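/- arXiv:2308.11566 — 3 statements merged into one kernel-verified Lean document; each statement's English description precedes it below -/
import Mathlib

section
/- There are exactly two GL_16(ℤ)-equivalence classes of positive definite integral quadratic forms in 16 variables with discriminant 1. -/
open scoped BigOperators

/-- The integral quadratic form `Q(x) = ∑_{i ≤ j} a_{ij} x_i x_j` attached to the
coefficient matrix `a` (only entries with `i ≤ j` are used). -/
def Qform {n : ℕ} (a : Matrix (Fin n) (Fin n) ℤ) (x : Fin n → ℤ) : ℤ :=
  ∑ i, ∑ j, if i ≤ j then a i j * x i * x j else 0

/-- The associated bilinear form `T(x,y) = Q(x+y) - Q(x) - Q(y)`. -/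
def Tbil {n : ℕ} (a : Matrix (Fin n) (Fin n) ℤ) (x y : Fin n → ℤ) : ℤ :=
  Qform a (x + y) - Qform a x - Qform a y

/-- The Gram matrix `[T] = (T(e_i, e_j))_{i,j}`. -/
def gram {n : ℕ} (a : Matrix (Fin n) (Fin n) ℤ) : Matrix (Fin n) (Fin n) ℤ :=
  Matrix.of fun i j => Tbil a (Pi.single i 1) (Pi.single j 1)

/-- `ε(n) = 0` if `n` is even, `1` if `n` is odd. -/
def eps (n : ℕ) : ℕ := if Even n then 0 else 1

/-- `Q` has (half-)discriminant `d`, i.e. `det [T] = 2^{ε(n)} d`. -/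
def HasDisc {n : ℕ} (a : Matrix (Fin n) (Fin n) ℤ) (d : ℤ) : Prop :=
  (gram a).det = 2 ^ (eps n) * d

/-- `Q` is positive definite: `Q(x) > 0` for all `x ≠ 0`. -/
def PosDef {n : ℕ} (a : Matrix (Fin n) (Fin n) ℤ) : Prop :=
  ∀ x : Fin n → ℤ, x ≠ 0 → 0 < Qform a x

/-- Two integral quadratic forms (as functions) are `GL_n(ℤ)`-equivalent:
`Q'(x) = Q(g⁻¹ x)` for some `g ∈ GL_n(ℤ)`. -/
def FormEquiv {n : ℕ} (Q Q' : (Fin n → ℤ) → ℤ) : Prop :=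
  ∃ g : GL (Fin n) ℤ, ∀ x, Q' x = Q (Matrix.mulVec (↑(g⁻¹) : Matrix (Fin n) (Fin n) ℤ) x)



open UpperHalfPlane ModularForm ModularFormClass MatrixGroups EisensteinSeries SlashInvariantForm ModularGroup in
theorem exists_modularForm_of_series (k : ℤ) (a : ℕ → ℂ) (F : ℍ → ℂ)
    (hF : ∀ τ : ℍ, HasSum (fun m ↦ a m • Function.Periodic.qParam 1 τ ^ m) (F τ))
    (hS : ∀ τ : ℍ, F (ModularGroup.S • τ) = (τ : ℂ) ^ k * F τ) :
    ∃ f : ModularForm 𝒮ℒ k, ∀ n, (qExpansion 1 f).coeff n = a n := by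
  have hS' : F ∣[k] S = F := by
    ext τ
    rw [SL_slash_apply, hS, denom_S]
    have : (τ : ℂ) ≠ 0 := ne_zero τ
    rw [mul_assoc, mul_comm (F τ), ← mul_assoc, ← zpow_add₀ this]
    simp
  have hT' : F ∣[k] T = F := by
    ext τ
    have h1 := hF (T • τ)
    have : Function.Periodic.qParam 1 ((T • τ : ℍ) : ℂ) = Function.Periodic.qParam 1 τ := by
      rw [modular_T_smul]
      simp only [Function.Periodic.qParam, coe_vadd]
      rw [← Complex.exp_periodic (2 * Real.pi * Complex.I * (τ : ℂ) / (1 : ℝ))]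
      congr 1
      push_cast
      ring
    rw [this] at h1
    have := h1.unique (hF τ)
    have hd : denom T τ = 1 := by simp [ModularGroup.denom_apply]
    rw [SL_slash_apply, this, hd]
    simp
  have hbd := isBoundedAtImInfty_of_hasSum_qExpansion one_pos hF
  have hhol : DifferentiableOn ℂ (fun q : ℂ => ∑' n, a n * q ^ n) (Metric.ball 0 1) := by
    have hsum : ∀ r : ℝ, 0 < r → r < 1 → Summable fun n => ‖a n‖ * r ^ n := by
      intro r hr hr1
      have h1 := Function.Periodic.im_invQParam_pos_of_norm_lt_one (h := 1) (q := (r : ℂ)) one_pos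
        (by simpa [abs_of_pos hr] using hr1) (by exact_mod_cast hr.ne')
      have h2 := (hF ⟨Function.Periodic.invQParam 1 r, h1⟩).summable.norm
      have h3 := Function.Periodic.qParam_right_inv (h := 1) one_ne_zero (q := (r : ℂ)) (by exact_mod_cast hr.ne')
      simpa [h3, abs_of_pos hr] using h2
    intro q hq
    have hq1 : ‖q‖ < 1 := by simpa using hq
    obtain ⟨r, hr, hr1⟩ := exists_between hq1
    have hr0 : 0 < r := (norm_nonneg q).trans_lt hr
    have := Complex.differentiableOn_tsum_of_summable_norm (F := fun n (q : ℂ) => a n * q ^ n)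
      (U := Metric.ball 0 r) (hsum r hr0 hr1) (fun n => by fun_prop) Metric.isOpen_ball
      (fun n w hw => by
        have : ‖w‖ < r := by simpa using hw
        rw [norm_mul, norm_pow]
        gcongr)
    exact (this.differentiableAt (Metric.isOpen_ball.mem_nhds (by simpa using hr))).differentiableWithinAt
  let f : ModularForm 𝒮ℒ k :=
    { toFun := F
      slash_action_eq' := by
        intro A hA
        obtain ⟨A, rfl⟩ := hA
        exact slash_action_generators_SL2Z hS' hT' A
      holo' := by
        rw [UpperHalfPlane.mdifferentiable_iff]
        have : DifferentiableOn ℂ ((fun q : ℂ => ∑' n, a n * q ^ n) ∘ Function.Periodic.qParam 1) {z | 0 < z.im} := by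
          refine hhol.comp (Function.Periodic.differentiable_qParam).differentiableOn ?_
          intro z hz
          simpa using Function.Periodic.norm_qParam_lt_one one_pos hz
        refine this.congr fun z hz => ?_
        have := (hF (ofComplex z)).tsum_eq
        simp only [smul_eq_mul] at this
        refine this.symm.trans ?_
        rw [ofComplex_apply_of_im_pos hz]
        rfl
      bdd_at_cusps' := by
        intro c hc
        rw [Subgroup.IsArithmetic.isCusp_iff_isCusp_SL2Z] at hc
        rw [OnePoint.isBoundedAt_iff_forall_SL2Z hc]
        intro γ _
        rw [slash_action_generators_SL2Z hS' hT']
        exact hbd }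
  exact ⟨f, fun n => (ModularFormClass.qExpansion_coeff_unique one_pos one_mem_strictPeriods_SL (f := f) hF n).symm⟩

open UpperHalfPlane ModularForm ModularFormClass MatrixGroups EisensteinSeries in
theorem weight_ten_coeff (a : ℕ → ℂ) (F : ℍ → ℂ) (h0 : a 0 = 0)
    (hF : ∀ τ : ℍ, HasSum (fun m ↦ a m • Function.Periodic.qParam 1 τ ^ m) (F τ))
    (hS : ∀ τ : ℍ, F (ModularGroup.S • τ) = (τ : ℂ) ^ (10 : ℤ) * F τ) : a 1 = 0 := by
  obtain ⟨f, hf⟩ := exists_modularForm_of_series 10 a F hF hS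
  have : f = 0 := by
    apply sturm_bound_levelOne
    have : (qExpansion 1 f).order ≠ 0 := by
      rw [PowerSeries.order_ne_zero_iff_constCoeff_eq_zero, ← PowerSeries.coeff_zero_eq_constantCoeff_apply, hf, h0]
    simpa using pos_iff_ne_zero.mpr this
  rw [← hf 1, this]
  simp [qExpansion_zero]

open UpperHalfPlane ModularForm ModularFormClass MatrixGroups EisensteinSeries in
theorem weight_eight_coeff (a : ℕ → ℂ) (F : ℍ → ℂ) (h0 : a 0 = 1)
    (hF : ∀ τ : ℍ, HasSum (fun m ↦ a m • Function.Periodic.qParam 1 τ ^ m) (F τ))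
    (hS : ∀ τ : ℍ, F (ModularGroup.S • τ) = (τ : ℂ) ^ (8 : ℤ) * F τ) : a 1 = 480 := by
  obtain ⟨f, hf⟩ := exists_modularForm_of_series 8 a F hF hS
  let g : ModularForm 𝒮ℒ 8 := ModularForm.mcast (by decide) (E₄.pow 2)
  have hg : qExpansion 1 g = qExpansion 1 E₄ * qExpansion 1 E₄ := by
    simp only [g, coe_mcast, ModularForm.qExpansion_pow one_pos one_mem_strictPeriods_SL]
    ring
  have hq : qExpansion 1 (f - g : ModularForm 𝒮ℒ 8) = qExpansion 1 f - qExpansion 1 E₄ * qExpansion 1 E₄ := by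
    simp only [FunLike.coe_sub, ModularForm.qExpansion_sub one_pos one_mem_strictPeriods_SL, hg]
  have : f - g = 0 := by
    apply sturm_bound_levelOne
    have : (qExpansion 1 (f - g : ModularForm 𝒮ℒ 8)).order ≠ 0 := by
      rw [PowerSeries.order_ne_zero_iff_constCoeff_eq_zero, ← PowerSeries.coeff_zero_eq_constantCoeff_apply, hq]
      simp [hf, h0, PowerSeries.coeff_mul, -PowerSeries.coeff_zero_eq_constantCoeff,
        E_qExpansion_coeff_zero _ ⟨2, rfl⟩]
    simpa using pos_iff_ne_zero.mpr this
  have h1 : (qExpansion 1 (f - g : ModularForm 𝒮ℒ 8)).coeff 1 = 0 := by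
    rw [this]; simp [qExpansion_zero]
  rw [hq, map_sub, hf 1] at h1
  norm_num [PowerSeries.coeff_mul, Finset.Nat.antidiagonal_succ, E₄_qExpansion_coeff_one,
    E_qExpansion_coeff_zero _ ⟨2, rfl⟩] at h1
  linear_combination h1


theorem hasSum_mul_pair {α β : Type*} (f : α → ℂ) (g : β → ℂ) (a b : ℂ) (hf : HasSum f a) (hg : HasSum g b) :
    HasSum (fun p : α × β => f p.1 * g p.2) (a * b) :=
  HasSum.mul hf hg (summable_mul_of_summable_norm hf.summable.norm hg.summable.norm)

theorem hasSum_pi_prod (n : ℕ) (g : Fin n → ℤ → ℂ) (hg : ∀ i, Summable (g i)) :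
    HasSum (fun m : Fin n → ℤ => ∏ i, g i (m i)) (∏ i, ∑' m, g i m) := by
  induction n with
  | zero =>
    simp only [Finset.univ_eq_empty, Finset.prod_empty]
    exact hasSum_unique (fun _ : Fin 0 → ℤ => (1 : ℂ))
  | succ n ih =>
    have h1 := ih (fun i => g i.succ) (fun i => hg _)
    have h2 := (hg 0).hasSum
    have h3 := hasSum_mul_pair _ _ _ _ h2 h1
    rw [Fin.prod_univ_succ]
    rw [← (Fin.consEquiv (fun _ : Fin (n+1) => ℤ)).hasSum_iff]
    convert h3 using 1
    funext p
    simp [Fin.prod_univ_succ, Fin.consEquiv]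

/-- the one-dimensional building block -/
noncomputable def thTerm (k d : ℕ) (τ : ℂ) (m : ℤ) : ℂ :=
  (m : ℂ) ^ k * Complex.exp (Real.pi * Complex.I * τ * m ^ 2 / d)

open Complex in
theorem thTerm_char_summable (k d : ℕ) (hk : k ≤ 1) (hd : 0 < d) (τ : ℂ) (hτ : 0 < τ.im) (h : ℤ) :
    Summable fun m : ℤ => exp (2 * Real.pi * I * h * m / d) * thTerm k d τ m := by
  have him : 0 < (τ / d).im := by
    rw [div_natCast_im]; positivity
  have hd' : (d : ℂ) ≠ 0 := by exact_mod_cast hd.ne'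
  interval_cases k
  · have := (summable_jacobiTheta₂_term_iff (h / d) (τ / d)).2 him
    refine this.congr fun m => ?_
    simp only [jacobiTheta₂_term, thTerm, pow_zero, one_mul]
    rw [← exp_add]
    congr 1; field_simp
  · have := ((summable_jacobiTheta₂'_term_iff (h / d) (τ / d)).2 him).mul_left (1 / (2 * Real.pi * I))
    refine this.congr fun m => ?_
    simp only [jacobiTheta₂'_term, jacobiTheta₂_term, thTerm, pow_one]
    have hpi : (Real.pi : ℂ) ≠ 0 := by exact_mod_cast Real.pi_ne_zero
    have : 2 * (Real.pi : ℂ) * I * m * (h / d) + Real.pi * I * m ^ 2 * (τ / d) = 2 * Real.pi * I * h * m / d + Real.pi * I * τ * m ^ 2 / d := by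
      field_simp
    rw [this, exp_add]
    field_simp

open Complex in
theorem thTerm_functional (k d : ℕ) (hk : k ≤ 1) (hd : 0 < d) (τ : ℂ) (hτ : 0 < τ.im) (h : ℤ) :
    ∑' m : ℤ, exp (2 * Real.pi * I * h * m / d) * thTerm k d (-1 / τ) m =
      (1 / (I / (τ * d)) ^ (1 / 2 : ℂ)) * τ ^ k * ∑' n : ℤ, thTerm k d τ (h + d * n) := by
  have hτ0 : τ ≠ 0 := by rintro rfl; simp at hτ
  have hd' : (d : ℂ) ≠ 0 := by exact_mod_cast hd.ne'
  have hpi : (Real.pi : ℂ) ≠ 0 := by exact_mod_cast Real.pi_ne_zero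
  have e1 : -I * (-1 / τ / d) = I / (τ * d) := by field_simp
  have e2 : -1 / (-1 / τ / (d : ℂ)) = d * τ := by field_simp
  have e3 : (h : ℂ) / d / (-1 / τ / d) = - h * τ := by field_simp
  have hdτ : 0 < ((d : ℂ) * τ).im := by
    simp; positivity
  have hneg : ∑' n : ℤ, thTerm k d τ (h + d * n) = ∑' n : ℤ, thTerm k d τ (h - d * n) := by
    rw [← (Equiv.neg ℤ).tsum_eq]
    refine tsum_congr fun n => ?_
    simp [sub_eq_add_neg]
  rw [hneg]
  interval_cases k
  · have := jacobiTheta₂_functional_equation (h / d) (-1 / τ / d)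
    rw [e1, e2, e3] at this
    have l : ∑' m : ℤ, exp (2 * Real.pi * I * h * m / d) * thTerm 0 d (-1 / τ) m = jacobiTheta₂ (h / d) (-1 / τ / d) := by
      refine tsum_congr fun m => ?_
      simp only [jacobiTheta₂_term, thTerm, pow_zero, one_mul]
      rw [← exp_add]
      congr 1; field_simp
    rw [l, this, pow_zero, mul_one, mul_assoc]
    congr 1
    rw [jacobiTheta₂, ← tsum_mul_left]
    refine tsum_congr fun m => ?_
    simp only [jacobiTheta₂_term, thTerm, pow_zero, one_mul]
    rw [← exp_add]
    congr 1
    push_cast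
    field_simp
    ring
  · have := jacobiTheta₂'_functional_equation (h / d) (-1 / τ / d)
    rw [e1, e2, e3] at this
    have l : ∑' m : ℤ, exp (2 * Real.pi * I * h * m / d) * thTerm 1 d (-1 / τ) m = 1 / (2 * Real.pi * I) * jacobiTheta₂' (h / d) (-1 / τ / d) := by
      rw [jacobiTheta₂', ← tsum_mul_left]
      refine tsum_congr fun m => ?_
      simp only [jacobiTheta₂'_term, jacobiTheta₂_term, thTerm, pow_one]
      have : 2 * (Real.pi : ℂ) * I * m * (h / d) + Real.pi * I * m ^ 2 * (-1 / τ / d) = 2 * Real.pi * I * h * m / d + Real.pi * I * (-1 / τ) * m ^ 2 / d := by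
        field_simp
      rw [this, exp_add]
      field_simp
    have h1 := hasSum_jacobiTheta₂'_term (- h * τ) hdτ
    have h2 := (hasSum_jacobiTheta₂_term (- h * τ) hdτ).mul_left (2 * Real.pi * I * (h / d))
    have h3 := ((h1.sub h2).mul_left (-(d : ℂ) / (2 * Real.pi * I) * exp (-Real.pi * I * (h / d) ^ 2 / (-1 / τ / d)))).tsum_eq
    rw [l, this]
    have h4 : ∑' n : ℤ, thTerm 1 d τ (h - d * n) = -(d : ℂ) / (2 * Real.pi * I) * exp (-Real.pi * I * (h / d) ^ 2 / (-1 / τ / d)) *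
        (jacobiTheta₂' (-h * τ) (d * τ) - 2 * Real.pi * I * (h / d) * jacobiTheta₂ (-h * τ) (d * τ)) := by
      rw [← h3]
      refine tsum_congr fun m => ?_
      simp only [jacobiTheta₂'_term, jacobiTheta₂_term, thTerm, pow_one]
      have : exp (Real.pi * I * τ * ((h - d * m : ℤ) : ℂ) ^ 2 / d) = exp (-Real.pi * I * (h / d) ^ 2 / (-1 / τ / d)) * exp (2 * Real.pi * I * m * (-h * τ) + Real.pi * I * m ^ 2 * (d * τ)) := by
        rw [← exp_add]; congr 1
        push_cast
        field_simp
        ring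
      rw [this]
      push_cast
      field_simp
      ring
    rw [h4]
    field_simp

theorem residue_bijective (n : ℕ) (d : Fin n → ℕ) [∀ i, NeZero (d i)] :
    Function.Bijective (fun (p : (∀ i, ZMod (d i)) × (Fin n → ℤ)) (i : Fin n) => (((p.1 i).val : ℤ) + d i * p.2 i : ℤ)) := by
  constructor
  · rintro ⟨h, m⟩ ⟨h', m'⟩ heq
    have h1 : h = h' := by
      funext i
      have := congrArg (fun z : ℤ => (z : ZMod (d i))) (congrFun heq i)
      simpa using this
    subst h1
    have h2 : m = m' := by
      funext i
      have := congrFun heq i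
      have hd : (d i : ℤ) ≠ 0 := by exact_mod_cast NeZero.ne (d i)
      simpa [hd, NeZero.ne (d i)] using this
    rw [h2]
  · intro m
    have : ∀ i, ∃ z : ℤ, m i = ((m i : ZMod (d i)).val : ℤ) + d i * z := by
      intro i
      have : (((m i : ZMod (d i)).val : ℤ) : ZMod (d i)) = (m i : ZMod (d i)) := by simp
      rw [ZMod.intCast_eq_intCast_iff_dvd_sub] at this
      obtain ⟨z, hz⟩ := this
      exact ⟨z, by linarith⟩
    choose z hz using this
    exact ⟨(fun i => (m i : ZMod (d i)), z), by funext i; exact (hz i).symm⟩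


open Complex in
theorem expchar_congr (d : ℕ) [NeZero d] (x y m : ℤ) (h : (x : ZMod d) = (y : ZMod d)) :
    exp (2 * Real.pi * I * x * m / d) = exp (2 * Real.pi * I * y * m / d) := by
  rw [ZMod.intCast_eq_intCast_iff_dvd_sub] at h
  obtain ⟨z, hz⟩ := h
  have hy : y = x + d * z := by linarith
  have hd' : (d : ℂ) ≠ 0 := by exact_mod_cast NeZero.ne d
  rw [hy, Complex.exp_eq_exp_iff_exists_int]
  refine ⟨-(z * m), ?_⟩
  push_cast
  field_simp
  ring

open Complex in
theorem prod_expchar {n : ℕ} (d : Fin n → ℕ) (h m : Fin n → ℤ) :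
    ∏ i, exp (2 * Real.pi * I * h i * m i / d i) =
      exp (2 * Real.pi * I * ((∑ i, (h i : ℚ) * m i / d i : ℚ) : ℂ)) := by
  rw [← Complex.exp_sum]
  congr 1
  push_cast
  rw [Finset.mul_sum]
  refine Finset.sum_congr rfl fun i _ => ?_
  ring

open Complex in
theorem exp_rat_eq_one_iff (q : ℚ) : exp (2 * Real.pi * I * (q : ℂ)) = 1 ↔ ∃ z : ℤ, q = z := by
  rw [Complex.exp_eq_one_iff]
  have h : (2 * Real.pi * I : ℂ) ≠ 0 := by simp [Real.pi_ne_zero]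
  constructor
  · rintro ⟨z, hz⟩
    refine ⟨z, ?_⟩
    have : (2 * Real.pi * I) * (q : ℂ) = 2 * Real.pi * I * z := by rw [hz]; ring
    have := mul_left_cancel₀ h this
    exact_mod_cast this
  · rintro ⟨z, rfl⟩
    exact ⟨z, by push_cast; ring⟩

open Classical in
/-- residues of a lattice -/
noncomputable def residues {n : ℕ} (d : Fin n → ℕ) [∀ i, NeZero (d i)] (H : AddSubgroup (Fin n → ℤ)) :
    Finset (∀ i, ZMod (d i)) :=
  Finset.univ.filter fun h => (fun i => ((h i).val : ℤ)) ∈ H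

theorem mem_iff_of_residue {n : ℕ} (d : Fin n → ℕ) (H : AddSubgroup (Fin n → ℤ))
    (hdH : ∀ m : Fin n → ℤ, (fun i => (d i : ℤ) * m i) ∈ H) (x y : Fin n → ℤ)
    (h : ∀ i, (x i : ZMod (d i)) = y i) : x ∈ H ↔ y ∈ H := by
  have : ∀ i, ∃ z : ℤ, y i - x i = d i * z := by
    intro i
    have := h i
    rw [ZMod.intCast_eq_intCast_iff_dvd_sub] at this
    exact this
  choose z hz using this
  have hy : y = x + (fun i => (d i : ℤ) * z i) := by
    funext i
    have := hz i
    simp; linarith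
  rw [hy]
  exact (H.add_mem_cancel_right (hdH z)).symm

open Complex Classical in
theorem residue_orthogonality {n : ℕ} (d : Fin n → ℕ) [∀ i, NeZero (d i)] (H : AddSubgroup (Fin n → ℤ))
    (hdH : ∀ m : Fin n → ℤ, (fun i => (d i : ℤ) * m i) ∈ H)
    (hdual : ∀ m, m ∈ H ↔ ∀ h ∈ H, ∃ z : ℤ, ∑ i, (h i : ℚ) * m i / d i = z) (m : Fin n → ℤ) :
    ∑ h ∈ residues d H, ∏ i, exp (2 * Real.pi * I * ((h i).val : ℤ) * m i / d i) =
      if m ∈ H then ((residues d H).card : ℂ) else 0 := by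
  split_ifs with hm
  · rw [Finset.card_eq_sum_ones]
    push_cast
    refine Finset.sum_congr rfl fun h hh => ?_
    have hh' : (fun i => ((h i).val : ℤ)) ∈ H := by simpa [residues] using hh
    have := prod_expchar d (fun i => ((h i).val : ℤ)) m
    rw [(exp_rat_eq_one_iff _).2 ((hdual m).1 hm _ hh')] at this
    exact this
  · rw [hdual] at hm
    push Not at hm
    obtain ⟨h0, h0H, hne⟩ := hm
    have hE : exp (2 * Real.pi * I * ((∑ i, (h0 i : ℚ) * m i / d i : ℚ) : ℂ)) ≠ 1 := by
      rw [Ne, exp_rat_eq_one_iff]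
      push Not
      exact hne
    rw [← prod_expchar] at hE
    set S := ∑ h ∈ residues d H, ∏ i, exp (2 * Real.pi * I * ((h i).val : ℤ) * m i / d i) with hS
    have key : S = S * ∏ i, exp (2 * Real.pi * I * h0 i * m i / d i) := by
      rw [hS, Finset.sum_mul]
      symm
      refine Finset.sum_equiv (Equiv.addRight (fun i => ((h0 i : ℤ) : ZMod (d i)))) ?_ ?_
      · intro h
        simp only [residues, Finset.mem_filter, Finset.mem_univ, true_and, Equiv.coe_addRight]
        rw [← H.add_mem_cancel_right h0H]
        apply mem_iff_of_residue d H hdH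
        intro i
        simp
      · intro h _
        rw [← Finset.prod_mul_distrib]
        refine Finset.prod_congr rfl fun i _ => ?_
        rw [← expchar_congr (d i) (((h i).val : ℤ) + h0 i)
          (((Equiv.addRight (fun i => ((h0 i : ℤ) : ZMod (d i))) h i).val : ℤ)) (m i) (by simp), ← exp_add]
        congr 1
        push_cast
        ring
    have : S * (∏ i, exp (2 * Real.pi * I * h0 i * m i / d i) - 1) = 0 := by
      rw [mul_sub, ← key]; ring
    rcases mul_eq_zero.1 this with h | h
    · exact h
    · exact absurd (sub_eq_zero.1 h) hE

theorem thTerm_summable (k d : ℕ) (hk : k ≤ 1) (hd : 0 < d) (τ : ℂ) (hτ : 0 < τ.im) :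
    Summable fun m : ℤ => thTerm k d τ m := by
  simpa using thTerm_char_summable k d hk hd τ hτ 0

theorem neg_inv_im_pos (τ : ℂ) (hτ : 0 < τ.im) : 0 < (-1 / τ).im := by
  have := (UpperHalfPlane.mk τ hτ).im_inv_neg_coe_pos
  rw [neg_div, one_div, neg_inv]
  exact this

open Complex Classical in
theorem theta_transform_aux {n : ℕ} (d : Fin n → ℕ) [∀ i, NeZero (d i)] (H : AddSubgroup (Fin n → ℤ))
    (hdH : ∀ m : Fin n → ℤ, (fun i => (d i : ℤ) * m i) ∈ H)
    (hdual : ∀ m, m ∈ H ↔ ∀ h ∈ H, ∃ z : ℤ, ∑ i, (h i : ℚ) * m i / d i = z)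
    (k : Fin n → ℕ) (hk : ∀ i, k i ≤ 1) (τ : ℂ) (hτ : 0 < τ.im) :
    ((residues d H).card : ℂ) * ∑' m : Fin n → ℤ, (if m ∈ H then ∏ i, thTerm (k i) (d i) (-1 / τ) (m i) else 0) =
      (∏ i, ((1 / (I / (τ * d i)) ^ (1 / 2 : ℂ)) * τ ^ k i)) *
        ∑' m : Fin n → ℤ, (if m ∈ H then ∏ i, thTerm (k i) (d i) τ (m i) else 0) := by
  have hd : ∀ i, 0 < d i := fun i => Nat.pos_of_ne_zero (NeZero.ne _)
  have hτ' := neg_inv_im_pos τ hτ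
  have hs1 : ∀ h : ∀ i, ZMod (d i), HasSum (fun m : Fin n → ℤ => ∏ i, (exp (2 * Real.pi * I * ((h i).val : ℤ) * m i / d i) * thTerm (k i) (d i) (-1 / τ) (m i)))
      (∏ i, ((1 / (I / (τ * d i)) ^ (1 / 2 : ℂ)) * τ ^ k i * ∑' n : ℤ, thTerm (k i) (d i) τ ((h i).val + d i * n))) := by
    intro h
    have := hasSum_pi_prod n (fun i m => exp (2 * Real.pi * I * ((h i).val : ℤ) * m / d i) * thTerm (k i) (d i) (-1 / τ) m)
      (fun i => thTerm_char_summable (k i) (d i) (hk i) (hd i) _ hτ' _)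
    simp only [thTerm_functional _ _ (hk _) (hd _) τ hτ] at this
    exact this
  have hs2 : ∀ h : ∀ i, ZMod (d i), HasSum (fun m : Fin n → ℤ => ∏ i, thTerm (k i) (d i) τ ((h i).val + d i * m i))
      (∏ i, ∑' n : ℤ, thTerm (k i) (d i) τ ((h i).val + d i * n)) := by
    intro h
    refine hasSum_pi_prod n (fun i m => thTerm (k i) (d i) τ ((h i).val + d i * m)) (fun i => ?_)
    have hinj : Function.Injective (fun m : ℤ => (((h i).val : ℤ) + d i * m)) := by
      intro a b hab
      have : (d i : ℤ) ≠ 0 := by exact_mod_cast (hd i).ne'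
      simpa [this, NeZero.ne (d i)] using hab
    exact (thTerm_summable (k i) (d i) (hk i) (hd i) τ hτ).comp_injective hinj
  have hs3 : Summable (fun m : Fin n → ℤ => if m ∈ H then ∏ i, thTerm (k i) (d i) τ (m i) else 0) := by
    have := (hasSum_pi_prod n (fun i m => thTerm (k i) (d i) τ m) (fun i => thTerm_summable (k i) (d i) (hk i) (hd i) τ hτ)).summable
    exact this.indicator (H : Set (Fin n → ℤ))
  -- left side
  have hL := (hasSum_sum (s := residues d H) fun h _ => hs1 h).tsum_eq
  have hL' : ∀ m : Fin n → ℤ, ∑ h ∈ residues d H, ∏ i, (exp (2 * Real.pi * I * ((h i).val : ℤ) * m i / d i) * thTerm (k i) (d i) (-1 / τ) (m i)) =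
      ((residues d H).card : ℂ) * (if m ∈ H then ∏ i, thTerm (k i) (d i) (-1 / τ) (m i) else 0) := by
    intro m
    simp only [Finset.prod_mul_distrib]
    rw [← Finset.sum_mul, residue_orthogonality d H hdH hdual]
    split_ifs <;> simp
  simp only [hL'] at hL
  rw [tsum_mul_left] at hL
  rw [hL]
  -- right side
  let e := Equiv.ofBijective _ (residue_bijective n d)
  have hs4 : Summable (fun p => if e p ∈ H then ∏ i, thTerm (k i) (d i) τ (e p i) else 0) :=
    e.summable_iff.2 hs3
  rw [← e.tsum_eq, hs4.tsum_prod, tsum_fintype, Finset.mul_sum]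
  have : ∀ h : ∀ i, ZMod (d i), ∑' m : Fin n → ℤ, (if e (h, m) ∈ H then ∏ i, thTerm (k i) (d i) τ (e (h, m) i) else 0) =
      if h ∈ residues d H then ∏ i, ∑' n : ℤ, thTerm (k i) (d i) τ ((h i).val + d i * n) else 0 := by
    intro h
    have h1 : ∀ m, e (h, m) ∈ H ↔ h ∈ residues d H := by
      intro m
      simp only [residues, Finset.mem_filter, Finset.mem_univ, true_and]
      apply mem_iff_of_residue d H hdH
      intro i
      simp [e]
    simp only [h1]
    split_ifs with hh
    · exact (hs2 h).tsum_eq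
    · simp
  simp only [this, mul_ite, mul_zero]
  rw [← Finset.sum_filter, Finset.filter_mem_eq_inter, Finset.univ_inter]
  refine Finset.sum_congr rfl fun h _ => ?_
  rw [← Finset.prod_mul_distrib]


open Matrix in
/-- data of an orthogonal family in a unimodular lattice -/
structure OrthFrame {n : ℕ} (A : Matrix (Fin n) (Fin n) ℤ) (d : Fin n → ℕ) (W : Matrix (Fin n) (Fin n) ℤ) : Prop where
  sym : Aᵀ = A
  det : A.det = 1
  gram : W * A * Wᵀ = Matrix.diagonal (fun i => (d i : ℤ))
  pos : ∀ i, 0 < d i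

namespace OrthFrame
open Matrix

variable {n : ℕ} {A : Matrix (Fin n) (Fin n) ℤ} {d : Fin n → ℕ} {W : Matrix (Fin n) (Fin n) ℤ}

theorem left_inv (h : OrthFrame A d W) :
    ((W.map (Int.cast : ℤ → ℚ))ᵀ * Matrix.diagonal (fun i => (d i : ℚ)⁻¹)) *
      ((W * A).map (Int.cast : ℤ → ℚ)) = 1 := by
  rw [mul_eq_one_comm]
  have h1 := congrArg (fun M : Matrix (Fin n) (Fin n) ℤ => M.map (Int.castRingHom ℚ)) h.gram
  simp only [Matrix.map_mul] at h1
  rw [← Matrix.mul_assoc]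
  have h2 : (W * A).map (Int.cast : ℤ → ℚ) * (W.map (Int.cast : ℤ → ℚ))ᵀ = Matrix.diagonal (fun i => (d i : ℚ)) := by
    have h3 : ((W * A).map (Int.castRingHom ℚ)) * (W.map (Int.castRingHom ℚ))ᵀ = Matrix.diagonal (fun i => (d i : ℚ)) := by
      rw [Matrix.map_mul, ← Matrix.transpose_map, h1]
      ext i j
      simp [Matrix.diagonal_apply]
    exact h3
  rw [h2, Matrix.diagonal_mul_diagonal]
  ext i j
  have := h.pos i
  rw [Matrix.diagonal_apply, Matrix.one_apply]
  split_ifs with hij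
  · field_simp
  · rfl

theorem pairing (h : OrthFrame A d W) (x y : Fin n → ℤ) :
    ∑ i, (((W * A) *ᵥ x) i : ℚ) * (((W * A) *ᵥ y) i : ℚ) / d i = ((x ⬝ᵥ A *ᵥ y : ℤ) : ℚ) := by
  set c : ℤ → ℚ := Int.cast with hc
  have e1 : ∀ (M : Matrix (Fin n) (Fin n) ℤ) (v : Fin n → ℤ), (fun i => c ((M *ᵥ v) i)) = (M.map c) *ᵥ (fun i => c (v i)) := by
    intro M v
    ext i
    exact RingHom.map_mulVec (Int.castRingHom ℚ) M v i
  have e2 : ∀ v w : Fin n → ℤ, c (v ⬝ᵥ w) = (fun i => c (v i)) ⬝ᵥ (fun i => c (w i)) := by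
    intro v w
    exact RingHom.map_dotProduct (Int.castRingHom ℚ) v w
  have e3 : (A.map c) * (((W.map c)ᵀ * Matrix.diagonal (fun i => (d i : ℚ)⁻¹)) * ((W * A).map c)) = A.map c := by
    rw [h.left_inv, Matrix.mul_one]
  have e4 : (A.map c) * (W.map c)ᵀ = ((W * A).map c)ᵀ := by
    have : ((W * A).map (Int.castRingHom ℚ))ᵀ = (A.map (Int.castRingHom ℚ)) * (W.map (Int.castRingHom ℚ))ᵀ := by
      rw [Matrix.map_mul, Matrix.transpose_mul]
      congr 1
      rw [← Matrix.transpose_map, h.sym]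
    exact this.symm
  rw [e2, e1, ← e3, ← Matrix.mul_assoc, ← Matrix.mul_assoc, e4,
    ← Matrix.mulVec_mulVec (fun i => c (y i)) _ ((W * A).map c), ← e1,
    ← Matrix.mulVec_mulVec _ ((W * A).map c)ᵀ,
    Matrix.dotProduct_mulVec, Matrix.vecMul_transpose, ← e1]
  simp only [dotProduct, Matrix.mulVec_diagonal]
  refine Finset.sum_congr rfl fun i _ => ?_
  ring

theorem inj (h : OrthFrame A d W) : Function.Injective (fun x : Fin n → ℤ => (W * A) *ᵥ x) := by
  have hdet : (W * A).det ≠ 0 := by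
    intro h0
    have := congrArg Matrix.det h.gram
    rw [Matrix.det_mul, h0, zero_mul, Matrix.det_diagonal] at this
    exact Finset.prod_ne_zero_iff.2 (fun i _ => by exact_mod_cast (h.pos i).ne') this.symm
  exact Matrix.mulVec_injective_of_det_ne_zero hdet

/-- coordinates lattice -/
def latt (A W : Matrix (Fin n) (Fin n) ℤ) : AddSubgroup (Fin n → ℤ) :=
  ((W * A).mulVecLin.toAddMonoidHom).range

theorem mem_latt (m : Fin n → ℤ) : m ∈ latt A W ↔ ∃ x, (W * A) *ᵥ x = m := by
  simp [latt, AddMonoidHom.mem_range]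

theorem hdH (h : OrthFrame A d W) (m : Fin n → ℤ) : (fun i => (d i : ℤ) * m i) ∈ latt A W := by
  rw [mem_latt]
  refine ⟨Wᵀ *ᵥ m, ?_⟩
  rw [Matrix.mulVec_mulVec, h.gram]
  ext i
  simp [Matrix.mulVec_diagonal]

theorem hdual (h : OrthFrame A d W) (m : Fin n → ℤ) :
    m ∈ latt A W ↔ ∀ t ∈ latt A W, ∃ z : ℤ, ∑ i, (t i : ℚ) * m i / d i = z := by
  constructor
  · intro hm t ht
    obtain ⟨x, rfl⟩ := (mem_latt _).1 hm
    obtain ⟨y, rfl⟩ := (mem_latt _).1 ht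
    exact ⟨_, h.pairing y x⟩
  · intro hm
    have h1 : ∀ j, ∃ z : ℤ, ∑ i, (((W * A) i j : ℤ) : ℚ) * m i / d i = z := by
      intro j
      have := hm ((W * A) *ᵥ (Pi.single j 1)) ((mem_latt _).2 ⟨_, rfl⟩)
      simpa using this
    choose z hz using h1
    refine (mem_latt _).2 ⟨A⁻¹ *ᵥ z, ?_⟩
    have hA : A * A⁻¹ = 1 := Matrix.mul_nonsing_inv _ (by rw [h.det]; exact isUnit_one)
    rw [Matrix.mulVec_mulVec, Matrix.mul_assoc, hA, Matrix.mul_one]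
    -- W z = m
    set c : ℤ → ℚ := Int.cast with hc
    have e3 : ((W * A).map c) * ((W.map c)ᵀ * Matrix.diagonal (fun i => (d i : ℚ)⁻¹)) = 1 := by
      rw [mul_eq_one_comm]; exact h.left_inv
    have e4 : (A.map c) * (W.map c)ᵀ = ((W * A).map c)ᵀ := by
      have : ((W * A).map (Int.castRingHom ℚ))ᵀ = (A.map (Int.castRingHom ℚ)) * (W.map (Int.castRingHom ℚ))ᵀ := by
        rw [Matrix.map_mul, Matrix.transpose_mul]
        congr 1
        rw [← Matrix.transpose_map, h.sym]
      exact this.symm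
    have e5 : (W * A).map c = W.map c * A.map c := Matrix.map_mul (f := Int.castRingHom ℚ)
    have e6 : (fun j => c (z j)) = (((W * A).map c)ᵀ * Matrix.diagonal (fun i => (d i : ℚ)⁻¹)) *ᵥ (fun i => c (m i)) := by
      ext j
      rw [← Matrix.mulVec_mulVec]
      simp only [Matrix.mulVec, dotProduct, Matrix.transpose_apply, Matrix.map_apply, Matrix.diagonal_apply, ite_mul, zero_mul, Finset.sum_ite_eq, Finset.mem_univ, if_true]
      rw [← hz]
      refine Finset.sum_congr rfl fun i _ => ?_
      ring
    have e7 : (W.map c) *ᵥ (fun j => c (z j)) = fun i => c (m i) := by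
      rw [e6, Matrix.mulVec_mulVec, ← e4, ← Matrix.mul_assoc, ← Matrix.mul_assoc, ← e5, Matrix.mul_assoc, e3, Matrix.one_mulVec]
    ext i
    have := congrFun e7 i
    have h2 := RingHom.map_mulVec (Int.castRingHom ℚ) W z i
    have h3 : c ((W *ᵥ z) i) = c (m i) := by rw [← this]; exact h2
    exact Int.cast_injective h3

end OrthFrame


open Complex in
theorem prefactor_eq (d : Fin 16 → ℕ) (hd : ∀ i, 0 < d i) :
    ∃ c : ℂ, ∀ (τ : ℂ), 0 < τ.im → ∀ k : Fin 16 → ℕ,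
      ∏ i, ((1 / (I / (τ * d i)) ^ (1 / 2 : ℂ)) * τ ^ k i) = c * τ ^ (8 + ∑ i, k i) := by
  refine ⟨∏ i, 1 / exp ((Real.log (1 / d i) : ℝ) * (1 / 2 : ℂ)), fun τ hτ k => ?_⟩
  have hτ0 : τ ≠ 0 := by rintro rfl; simp at hτ
  have hI : I / τ ≠ 0 := div_ne_zero I_ne_zero hτ0
  have h1 : ∀ i, (I / (τ * d i)) ^ (1 / 2 : ℂ) = exp ((Real.log (1 / d i) : ℝ) * (1 / 2 : ℂ)) * (I / τ) ^ (1 / 2 : ℂ) := by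
    intro i
    have hdi : (0 : ℝ) < 1 / d i := by have := hd i; positivity
    have hdc : (d i : ℂ) ≠ 0 := by exact_mod_cast (hd i).ne'
    have e : I / (τ * d i) = ((1 / d i : ℝ) : ℂ) * (I / τ) := by
      push_cast; field_simp
    rw [e, cpow_def_of_ne_zero (mul_ne_zero (by exact_mod_cast hdi.ne') hI), Complex.log_ofReal_mul hdi hI, add_mul, exp_add,
      cpow_def_of_ne_zero hI]
  have h2 : ((I / τ) ^ (1 / 2 : ℂ)) ^ 16 = 1 / τ ^ 8 := by
    have : ((I / τ) ^ (1 / 2 : ℂ)) ^ 2 = I / τ := by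
      rw [← cpow_nat_mul]; norm_num
    calc ((I / τ) ^ (1 / 2 : ℂ)) ^ 16 = (((I / τ) ^ (1 / 2 : ℂ)) ^ 2) ^ 8 := by ring
      _ = (I / τ) ^ 8 := by rw [this]
      _ = (I ^ 4) ^ 2 / τ ^ 8 := by rw [div_pow]; ring
      _ = 1 / τ ^ 8 := by rw [I_pow_four]; norm_num
  rw [Finset.prod_mul_distrib, Finset.prod_pow_eq_pow_sum, pow_add, ← mul_assoc]
  congr 1
  have h3 : ∀ i, 1 / (I / (τ * d i)) ^ (1 / 2 : ℂ) = (1 / exp ((Real.log (1 / d i) : ℝ) * (1 / 2 : ℂ))) * ((I / τ) ^ (1 / 2 : ℂ))⁻¹ := by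
    intro i
    rw [h1]; simp only [one_div, mul_inv]
  simp only [h3]
  rw [Finset.prod_mul_distrib, Finset.prod_const, Finset.card_univ, Fintype.card_fin, inv_pow, h2]
  simp

namespace OrthFrame
open Matrix

variable {A : Matrix (Fin 16) (Fin 16) ℤ} {d : Fin 16 → ℕ} {W : Matrix (Fin 16) (Fin 16) ℤ}

/-- polynomial weight -/
def pol (A W : Matrix (Fin 16) (Fin 16) ℤ) (k : Fin 16 → ℕ) (x : Fin 16 → ℤ) : ℤ :=
  ∏ i, ((W * A) *ᵥ x) i ^ k i

/-- theta term -/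
noncomputable def term (A W : Matrix (Fin 16) (Fin 16) ℤ) (q : (Fin 16 → ℤ) → ℕ) (k : Fin 16 → ℕ) (τ : ℂ) (x : Fin 16 → ℤ) : ℂ :=
  (pol A W k x : ℂ) * Complex.exp (2 * Real.pi * Complex.I * τ) ^ (q x)

theorem prod_thTerm (h : OrthFrame A d W) (q : (Fin 16 → ℤ) → ℕ) (hq : ∀ x, x ⬝ᵥ A *ᵥ x = 2 * q x)
    (k : Fin 16 → ℕ) (τ : ℂ) (x : Fin 16 → ℤ) :
    ∏ i, thTerm (k i) (d i) τ (((W * A) *ᵥ x) i) = term A W q k τ x := by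
  simp only [thTerm, term, pol]
  rw [Finset.prod_mul_distrib, ← Complex.exp_sum, ← Complex.exp_nat_mul]
  push_cast
  congr 2
  have h1 := h.pairing x x
  rw [hq] at h1
  have h2 : ∑ i, (((W * A) *ᵥ x) i : ℂ) * (((W * A) *ᵥ x) i : ℂ) / d i = 2 * q x := by
    exact_mod_cast congrArg (fun t : ℚ => (t : ℂ)) h1
  calc _ = Real.pi * Complex.I * τ * ∑ i, (((W * A) *ᵥ x) i : ℂ) * (((W * A) *ᵥ x) i : ℂ) / d i := by
        rw [Finset.mul_sum]
        refine Finset.sum_congr rfl fun i _ => ?_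
        ring
    _ = _ := by rw [h2]; ring

theorem term_summable (h : OrthFrame A d W) (q : (Fin 16 → ℤ) → ℕ) (hq : ∀ x, x ⬝ᵥ A *ᵥ x = 2 * q x)
    (k : Fin 16 → ℕ) (hk : ∀ i, k i ≤ 1) (τ : ℂ) (hτ : 0 < τ.im) : Summable (term A W q k τ) := by
  have := (hasSum_pi_prod 16 (fun i m => thTerm (k i) (d i) τ m)
    (fun i => thTerm_summable (k i) (d i) (hk i) (h.pos i) τ hτ)).summable
  have h2 := this.comp_injective h.inj
  refine h2.congr fun x => ?_
  exact h.prod_thTerm q hq k τ x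

theorem theta_aux (h : OrthFrame A d W) (q : (Fin 16 → ℤ) → ℕ) (hq : ∀ x, x ⬝ᵥ A *ᵥ x = 2 * q x) :
    ∃ C : ℂ, ∀ (k : Fin 16 → ℕ) (_ : ∀ i, k i ≤ 1) (τ : ℂ) (_ : 0 < τ.im),
      ∑' x, term A W q k (-1 / τ) x = C * τ ^ (8 + ∑ i, k i) * ∑' x, term A W q k τ x := by
  classical
  haveI : ∀ i, NeZero (d i) := fun i => ⟨(h.pos i).ne'⟩
  obtain ⟨c, hc⟩ := prefactor_eq d h.pos
  refine ⟨c / (residues d (latt A W)).card, fun k hk τ hτ => ?_⟩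
  have hN : ((residues d (latt A W)).card : ℂ) ≠ 0 := by
    have : 0 < (residues d (latt A W)).card := by
      refine Finset.card_pos.2 ⟨0, ?_⟩
      simp only [residues, Finset.mem_filter, Finset.mem_univ, true_and]
      convert (latt A W).zero_mem using 1
      funext i
      simp
    exact_mod_cast this.ne'
  have key := theta_transform_aux d (latt A W) h.hdH h.hdual k hk τ hτ
  have conv : ∀ σ : ℂ, ∑' m : Fin 16 → ℤ, (if m ∈ latt A W then ∏ i, thTerm (k i) (d i) σ (m i) else 0) = ∑' x, term A W q k σ x := by
    intro σ
    rw [← h.inj.tsum_eq]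
    · refine tsum_congr fun x => ?_
      rw [if_pos ((mem_latt _).2 ⟨x, rfl⟩)]
      exact h.prod_thTerm q hq k σ x
    · intro m hm
      by_contra hcon
      apply hm
      refine if_neg fun hm' => hcon ?_
      obtain ⟨x, hx⟩ := (mem_latt _).1 hm'
      exact ⟨x, hx⟩
  rw [conv, conv, hc τ hτ] at key
  rw [div_mul_eq_mul_div, div_mul_eq_mul_div, eq_div_iff hN, mul_comm]
  exact key

theorem theta (h : OrthFrame A d W) (q : (Fin 16 → ℤ) → ℕ) (hq : ∀ x, x ⬝ᵥ A *ᵥ x = 2 * q x)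
    (k : Fin 16 → ℕ) (hk : ∀ i, k i ≤ 1) (τ : ℂ) (hτ : 0 < τ.im) :
      ∑' x, term A W q k (-1 / τ) x = τ ^ (8 + ∑ i, k i) * ∑' x, term A W q k τ x := by
  obtain ⟨C, hC⟩ := h.theta_aux q hq
  have hI := hC (fun _ => 0) (by simp) Complex.I (by simp)
  have e : (-1 / Complex.I) = Complex.I := by
    rw [div_eq_iff Complex.I_ne_zero]; simp
  have hne : ∑' x, term A W q (fun _ => 0) Complex.I x ≠ 0 := by
    have hs := h.term_summable q hq (fun _ => 0) (by simp) Complex.I (by simp)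
    have e1 : ∀ x, term A W q (fun _ => 0) Complex.I x = ((Real.exp (-(2 * Real.pi)) ^ (q x) : ℝ) : ℂ) := by
      intro x
      simp only [term, pol, pow_zero, Finset.prod_const_one, Int.cast_one, one_mul]
      push_cast
      congr 2
      have := Complex.I_mul_I
      linear_combination (2 * Real.pi : ℂ) * this
    have hs' : Summable fun x => Real.exp (-(2 * Real.pi)) ^ (q x) :=
      Complex.summable_ofReal.1 (hs.congr e1)
    simp only [e1]
    rw [← Complex.ofReal_tsum]
    have := hs'.tsum_pos (fun x => by positivity) 0 (by positivity)
    exact_mod_cast this.ne'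
  rw [e] at hI
  have hC1 : C = 1 := by
    have e8 : Complex.I ^ 8 = 1 := by
      calc Complex.I ^ 8 = (Complex.I ^ 4) ^ 2 := by ring
        _ = 1 := by rw [Complex.I_pow_four]; norm_num
    simp only [Finset.sum_const_zero, add_zero, e8, mul_one] at hI
    exact (mul_right_cancel₀ hne (by rw [one_mul]; exact hI)).symm
  rw [hC k hk τ hτ, hC1, one_mul]

open UpperHalfPlane

theorem fiber_hasSum (h : OrthFrame A d W) (q : (Fin 16 → ℤ) → ℕ) (hq : ∀ x, x ⬝ᵥ A *ᵥ x = 2 * q x)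
    (k : Fin 16 → ℕ) (hk : ∀ i, k i ≤ 1) (τ : ℍ) :
    HasSum (fun m => (∑' x : q ⁻¹' {m}, (pol A W k x : ℂ)) • Function.Periodic.qParam 1 τ ^ m) (∑' x, term A W q k τ x) := by
  have hs := (h.term_summable q hq k hk τ τ.2).hasSum.tsum_fiberwise q
  have e : (fun m => (∑' x : q ⁻¹' {m}, (pol A W k x : ℂ)) • Function.Periodic.qParam 1 τ ^ m) =
      fun c => ∑' b : q ⁻¹' {c}, term A W q k τ b := by
    funext m
    rw [smul_eq_mul, ← tsum_mul_right]
    refine tsum_congr fun x => ?_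
    have : q x = m := x.2
    simp only [term, this]
    congr 2
    simp [Function.Periodic.qParam]
  rw [e]
  exact hs

theorem theta_S (h : OrthFrame A d W) (q : (Fin 16 → ℤ) → ℕ) (hq : ∀ x, x ⬝ᵥ A *ᵥ x = 2 * q x)
    (k : Fin 16 → ℕ) (hk : ∀ i, k i ≤ 1) (τ : ℍ) :
    ∑' x, term A W q k ((ModularGroup.S • τ : ℍ) : ℂ) x = (τ : ℂ) ^ (8 + ∑ i, k i) * ∑' x, term A W q k τ x := by
  rw [← h.theta q hq k hk τ τ.2, UpperHalfPlane.modular_S_smul]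
  have : ((UpperHalfPlane.mk (-τ : ℂ)⁻¹ τ.im_inv_neg_coe_pos : ℍ) : ℂ) = -1 / (τ : ℂ) := by
    rw [neg_div, one_div, neg_inv]
  rw [this]

theorem roots_finite (h : OrthFrame A d W) (q : (Fin 16 → ℤ) → ℕ) (hq : ∀ x, x ⬝ᵥ A *ᵥ x = 2 * q x) (m : ℕ) :
    (q ⁻¹' {m}).Finite := by
  have hs := h.term_summable q hq (fun _ => 0) (by simp) Complex.I (by simp)
  have h2 := hs.subtype (q ⁻¹' {m})
  have : (fun x : q ⁻¹' {m} => Complex.exp (2 * Real.pi * Complex.I * Complex.I) ^ m) = (term A W q (fun _ => 0) Complex.I ∘ Subtype.val) := by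
    funext x
    have : q x = m := x.2
    simp [term, pol, this]
  replace h2 : Summable (fun x : q ⁻¹' {m} => Complex.exp (2 * Real.pi * Complex.I * Complex.I) ^ m) := by
    rw [this]; exact h2
  by_contra hinf
  haveI : Infinite (q ⁻¹' {m}) := Set.infinite_coe_iff.2 hinf
  rw [summable_const_iff] at h2
  exact pow_ne_zero _ (Complex.exp_ne_zero _) h2

theorem tsum_fiber (h : OrthFrame A d W) (q : (Fin 16 → ℤ) → ℕ) (hq : ∀ x, x ⬝ᵥ A *ᵥ x = 2 * q x)
    (R : Finset (Fin 16 → ℤ)) (m : ℕ) (hR : ∀ x, x ∈ R ↔ q x = m) (k : Fin 16 → ℕ) :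
    ∑' x : q ⁻¹' {m}, (pol A W k x : ℂ) = ((∑ x ∈ R, pol A W k x : ℤ) : ℂ) := by
  have : q ⁻¹' {m} = (R : Set (Fin 16 → ℤ)) := by ext x; simp [hR]
  rw [this, Finset.tsum_subtype' R (fun x => (pol A W k x : ℂ))]
  push_cast
  rfl

theorem fiber_zero (h : OrthFrame A d W) (q : (Fin 16 → ℤ) → ℕ) (hq : ∀ x, x ⬝ᵥ A *ᵥ x = 2 * q x)
    (hpos : ∀ x, x ≠ 0 → 0 < q x) (k : Fin 16 → ℕ) :
    ∑' x : q ⁻¹' {0}, (pol A W k x : ℂ) = pol A W k 0 := by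
  rw [h.tsum_fiber q hq {0} 0 _ k]
  · simp
  · intro x
    rw [Finset.mem_singleton]
    constructor
    · rintro rfl
      have := hq 0
      simp at this
      omega
    · intro hx
      by_contra hne
      exact (hpos x hne).ne' hx

theorem card_roots (h : OrthFrame A d W) (q : (Fin 16 → ℤ) → ℕ) (hq : ∀ x, x ⬝ᵥ A *ᵥ x = 2 * q x)
    (hpos : ∀ x, x ≠ 0 → 0 < q x) (R : Finset (Fin 16 → ℤ)) (hR : ∀ x, x ∈ R ↔ q x = 1) : R.card = 480 := by
  have := weight_eight_coeff _ _ ?_ (h.fiber_hasSum q hq (fun _ => 0) (by simp)) ?_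
  · rw [h.tsum_fiber q hq R 1 hR] at this
    simp [pol] at this
    exact_mod_cast this
  · rw [h.fiber_zero q hq hpos]
    simp [pol]
  · intro τ
    rw [h.theta_S q hq _ (by simp)]
    simp
    try norm_cast

theorem orth_roots (h : OrthFrame A d W) (q : (Fin 16 → ℤ) → ℕ) (hq : ∀ x, x ⬝ᵥ A *ᵥ x = 2 * q x)
    (hpos : ∀ x, x ≠ 0 → 0 < q x) (R : Finset (Fin 16 → ℤ)) (hR : ∀ x, x ∈ R ↔ q x = 1) :
    ∑ x ∈ R, ((W * A) *ᵥ x) 0 * ((W * A) *ᵥ x) 1 = 0 := by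
  let k : Fin 16 → ℕ := fun i => if i = 0 ∨ i = 1 then 1 else 0
  have hk : ∀ i, k i ≤ 1 := by intro i; simp only [k]; split_ifs <;> omega
  have hsum : 8 + ∑ i, k i = 10 := by decide
  have hp : ∀ x, pol A W k x = ((W * A) *ᵥ x) 0 * ((W * A) *ᵥ x) 1 := by
    intro x
    simp only [pol]
    rw [Fin.prod_univ_succ, Fin.prod_univ_succ]
    have : ∏ i : Fin 14, ((W * A) *ᵥ x) i.succ.succ ^ k i.succ.succ = 1 := by
      refine Finset.prod_eq_one fun i _ => ?_
      have : k i.succ.succ = 0 := by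
        simp only [k]
        rw [if_neg]
        rintro (h | h)
        · exact absurd h (Fin.succ_ne_zero _)
        · have := congrArg Fin.val h
          simp at this
      rw [this, pow_zero]
    rw [this]
    have h0 : k 0 = 1 := by simp [k]
    have h1 : k (Fin.succ 0) = 1 := by simp [k]
    rw [h0, h1]
    simp
  have := weight_ten_coeff _ _ ?_ (h.fiber_hasSum q hq k hk) ?_
  · rw [h.tsum_fiber q hq R 1 hR] at this
    simp only [hp] at this
    exact_mod_cast this
  · rw [h.fiber_zero q hq hpos, hp]
    simp
  · intro τ
    rw [h.theta_S q hq _ hk, hsum]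
    congr 1

end OrthFrame


open scoped Matrix

/-- an even positive definite unimodular lattice of rank 16 -/
structure EvenUni (A : Matrix (Fin 16) (Fin 16) ℤ) (q : (Fin 16 → ℤ) → ℕ) : Prop where
  sym : Aᵀ = A
  det : A.det = 1
  hq : ∀ x, x ⬝ᵥ A *ᵥ x = 2 * q x
  pos : ∀ x, x ≠ 0 → 0 < q x

namespace EvenUni

open Matrix

variable {A : Matrix (Fin 16) (Fin 16) ℤ} {q : (Fin 16 → ℤ) → ℕ}

theorem comm (h : EvenUni A q) (x y : Fin 16 → ℤ) : x ⬝ᵥ A *ᵥ y = y ⬝ᵥ A *ᵥ x := by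
  rw [Matrix.dotProduct_mulVec, dotProduct_comm, ← Matrix.mulVec_transpose, h.sym]

theorem exists_orth (A : Matrix (Fin 16) (Fin 16) ℤ) (k : ℕ) (hk : k < 16) (w : ℕ → Fin 16 → ℤ) :
    ∃ z : Fin 16 → ℤ, z ≠ 0 ∧ ∀ i < k, w i ⬝ᵥ A *ᵥ z = 0 := by
  let M : Matrix (Fin 16) (Fin 16) ℤ := Matrix.of fun i => if i.val < k then w i ᵥ* A else 0
  have hM : M.det = 0 := by
    apply Matrix.det_eq_zero_of_row_eq_zero (⟨k, hk⟩ : Fin 16)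
    intro j
    simp [M]
  obtain ⟨z, hz, hMz⟩ := Matrix.exists_mulVec_eq_zero_iff.2 hM
  refine ⟨z, hz, fun i hi => ?_⟩
  have := congrFun hMz ⟨i, by omega⟩
  rw [Matrix.dotProduct_mulVec]
  simpa [M, Matrix.mulVec, hi] using this

theorem extend (h : EvenUni A q) (j : ℕ) (w : ℕ → Fin 16 → ℤ) (hw : ∀ i < j, w i ≠ 0)
    (ho : ∀ i < j, ∀ l < j, i ≠ l → w i ⬝ᵥ A *ᵥ w l = 0) (k : ℕ) (hk : j ≤ k) (hk' : k ≤ 16) :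
    ∃ w' : ℕ → Fin 16 → ℤ, (∀ i < j, w' i = w i) ∧ (∀ i < k, w' i ≠ 0) ∧
      ∀ i < k, ∀ l < k, i ≠ l → w' i ⬝ᵥ A *ᵥ w' l = 0 := by
  induction k, hk using Nat.le_induction with
  | base => exact ⟨w, fun _ _ => rfl, hw, ho⟩
  | succ k hjk ih =>
    obtain ⟨w', h1, h2, h3⟩ := ih (by omega)
    obtain ⟨z, hz, hzo⟩ := exists_orth A k (by omega) w'
    refine ⟨Function.update w' k z, ?_, ?_, ?_⟩
    · intro i hi
      rw [Function.update_of_ne (by omega)]; exact h1 i hi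
    · intro i hi
      by_cases hik : i = k
      · subst hik; simpa using hz
      · rw [Function.update_of_ne hik]; exact h2 i (by omega)
    · intro i hi l hl hil
      by_cases hik : i = k
      · subst hik
        rw [Function.update_self, Function.update_of_ne (Ne.symm hil), h.comm]
        exact hzo l (by omega)
      · rw [Function.update_of_ne hik]
        by_cases hlk : l = k
        · subst hlk
          rw [Function.update_self]
          exact hzo i (by omega)
        · rw [Function.update_of_ne hlk]
          exact h3 i (by omega) l (by omega) hil

theorem frame (h : EvenUni A q) (w : ℕ → Fin 16 → ℤ) (hw : ∀ i < 16, w i ≠ 0)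
    (ho : ∀ i < 16, ∀ l < 16, i ≠ l → w i ⬝ᵥ A *ᵥ w l = 0) :
    OrthFrame A (fun i : Fin 16 => 2 * q (w i)) (Matrix.of fun i : Fin 16 => w i) where
  sym := h.sym
  det := h.det
  gram := by
    ext i j
    have : (Matrix.of (fun i : Fin 16 => w i) * A * (Matrix.of fun i : Fin 16 => w i)ᵀ) i j = w i ⬝ᵥ A *ᵥ w j := by
      rw [Matrix.mul_apply, Matrix.dotProduct_mulVec]
      rfl
    rw [this, Matrix.diagonal_apply]
    split_ifs with hij
    · subst hij
      rw [h.hq]; push_cast; rfl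
    · exact ho i i.2 j j.2 (fun e => hij (Fin.ext e))
  pos := fun i => by
    have := h.pos (w i) (hw i i.2)
    omega

theorem frame_apply (h : EvenUni A q) (w : ℕ → Fin 16 → ℤ) (x : Fin 16 → ℤ) (i : Fin 16) :
    ((Matrix.of (fun i : Fin 16 => w i) * A) *ᵥ x) i = x ⬝ᵥ A *ᵥ w i := by
  rw [h.comm, Matrix.dotProduct_mulVec]
  rfl

theorem exists_frame (h : EvenUni A q) (j : ℕ) (hj : j ≤ 16) (w : ℕ → Fin 16 → ℤ) (hw : ∀ i < j, w i ≠ 0)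
    (ho : ∀ i < j, ∀ l < j, i ≠ l → w i ⬝ᵥ A *ᵥ w l = 0) :
    ∃ w' : ℕ → Fin 16 → ℤ, (∀ i < j, w' i = w i) ∧ (∀ i < 16, w' i ≠ 0) ∧
      (∀ i < 16, ∀ l < 16, i ≠ l → w' i ⬝ᵥ A *ᵥ w' l = 0) := h.extend j w hw ho 16 hj le_rfl

theorem exists_roots (h : EvenUni A q) : ∃ R : Finset (Fin 16 → ℤ), ∀ x, x ∈ R ↔ q x = 1 := by
  obtain ⟨w, -, h1, h2⟩ := h.exists_frame 0 (by omega) 0 (by simp) (by simp)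
  have hf := (h.frame w h1 h2).roots_finite q h.hq 1
  exact ⟨hf.toFinset, fun x => by simp⟩

theorem card_roots (h : EvenUni A q) (R : Finset (Fin 16 → ℤ)) (hR : ∀ x, x ∈ R ↔ q x = 1) : R.card = 480 := by
  obtain ⟨w, -, h1, h2⟩ := h.exists_frame 0 (by omega) 0 (by simp) (by simp)
  exact (h.frame w h1 h2).card_roots q h.hq h.pos R hR

theorem orth_sum (h : EvenUni A q) (R : Finset (Fin 16 → ℤ)) (hR : ∀ x, x ∈ R ↔ q x = 1) (u v : Fin 16 → ℤ)
    (huv : u ⬝ᵥ A *ᵥ v = 0) : ∑ x ∈ R, (x ⬝ᵥ A *ᵥ u) * (x ⬝ᵥ A *ᵥ v) = 0 := by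
  by_cases hu : u = 0
  · subst hu; simp
  by_cases hv : v = 0
  · subst hv; simp
  obtain ⟨w, h0, h1, h2⟩ := h.exists_frame 2 (by omega) (fun i => if i = 0 then u else v) (by
    intro i _
    split_ifs <;> assumption) (by
    intro i hi l hl hil
    have : (i = 0 ∧ l = 1) ∨ (i = 1 ∧ l = 0) := by omega
    rcases this with ⟨rfl, rfl⟩ | ⟨rfl, rfl⟩
    · simpa using huv
    · rw [h.comm]; simpa using huv)
  have := (h.frame w h1 h2).orth_roots q h.hq h.pos R hR
  simp only [h.frame_apply] at this
  have e0 := h0 0 (by omega)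
  have e1 := h0 1 (by omega)
  simp at e0 e1
  have f1 : w ((1 : Fin 16) : ℕ) = v := e1
  have f0 : w ((0 : Fin 16) : ℕ) = u := e0
  rw [f0, f1] at this
  exact this

theorem design (h : EvenUni A q) (R : Finset (Fin 16 → ℤ)) (hR : ∀ x, x ∈ R ↔ q x = 1) (u : Fin 16 → ℤ) :
    ∑ x ∈ R, (x ⬝ᵥ A *ᵥ u) ^ 2 = 60 * (u ⬝ᵥ A *ᵥ u) := by
  by_cases hu : u = 0
  · subst hu; simp
  obtain ⟨w, h0, h1, h2⟩ := h.exists_frame 1 (by omega) (fun _ => u) (fun _ _ => hu) (by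
    intro i hi l hl hil; omega)
  have hw0 : w 0 = u := h0 0 (by omega)
  have hprop : ∀ i : Fin 16, (2 * q (w i) : ℤ) * ∑ x ∈ R, (x ⬝ᵥ A *ᵥ u) ^ 2 = (2 * q u) * ∑ x ∈ R, (x ⬝ᵥ A *ᵥ w i) ^ 2 := by
    intro i
    by_cases hi : i = 0
    · subst hi
      have : w ((0 : Fin 16) : ℕ) = u := hw0
      rw [this]
    · have horth : u ⬝ᵥ A *ᵥ w i = 0 := by
        rw [← hw0]
        exact h2 0 (by omega) i i.2 (fun e => hi (Fin.ext e.symm))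
      have horth' : w i ⬝ᵥ A *ᵥ u = 0 := by rw [h.comm]; exact horth
      have s1 := h.orth_sum R hR u (w i) horth
      have s2 := h.orth_sum R hR (u + w i) ((2 * q (w i) : ℤ) • u - (2 * q u : ℤ) • w i) (by
        simp only [Matrix.mulVec_sub, Matrix.mulVec_smul, dotProduct_sub, dotProduct_smul, add_dotProduct, h.hq, horth, horth', smul_eq_mul]
        ring)
      simp only [Matrix.mulVec_sub, Matrix.mulVec_smul, Matrix.mulVec_add, dotProduct_add, dotProduct_sub, dotProduct_smul, smul_eq_mul] at s2
      have e : ∀ x : Fin 16 → ℤ, (x ⬝ᵥ A *ᵥ u + x ⬝ᵥ A *ᵥ w i) * (2 * q (w i) * x ⬝ᵥ A *ᵥ u - 2 * q u * x ⬝ᵥ A *ᵥ w i) =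
          2 * q (w i) * (x ⬝ᵥ A *ᵥ u) ^ 2 + (2 * q (w i) - 2 * q u) * ((x ⬝ᵥ A *ᵥ u) * (x ⬝ᵥ A *ᵥ w i)) - 2 * q u * (x ⬝ᵥ A *ᵥ w i) ^ 2 := by
        intro x; ring
      simp only [e, Finset.sum_add_distrib, Finset.sum_sub_distrib, ← Finset.mul_sum, s1] at s2
      linarith
  have hF := h.frame w h1 h2
  have hpair : ∀ x ∈ R, ∑ i : Fin 16, (((x ⬝ᵥ A *ᵥ w i) ^ 2 : ℤ) : ℚ) / (2 * q (w i)) = 2 := by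
    intro x hx
    have := hF.pairing x x
    simp only [h.frame_apply] at this
    rw [h.hq, (hR x).1 hx] at this
    push_cast at this ⊢
    simp only [sq]
    exact this
  have htot : ∑ i : Fin 16, ((∑ x ∈ R, (x ⬝ᵥ A *ᵥ w i) ^ 2 : ℤ) : ℚ) / (2 * q (w i)) = 960 := by
    have : ∑ i : Fin 16, ((∑ x ∈ R, (x ⬝ᵥ A *ᵥ w i) ^ 2 : ℤ) : ℚ) / (2 * q (w i)) =
        ∑ x ∈ R, ∑ i : Fin 16, (((x ⬝ᵥ A *ᵥ w i) ^ 2 : ℤ) : ℚ) / (2 * q (w i)) := by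
      rw [Finset.sum_comm]
      refine Finset.sum_congr rfl fun i _ => ?_
      rw [Int.cast_sum, Finset.sum_div]
    rw [this, Finset.sum_congr rfl hpair, Finset.sum_const, h.card_roots R hR]
    norm_num
  have hqu : (0 : ℚ) < q u := by exact_mod_cast h.pos u hu
  have heach : ∀ i : Fin 16, ((∑ x ∈ R, (x ⬝ᵥ A *ᵥ w i) ^ 2 : ℤ) : ℚ) / (2 * q (w i)) =
      ((∑ x ∈ R, (x ⬝ᵥ A *ᵥ u) ^ 2 : ℤ) : ℚ) / (2 * q u) := by
    intro i
    have hqi : (0 : ℚ) < q (w i) := by exact_mod_cast h.pos (w i) (h1 i i.2)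
    rw [div_eq_div_iff (by positivity) (by positivity)]
    have := hprop i
    have : ((2 * q (w i) : ℤ) * ∑ x ∈ R, (x ⬝ᵥ A *ᵥ u) ^ 2 : ℤ) = ((2 * q u) * ∑ x ∈ R, (x ⬝ᵥ A *ᵥ w i) ^ 2 : ℤ) := this
    have h3 : ((2 * q (w i) : ℚ) * (∑ x ∈ R, (x ⬝ᵥ A *ᵥ u) ^ 2 : ℤ)) = ((2 * q u) * (∑ x ∈ R, (x ⬝ᵥ A *ᵥ w i) ^ 2 : ℤ)) := by
      exact_mod_cast this
    linarith
  rw [Finset.sum_congr rfl (fun i _ => heach i), Finset.sum_const, Finset.card_univ, Fintype.card_fin] at htot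
  rw [h.hq]
  have h4 : ((∑ x ∈ R, (x ⬝ᵥ A *ᵥ u) ^ 2 : ℤ) : ℚ) = 60 * (2 * q u) := by
    rw [nsmul_eq_mul] at htot
    field_simp at htot
    push_cast at htot ⊢
    linarith
  exact_mod_cast h4

end EvenUni


/-- A positive definite lattice with finite root set `R` which is a 2-design of the right strength. -/
structure DesignLat {M : Type*} [AddCommGroup M] (B : M →ₗ[ℤ] M →ₗ[ℤ] ℤ) (R : Finset M) : Prop where
  symm : ∀ x y, B x y = B y x
  pos : ∀ x, x ≠ 0 → 0 < B x x
  hR : ∀ x, x ∈ R ↔ B x x = 2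
  design : ∀ u, ∑ x ∈ R, (B x u) ^ 2 = 60 * B u u
  rank : ∀ v : Fin 17 → M, ∃ c : Fin 17 → ℤ, c ≠ 0 ∧ ∑ i, c i • v i = 0

/-- orthogonal frame of norm four vectors, congruent modulo two -/
structure IsFrame {M : Type*} [AddCommGroup M] (B : M →ₗ[ℤ] M →ₗ[ℤ] ℤ) {j : ℕ} (f : Fin j → M) : Prop where
  norm : ∀ a, B (f a) (f a) = 4
  orth : ∀ a b, a ≠ b → B (f a) (f b) = 0
  congr : ∀ a b, ∃ m, f a - f b = (2 : ℤ) • m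

namespace DesignLat

variable {M : Type*} [AddCommGroup M] {B : M →ₗ[ℤ] M →ₗ[ℤ] ℤ} {R : Finset M}

theorem nonneg (h : DesignLat B R) (x : M) : 0 ≤ B x x := by
  by_cases hx : x = 0
  · subst hx; simp
  · exact (h.pos x hx).le

theorem eq_zero (h : DesignLat B R) (x : M) (hx : B x x = 0) : x = 0 := by
  by_contra hne
  exact (h.pos x hne).ne' hx

theorem two_smul_inj (h : DesignLat B R) (x y : M) (hxy : (2 : ℤ) • x = (2 : ℤ) • y) : x = y := by
  have h0 : (2 : ℤ) • (x - y) = 0 := by rw [smul_sub, hxy, sub_self]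
  have h1 : B ((2 : ℤ) • (x - y)) ((2 : ℤ) • (x - y)) = 0 := by rw [h0]; simp
  simp only [map_smul, LinearMap.smul_apply, smul_eq_mul] at h1
  exact sub_eq_zero.1 (h.eq_zero _ (by linarith))

theorem sub_norm (h : DesignLat B R) (x y : M) : B (x - y) (x - y) = B x x - 2 * B x y + B y y := by
  simp only [map_sub, LinearMap.sub_apply]
  rw [h.symm y x]; ring

theorem add_norm (h : DesignLat B R) (x y : M) : B (x + y) (x + y) = B x x + 2 * B x y + B y y := by
  simp only [map_add, LinearMap.add_apply]
  rw [h.symm y x]; ring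

theorem root_le (h : DesignLat B R) {x y : M} (hx : x ∈ R) (hy : y ∈ R) (hne : x ≠ y) : B x y ≤ 1 := by
  have h1 := h.pos (x - y) (sub_ne_zero.2 hne)
  rw [h.sub_norm, (h.hR x).1 hx, (h.hR y).1 hy] at h1
  omega

theorem neg_mem (h : DesignLat B R) {x : M} (hx : x ∈ R) : -x ∈ R := by
  rw [h.hR] at *
  simpa using hx

theorem root_ge (h : DesignLat B R) {x y : M} (hx : x ∈ R) (hy : y ∈ R) (hne : x ≠ -y) : -1 ≤ B x y := by
  have := h.root_le hx (h.neg_mem hy) hne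
  rw [map_neg] at this
  omega

theorem exists_root (h : DesignLat B R) (u : M) (hu : u ≠ 0) : ∃ r, r ∈ R := by
  by_contra hcon
  push Not at hcon
  have hRe : R = ∅ := Finset.eq_empty_of_forall_notMem hcon
  have := h.design u
  rw [hRe] at this
  have h2 := h.pos u hu
  simp at this
  omega

/-- neighbours -/
noncomputable def nb (B : M →ₗ[ℤ] M →ₗ[ℤ] ℤ) (R : Finset M) (u : M) (c : ℤ) : Finset M := R.filter fun x => B x u = c

theorem mem_nb {x u : M} {c : ℤ} : x ∈ nb B R u c ↔ x ∈ R ∧ B x u = c := by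
  simp [nb]

theorem card_nb_neg (h : DesignLat B R) (u : M) (c : ℤ) : (nb B R u (-c)).card = (nb B R u c).card := by
  refine Finset.card_bij (fun x _ => -x) ?_ ?_ ?_
  · intro x hx
    rw [mem_nb] at *
    refine ⟨h.neg_mem hx.1, ?_⟩
    simp [hx.2]
  · intro x _ y _ hxy
    simpa using hxy
  · intro y hy
    rw [mem_nb] at hy
    refine ⟨-y, ?_, by simp⟩
    rw [mem_nb]
    exact ⟨h.neg_mem hy.1, by simp [hy.2]⟩

/-- counting for norm ≤ 4 vectors -/
theorem count (h : DesignLat B R) (u : M) (hu : ∀ x ∈ R, -2 ≤ B x u ∧ B x u ≤ 2) :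
    60 * B u u = 2 * (nb B R u 1).card + 8 * (nb B R u 2).card := by
  classical
  rw [← h.design u]
  have h1 : ∀ x ∈ R, (B x u) ^ 2 = (if B x u = 1 then 1 else 0) + (if B x u = -1 then 1 else 0) +
      4 * (if B x u = 2 then 1 else 0) + 4 * (if B x u = -2 then 1 else 0) := by
    intro x hx
    obtain ⟨h2, h3⟩ := hu x hx
    generalize B x u = t at *
    interval_cases t <;> norm_num
  rw [Finset.sum_congr rfl h1]
  simp only [Finset.sum_add_distrib, ← Finset.mul_sum, Finset.sum_boole]
  have e1 := h.card_nb_neg u 1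
  have e2 := h.card_nb_neg u 2
  simp only [nb] at *
  rw [e1, e2]
  ring

theorem card_gamma (h : DesignLat B R) {r : M} (hr : r ∈ R) : (nb B R r 1).card = 56 := by
  classical
  have hc := h.count r (by
    intro x hx
    have h1 := h.nonneg (x - r)
    have h2 := h.nonneg (x + r)
    rw [h.sub_norm, (h.hR x).1 hx, (h.hR r).1 hr] at h1
    rw [h.add_norm, (h.hR x).1 hx, (h.hR r).1 hr] at h2
    constructor <;> omega)
  have h2 : nb B R r 2 = {r} := by
    ext x
    rw [mem_nb, Finset.mem_singleton]
    constructor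
    · rintro ⟨hx, hxr⟩
      by_contra hne
      have := h.root_le hx hr hne
      omega
    · rintro rfl
      exact ⟨hr, (h.hR x).1 hr⟩
  rw [h2, (h.hR r).1 hr] at hc
  simp at hc
  omega

theorem clique (h : DesignLat B R) (v : Fin 17 → M) (hn : ∀ i, B (v i) (v i) = 2) (ho : ∀ i j, i ≠ j → B (v i) (v j) = 1) : False := by
  obtain ⟨c, hc, hsum⟩ := h.rank v
  have h0 : B (∑ i, c i • v i) (∑ i, c i • v i) = 0 := by rw [hsum]; simp
  have h1 : B (∑ i, c i • v i) (∑ i, c i • v i) = (∑ i, c i) ^ 2 + ∑ i, c i ^ 2 := by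
    simp only [map_sum, LinearMap.sum_apply, map_smul, LinearMap.smul_apply, smul_eq_mul, Finset.mul_sum]
    have : ∀ i j, c j * (c i * B (v i) (v j)) = c i * c j + if i = j then c i ^ 2 else 0 := by
      intro i j
      split_ifs with hij
      · subst hij; rw [hn]; ring
      · rw [ho i j hij]; ring
    rw [Finset.sum_congr rfl fun j _ => Finset.sum_congr rfl fun i _ => this i j]
    simp only [Finset.sum_add_distrib, Finset.sum_ite_eq', Finset.mem_univ, if_true]
    rw [sq, Finset.sum_mul_sum, Finset.sum_comm]
  rw [h1] at h0
  have h2 : 0 ≤ (∑ i, c i) ^ 2 := sq_nonneg _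
  have h3 : ∑ i, c i ^ 2 = 0 := le_antisymm (by linarith) (Finset.sum_nonneg fun i _ => sq_nonneg _)
  rw [Finset.sum_eq_zero_iff_of_nonneg (fun i _ => sq_nonneg _)] at h3
  exact hc (funext fun i => by simpa using h3 i (Finset.mem_univ _))

theorem exists_square (h : DesignLat B R) (u : M) (hu : u ≠ 0) :
    ∃ r x y z : M, r ∈ R ∧ x ∈ R ∧ y ∈ R ∧ z ∈ R ∧ B x r = 1 ∧ B y r = 1 ∧ B z r = 1 ∧ B y x = 1 ∧ B z x = 1 ∧ B y z = 0 := by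
  classical
  obtain ⟨r, hr⟩ := h.exists_root u hu
  have hg := h.card_gamma hr
  obtain ⟨x, hx⟩ : (nb B R r 1).Nonempty := Finset.card_pos.1 (by omega)
  obtain ⟨hxR, hxr⟩ := mem_nb.1 hx
  let Y := (nb B R r 1).filter fun y => B y x = 1
  have hY : ∀ y, y ∈ Y ↔ y ∈ R ∧ B y r = 1 ∧ B y x = 1 := by
    intro y; simp [Y, mem_nb, and_assoc]
  have hsub : nb B R r 1 ⊆ ({x, r - x} : Finset M) ∪ Y ∪ Y.image (fun y => r - y) := by
    intro y hy
    obtain ⟨hyR, hyr⟩ := mem_nb.1 hy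
    have hry : r - y ∈ R := by
      rw [h.hR, h.sub_norm, h.symm r y, (h.hR r).1 hr, (h.hR y).1 hyR, hyr]; norm_num
    by_cases h1 : y = x
    · simp [h1]
    by_cases h2 : r - y = x
    · have : y = r - x := by rw [← h2]; abel
      simp [this]
    have h3 := h.root_le hyR hxR h1
    have h4 := h.root_le hry hxR h2
    rw [map_sub, LinearMap.sub_apply, h.symm r x, hxr] at h4
    have h5 : B y x = 1 ∨ B y x = 0 := by omega
    rcases h5 with h5 | h5
    · have : y ∈ Y := (hY y).2 ⟨hyR, hyr, h5⟩
      simp [this]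
    · have : r - y ∈ Y := (hY _).2 ⟨hry, by rw [map_sub, LinearMap.sub_apply, (h.hR r).1 hr, hyr]; norm_num,
        by rw [map_sub, LinearMap.sub_apply, h.symm r x, hxr, h5]; norm_num⟩
      have : y ∈ Y.image (fun y => r - y) := Finset.mem_image.2 ⟨_, this, by abel⟩
      simp only [Finset.mem_union]
      exact Or.inr this
  have hcard : 56 ≤ 2 + Y.card + Y.card := by
    rw [← hg]
    refine (Finset.card_le_card hsub).trans ((Finset.card_union_le _ _).trans ?_)
    exact add_le_add ((Finset.card_union_le _ _).trans (add_le_add Finset.card_le_two le_rfl)) Finset.card_image_le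
  by_contra hcon
  have h17 : 17 ≤ Y.card := by omega
  obtain ⟨Z, hZ, hZc⟩ := Finset.exists_subset_card_eq h17
  let e := Z.equivFinOfCardEq hZc
  let v : Fin 17 → M := fun i => (e.symm i : M)
  have hv : ∀ i, v i ∈ Y := fun i => hZ (e.symm i).2
  refine h.clique v ?_ ?_
  · intro i
    exact (h.hR _).1 ((hY _).1 (hv i)).1
  · intro i j hij
    have hne : v i ≠ v j := by
      intro hc
      exact hij (e.symm.injective (Subtype.ext hc))
    obtain ⟨a1, a2, a3⟩ := (hY _).1 (hv i)
    obtain ⟨b1, b2, b3⟩ := (hY _).1 (hv j)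
    have h1 := h.root_le a1 b1 hne
    have h2 : B (v i) (v j) ≠ 0 := by
      intro h0
      exact hcon ⟨r, x, v i, v j, hr, hxR, a1, b1, hxr, a2, b2, a3, b3, h0⟩
    have hry : r - v i ∈ R := by
      rw [h.hR, h.sub_norm, h.symm r (v i), (h.hR r).1 hr, (h.hR _).1 a1, a2]; norm_num
    have h3 : r - v i ≠ v j := by
      intro hc
      have := congrArg (fun t => B t x) hc
      simp only [map_sub, LinearMap.sub_apply] at this
      rw [h.symm r x, hxr, a3, b3] at this
      norm_num at this
    have h4 := h.root_le hry b1 h3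
    rw [map_sub, LinearMap.sub_apply, h.symm r, b2] at h4
    omega

theorem frame_four (h : DesignLat B R) (u : M) (hu : u ≠ 0) : ∃ f : Fin 4 → M, IsFrame B f := by
  obtain ⟨r, x, y, z, hr, hx, hy, hz, xr, yr, zr, yx, zx, yz⟩ := h.exists_square u hu
  rw [h.hR] at hr hx hy hz
  have rx := h.symm r x; have ry := h.symm r y; have rz := h.symm r z
  have xy := h.symm x y; have xz := h.symm x z; have zy := h.symm z y
  rw [xr] at rx; rw [yr] at ry; rw [zr] at rz; rw [yx] at xy; rw [zx] at xz; rw [yz] at zy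
  refine ⟨![y + z, z - y, y + z - (2 : ℤ) • r, y + z - (2 : ℤ) • x], ?_, ?_, ?_⟩
  · intro a
    fin_cases a <;>
    simp [hr, hx, hy, hz, xr, yr, zr, yx, zx, yz, rx, ry, rz, xy, xz, zy]
  · intro a b hab
    fin_cases a <;> fin_cases b <;>
    first
    | exact absurd rfl hab
    | simp [hr, hx, hy, hz, xr, yr, zr, yx, zx, yz, rx, ry, rz, xy, xz, zy]
  · have hm : ∀ a : Fin 4, ∃ m, (![y + z, z - y, y + z - (2 : ℤ) • r, y + z - (2 : ℤ) • x] : Fin 4 → M) a = y + z + (2 : ℤ) • m := by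
      intro a
      fin_cases a
      · exact ⟨0, by simp⟩
      · exact ⟨-y, by simp only [two_smul]; simp; abel⟩
      · exact ⟨-r, by simp; abel⟩
      · exact ⟨-x, by simp; abel⟩
    intro a b
    obtain ⟨m, hm1⟩ := hm a
    obtain ⟨m', hm2⟩ := hm b
    exact ⟨m - m', by rw [hm1, hm2, smul_sub]; abel⟩

end DesignLat


namespace IsFrame

variable {M : Type*} [AddCommGroup M] {B : M →ₗ[ℤ] M →ₗ[ℤ] ℤ} {R : Finset M} {j : ℕ} {f : Fin j → M}

theorem apply_sum (hf : IsFrame B f) (c : Fin j → ℤ) (a : Fin j) : B (∑ b, c b • f b) (f a) = 4 * c a := by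
  simp only [map_sum, LinearMap.sum_apply, map_smul, LinearMap.smul_apply, smul_eq_mul]
  rw [Finset.sum_eq_single a]
  · rw [hf.norm]; ring
  · intro b _ hb
    rw [hf.orth b a hb]; ring
  · simp

theorem sum_norm (hf : IsFrame B f) (c : Fin j → ℤ) : B (∑ b, c b • f b) (∑ b, c b • f b) = 4 * ∑ b, c b ^ 2 := by
  conv_lhs => rw [map_sum]
  simp only [map_smul, hf.apply_sum, smul_eq_mul, Finset.mul_sum]
  refine Finset.sum_congr rfl fun b _ => ?_
  ring

theorem sum_apply (z : M) (c : Fin j → ℤ) : B z (∑ b, c b • f b) = ∑ b, c b * B z (f b) := by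
  simp [map_sum]

theorem defect (hf : IsFrame B f) (h : DesignLat B R) (z : M) :
    B ((4 : ℤ) • z - ∑ a, B z (f a) • f a) ((4 : ℤ) • z - ∑ a, B z (f a) • f a) =
      4 * (4 * B z z - ∑ a, B z (f a) ^ 2) := by
  have h1 : B ((4 : ℤ) • z) ((4 : ℤ) • z) = 16 * B z z := by
    simp only [map_smul, LinearMap.smul_apply, smul_eq_mul]; ring
  have h2 : B ((4 : ℤ) • z) (∑ a, B z (f a) • f a) = 4 * ∑ a, B z (f a) ^ 2 := by
    rw [map_smul, LinearMap.smul_apply, sum_apply, smul_eq_mul]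
    simp only [← sq]
  rw [h.sub_norm, hf.sum_norm, h1, h2]
  ring

theorem bessel (hf : IsFrame B f) (h : DesignLat B R) (z : M) : ∑ a, B z (f a) ^ 2 ≤ 4 * B z z := by
  have := h.nonneg ((4 : ℤ) • z - ∑ a, B z (f a) • f a)
  rw [hf.defect h] at this
  linarith

theorem bessel_eq (hf : IsFrame B f) (h : DesignLat B R) (z : M) (hz : ∑ a, B z (f a) ^ 2 = 4 * B z z) :
    (4 : ℤ) • z = ∑ a, B z (f a) • f a := by
  have := hf.defect h z
  rw [hz, sub_self, mul_zero] at this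
  exact sub_eq_zero.1 (h.eq_zero _ this)

theorem parity (hf : IsFrame B f) (z : M) (a b : Fin j) : ∃ k, B z (f a) = B z (f b) + 2 * k := by
  obtain ⟨m, hm⟩ := hf.congr a b
  refine ⟨B z m, ?_⟩
  have := congrArg (fun t => B z t) hm
  simp only [map_sub, map_smul, smul_eq_mul] at this
  linarith

theorem card_le (hf : IsFrame B f) (h : DesignLat B R) : j ≤ 16 := by
  by_contra hj
  push Not at hj
  obtain ⟨c, hc, hsum⟩ := h.rank (fun i => f (Fin.castLE hj i))
  apply hc
  funext a
  have h1 : B (∑ i, c i • f (Fin.castLE hj i)) (f (Fin.castLE hj a)) = 0 := by rw [hsum]; simp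
  simp only [map_sum, LinearMap.sum_apply, map_smul, LinearMap.smul_apply, smul_eq_mul] at h1
  rw [Finset.sum_eq_single a, hf.norm] at h1
  · simp; omega
  · intro b _ hb
    rw [hf.orth _ _ (fun e => hb (Fin.castLE_injective hj e))]; ring
  · simp

theorem flip (hf : IsFrame B f) (e : Fin j → ℤ) (he : ∀ a, e a = 1 ∨ e a = -1) : IsFrame B (fun a => e a • f a) where
  norm := fun a => by
    simp only [map_smul, LinearMap.smul_apply, smul_eq_mul, hf.norm]
    rcases he a with h | h <;> rw [h] <;> norm_num
  orth := fun a b hab => by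
    simp only [map_smul, LinearMap.smul_apply, smul_eq_mul, hf.orth a b hab]
    ring
  congr := fun a b => by
    obtain ⟨m, hm⟩ := hf.congr a b
    have hab : f a = f b + (2 : ℤ) • m := by rw [← hm]; abel
    rcases he a with h | h <;> rcases he b with h' | h' <;> rw [h, h', hab]
    · exact ⟨m, by simp⟩
    · exact ⟨m + f b, by simp only [two_smul, neg_smul, one_smul]; abel⟩
    · exact ⟨-m - f b, by simp only [two_smul, neg_smul, one_smul]; abel⟩
    · exact ⟨-m, by simp only [two_smul, neg_smul, one_smul]; abel⟩

theorem snoc (hf : IsFrame B f) (h : DesignLat B R) (w : M) (hw : B w w = 4) (ho : ∀ a, B w (f a) = 0)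
    (hc : ∀ a, ∃ m, w - f a = (2 : ℤ) • m) : IsFrame B (Fin.cons w f : Fin (j + 1) → M) where
  norm := fun a => by
    refine Fin.cases ?_ (fun a => ?_) a
    · simpa using hw
    · simpa using hf.norm a
  orth := fun a b => by
    refine Fin.cases ?_ (fun a => ?_) a <;> refine Fin.cases ?_ (fun b => ?_) b
    · intro h; exact absurd rfl h
    · intro _; simpa using ho b
    · intro _; simpa using (h.symm _ _).trans (ho a)
    · intro hab
      simpa using hf.orth a b (fun e => hab (by rw [e]))
  congr := fun a b => by
    refine Fin.cases ?_ (fun a => ?_) a <;> refine Fin.cases ?_ (fun b => ?_) b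
    · exact ⟨0, by simp⟩
    · simpa using hc b
    · obtain ⟨m, hm⟩ := hc a
      exact ⟨-m, by simp only [Fin.cons_succ, Fin.cons_zero, smul_neg, ← hm]; abel⟩
    · simpa using hf.congr a b

theorem root_bounds (hf : IsFrame B f) (h : DesignLat B R) {x : M} (hx : x ∈ R) (a : Fin j) : -2 ≤ B x (f a) ∧ B x (f a) ≤ 2 := by
  have h1 := hf.bessel h x
  rw [(h.hR x).1 hx] at h1
  have h2 : B x (f a) ^ 2 ≤ ∑ a, B x (f a) ^ 2 := Finset.single_le_sum (f := fun a => B x (f a) ^ 2) (fun i _ => sq_nonneg _) (Finset.mem_univ a)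
  constructor <;> nlinarith

/-- even roots -/
theorem even_root (hf : IsFrame B f) (h : DesignLat B R) (o : Fin j)
    (hno : ¬ ∃ g : Fin (j + 1) → M, IsFrame B g) {x : M} (hx : x ∈ R) (h2 : B x (f o) = 2) :
    ∃ b, b ≠ o ∧ ∃ e : Bool, (2 : ℤ) • x = f o + (if e then (1 : ℤ) else -1) • f b := by
  have hxx := (h.hR x).1 hx
  have hex : ∃ b, b ≠ o ∧ B x (f b) ≠ 0 := by
    by_contra hcon
    push Not at hcon
    apply hno
    refine ⟨_, hf.snoc h (f o - (2 : ℤ) • x) ?_ ?_ ?_⟩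
    · rw [h.sub_norm]
      simp only [map_smul, LinearMap.smul_apply, smul_eq_mul, hf.norm, hxx]
      rw [h.symm, h2]; norm_num
    · intro a
      simp only [map_sub, LinearMap.sub_apply, map_smul, LinearMap.smul_apply, smul_eq_mul]
      by_cases ha : a = o
      · subst ha; rw [hf.norm, h2]; norm_num
      · rw [hf.orth o a (Ne.symm ha), hcon a ha]; norm_num
    · intro a
      obtain ⟨m, hm⟩ := hf.congr o a
      refine ⟨m - x, ?_⟩
      rw [smul_sub, ← hm]; abel
  obtain ⟨b, hb, hbne⟩ := hex
  obtain ⟨k, hk⟩ := hf.parity x b o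
  obtain ⟨hb1, hb2⟩ := hf.root_bounds h hx b
  refine ⟨b, hb, ?_⟩
  have hcase : B x (f b) = 2 ∨ B x (f b) = -2 := by omega
  have key : ∀ e : ℤ, B x (f b) = 2 * e → e ^ 2 = 1 → (2 : ℤ) • x = f o + e • f b := by
    intro e he he1
    apply sub_eq_zero.1
    apply h.eq_zero
    rw [h.sub_norm, h.add_norm]
    simp only [map_smul, LinearMap.smul_apply, smul_eq_mul, map_add, LinearMap.add_apply, hf.norm, hxx, hf.orth o b (Ne.symm hb), h2, he]
    linear_combination (-4) * he1
  rcases hcase with hc | hc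
  · exact ⟨true, by simpa using key 1 (by omega) (by norm_num)⟩
  · exact ⟨false, by simpa using key (-1) (by omega) (by norm_num)⟩

theorem card_even (hf : IsFrame B f) (h : DesignLat B R) (o : Fin j)
    (hno : ¬ ∃ g : Fin (j + 1) → M, IsFrame B g) : (DesignLat.nb B R (f o) 2).card ≤ 2 * (j - 1) := by
  classical
  have hch : ∀ x, ∃ p : Fin j × Bool, x ∈ DesignLat.nb B R (f o) 2 →
      p.1 ≠ o ∧ (2 : ℤ) • x = f o + (if p.2 then (1 : ℤ) else -1) • f p.1 := by
    intro x
    by_cases hx : x ∈ DesignLat.nb B R (f o) 2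
    · obtain ⟨h1, h2⟩ := DesignLat.mem_nb.1 hx
      obtain ⟨b, hb, e, he⟩ := hf.even_root h o hno h1 h2
      exact ⟨(b, e), fun _ => ⟨hb, he⟩⟩
    · exact ⟨(o, true), fun hc => absurd hc hx⟩
  choose p hp using hch
  have : (DesignLat.nb B R (f o) 2).card ≤ ((Finset.univ.erase o) ×ˢ (Finset.univ : Finset Bool)).card := by
    refine Finset.card_le_card_of_injOn p ?_ ?_
    · intro x hx
      simpa using (hp x hx).1
    · intro x hx y hy hxy
      have h1 := (hp x hx).2
      have h2 := (hp y hy).2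
      rw [hxy, ← h2] at h1
      exact h.two_smul_inj _ _ h1
  refine this.trans ?_
  rw [Finset.card_product, Finset.card_erase_of_mem (Finset.mem_univ _)]
  simp
  omega

theorem card_odd (hf : IsFrame B f) (h : DesignLat B R) (o : Fin j)
    (hno : ¬ ∃ g : Fin (j + 1) → M, IsFrame B g) : 256 ≤ 2 * (DesignLat.nb B R (f o) 1).card + 16 * j := by
  have h1 := h.count (f o) (fun x hx => hf.root_bounds h hx o)
  rw [hf.norm] at h1
  have h2 := hf.card_even h o hno
  have h3 := o.2
  omega

theorem odd_all (hf : IsFrame B f) (h : DesignLat B R) (o : Fin j) {x : M} (hx : x ∈ R) (h1 : B x (f o) = 1 ∨ B x (f o) = -1)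
    (a : Fin j) : B x (f a) = 1 ∨ B x (f a) = -1 := by
  obtain ⟨k, hk⟩ := hf.parity x a o
  obtain ⟨hb1, hb2⟩ := hf.root_bounds h hx a
  omega

theorem odd_le (hf : IsFrame B f) (h : DesignLat B R) {x : M} (hx : x ∈ R) (h1 : ∀ a, B x (f a) = 1 ∨ B x (f a) = -1) : j ≤ 8 := by
  have h2 := hf.bessel h x
  have : ∀ a, B x (f a) ^ 2 = 1 := by
    intro a; rcases h1 a with h | h <;> rw [h] <;> norm_num
  simp only [this, (h.hR x).1 hx] at h2
  simp at h2
  omega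

theorem four_to_five {f : Fin 4 → M} (hf : IsFrame B f) (h : DesignLat B R) {x : M} (hx : x ∈ R) (h1 : ∀ a, B x (f a) = 1) :
    ∃ g : Fin 5 → M, IsFrame B g := by
  obtain ⟨m1, hm1⟩ := hf.congr 1 0
  obtain ⟨m2, hm2⟩ := hf.congr 2 0
  obtain ⟨m3, hm3⟩ := hf.congr 3 0
  have e1 : f 1 = f 0 + (2 : ℤ) • m1 := by rw [← hm1]; abel
  have e2 : f 2 = f 0 + (2 : ℤ) • m2 := by rw [← hm2]; abel
  have e3 : f 3 = f 0 + (2 : ℤ) • m3 := by rw [← hm3]; abel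
  obtain ⟨g, hg⟩ : ∃ g : M, (2 : ℤ) • g = f 0 + f 1 + f 2 + f 3 :=
    ⟨(2 : ℤ) • f 0 + m1 + m2 + m3, by rw [e1, e2, e3]; simp only [two_smul]; abel⟩
  have hg0 : ∀ z, 2 * B g z = B (f 0) z + B (f 1) z + B (f 2) z + B (f 3) z := by
    intro z
    have := congrArg (fun t => B t z) hg
    simpa using this
  have hxx := (h.hR x).1 hx
  have n := hf.norm
  have o01 := hf.orth 0 1 (by decide); have o02 := hf.orth 0 2 (by decide); have o03 := hf.orth 0 3 (by decide)
  have o10 := hf.orth 1 0 (by decide); have o12 := hf.orth 1 2 (by decide); have o13 := hf.orth 1 3 (by decide)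
  have o20 := hf.orth 2 0 (by decide); have o21 := hf.orth 2 1 (by decide); have o23 := hf.orth 2 3 (by decide)
  have o30 := hf.orth 3 0 (by decide); have o31 := hf.orth 3 1 (by decide); have o32 := hf.orth 3 2 (by decide)
  have gf0 : B g (f 0) = 2 := by have := hg0 (f 0); rw [n, o10, o20, o30] at this; omega
  have gf1 : B g (f 1) = 2 := by have := hg0 (f 1); rw [n, o01, o21, o31] at this; omega
  have gf2 : B g (f 2) = 2 := by have := hg0 (f 2); rw [n, o02, o12, o32] at this; omega
  have gf3 : B g (f 3) = 2 := by have := hg0 (f 3); rw [n, o03, o13, o23] at this; omega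
  have fg0 : B (f 0) g = 2 := (h.symm _ _).trans gf0
  have fg1 : B (f 1) g = 2 := (h.symm _ _).trans gf1
  have fg2 : B (f 2) g = 2 := (h.symm _ _).trans gf2
  have fg3 : B (f 3) g = 2 := (h.symm _ _).trans gf3
  have gg : B g g = 4 := by have := hg0 g; rw [fg0, fg1, fg2, fg3] at this; omega
  have fx : ∀ a, B (f a) x = 1 := fun a => (h.symm _ _).trans (h1 a)
  have gx : B g x = 2 := by have := hg0 x; rw [fx, fx, fx, fx] at this; omega
  have xg : B x g = 2 := (h.symm _ _).trans gx
  refine ⟨![g, g - f 0 - f 1, g - f 0 - f 2, g - f 0 - f 3, g - (2 : ℤ) • x], ?_, ?_, ?_⟩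
  · intro a
    fin_cases a <;>
    simp [hxx, n, o01, o02, o03, o10, o12, o13, o20, o21, o23, o30, o31, o32, gf0, gf1, gf2, gf3, fg0, fg1, fg2, fg3, gg, fx, h1, gx, xg]
  · intro a b hab
    fin_cases a <;> fin_cases b <;>
    first
    | exact absurd rfl hab
    | simp [hxx, n, o01, o02, o03, o10, o12, o13, o20, o21, o23, o30, o31, o32, gf0, gf1, gf2, gf3, fg0, fg1, fg2, fg3, gg, fx, h1, gx, xg]
  · have hm : ∀ a : Fin 5, ∃ m, (![g, g - f 0 - f 1, g - f 0 - f 2, g - f 0 - f 3, g - (2 : ℤ) • x] : Fin 5 → M) a = g + (2 : ℤ) • m := by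
      intro a
      fin_cases a
      · exact ⟨0, by simp⟩
      · exact ⟨-f 0 - m1, by rw [e1]; simp only [two_smul]; simp; abel⟩
      · exact ⟨-f 0 - m2, by rw [e2]; simp only [two_smul]; simp; abel⟩
      · exact ⟨-f 0 - m3, by rw [e3]; simp only [two_smul]; simp; abel⟩
      · exact ⟨-x, by simp; abel⟩
    intro a b
    obtain ⟨m, hm1⟩ := hm a
    obtain ⟨m', hm2⟩ := hm b
    exact ⟨m - m', by rw [hm1, hm2, smul_sub]; abel⟩

theorem fiber_bound (hf : IsFrame B f) (h : DesignLat B R) (X : Finset M) (hX : ∀ x ∈ X, x ∈ R) (e : Fin j → ℤ)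
    (he : ∀ a, e a ^ 2 = 1) (hXe : ∀ x ∈ X, ∀ a, B x (f a) = e a) : (j : ℤ) * X.card ^ 2 ≤ 4 * (X.card ^ 2 + X.card) := by
  classical
  have h1 := hf.bessel h (∑ x ∈ X, x)
  have h2 : ∀ a, B (∑ x ∈ X, x) (f a) = X.card * e a := by
    intro a
    rw [map_sum, LinearMap.sum_apply, Finset.sum_congr rfl (fun x hx => hXe x hx a)]
    simp
  have h3 : B (∑ x ∈ X, x) (∑ x ∈ X, x) ≤ X.card ^ 2 + X.card := by
    simp only [map_sum, LinearMap.sum_apply]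
    have : ∀ y ∈ X, ∀ x ∈ X, B x y ≤ 1 + if x = y then 1 else 0 := by
      intro y hy x hx
      split_ifs with hxy
      · subst hxy; rw [(h.hR x).1 (hX x hx)]; norm_num
      · have := h.root_le (hX x hx) (hX y hy) hxy
        linarith
    refine (Finset.sum_le_sum fun y hy => Finset.sum_le_sum fun x hx => this y hy x hx).trans ?_
    simp only [Finset.sum_add_distrib, Finset.sum_ite_eq']
    simp [sq]
  simp only [h2, mul_pow, he, mul_one] at h1
  simp only [Finset.sum_const, Finset.card_univ, Fintype.card_fin, nsmul_eq_mul] at h1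
  linarith

theorem step (hf : IsFrame B f) (h : DesignLat B R) (h4 : 4 ≤ j) (h15 : j ≤ 15) :
    (∃ g : Fin (j + 1) → M, IsFrame B g) ∨ (∃ g : Fin 8 → M, IsFrame B g ∧ ∃ s ∈ R, ∀ a, B s (g a) = 1) := by
  classical
  by_cases hno : ∃ g : Fin (j + 1) → M, IsFrame B g
  · exact Or.inl hno
  right
  let o : Fin j := ⟨0, by omega⟩
  have hcard := hf.card_odd h o hno
  have hposc : 0 < (DesignLat.nb B R (f o) 1).card := by omega
  obtain ⟨x, hx⟩ := Finset.card_pos.1 hposc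
  obtain ⟨hxR, hx1⟩ := DesignLat.mem_nb.1 hx
  have hall := hf.odd_all h o hxR (Or.inl hx1)
  have h8 := hf.odd_le h hxR hall
  have hfl : IsFrame B (fun a => B x (f a) • f a) := hf.flip _ hall
  have hfl1 : ∀ a, B x (B x (f a) • f a) = 1 := by
    intro a
    rw [map_smul, smul_eq_mul]
    rcases hall a with h | h <;> rw [h] <;> norm_num
  have hj : j = 4 ∨ j = 8 ∨ (5 ≤ j ∧ j ≤ 7) := by omega
  rcases hj with rfl | rfl | ⟨h5, h7⟩
  · exact absurd (hfl.four_to_five h hxR hfl1) hno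
  · exact ⟨_, hfl, x, hxR, hfl1⟩
  · exfalso
    let S := R.filter fun x => B x (f o) = 1 ∨ B x (f o) = -1
    have hS : S = DesignLat.nb B R (f o) 1 ∪ DesignLat.nb B R (f o) (-1) := by
      ext x; simp [S, DesignLat.mem_nb]; tauto
    have hSc : S.card = 2 * (DesignLat.nb B R (f o) 1).card := by
      rw [hS, Finset.card_union_of_disjoint, h.card_nb_neg]
      · ring
      · rw [Finset.disjoint_left]
        intro x hx hx'
        have := (DesignLat.mem_nb.1 hx).2
        have := (DesignLat.mem_nb.1 hx').2
        omega
    let p : M → (Fin j → Bool) := fun x a => decide (B x (f a) = 1)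
    have hfib : ∀ t : ℕ, 2 ^ j * t < S.card → ∃ k : ℕ, t < k ∧ (j : ℤ) * k ^ 2 ≤ 4 * (k ^ 2 + k) := by
      intro t ht
      obtain ⟨y, -, hy⟩ := Finset.exists_lt_card_fiber_of_mul_lt_card_of_maps_to (s := S) (t := Finset.univ) (f := p)
        (fun _ _ => Finset.mem_univ _) (n := t) (by simpa using ht)
      refine ⟨_, hy, ?_⟩
      refine hf.fiber_bound h _ ?_ (fun a => if y a then 1 else -1) ?_ ?_
      · intro x hx
        simp only [S, Finset.mem_filter] at hx
        exact hx.1.1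
      · intro a; split_ifs <;> norm_num
      · intro x hx a
        simp only [S, Finset.mem_filter] at hx
        have h1 := hf.odd_all h o hx.1.1 hx.1.2 a
        have h2 := congrFun hx.2 a
        simp only [p] at h2
        rw [← h2]
        rcases h1 with h1 | h1 <;> simp [h1]
    have hj : j = 5 ∨ j = 6 ∨ j = 7 := by omega
    rcases hj with rfl | rfl | rfl
    · obtain ⟨k, hk, hk'⟩ := hfib 4 (by omega)
      push_cast at hk'
      zify at hk
      nlinarith
    · obtain ⟨k, hk, hk'⟩ := hfib 2 (by omega)
      push_cast at hk'
      zify at hk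
      nlinarith
    · obtain ⟨k, hk, hk'⟩ := hfib 1 (by omega)
      push_cast at hk'
      zify at hk
      nlinarith

end IsFrame

theorem DesignLat.dichotomy {M : Type*} [AddCommGroup M] {B : M →ₗ[ℤ] M →ₗ[ℤ] ℤ} {R : Finset M} (h : DesignLat B R)
    (u : M) (hu : u ≠ 0) : (∃ f : Fin 16 → M, IsFrame B f) ∨ (∃ g : Fin 8 → M, IsFrame B g ∧ ∃ s ∈ R, ∀ a, B s (g a) = 1) := by
  by_cases h8 : ∃ g : Fin 8 → M, IsFrame B g ∧ ∃ s ∈ R, ∀ a, B s (g a) = 1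
  · exact Or.inr h8
  left
  have key : ∀ j, 4 ≤ j → j ≤ 16 → ∃ f : Fin j → M, IsFrame B f := by
    intro j hj
    induction j, hj using Nat.le_induction with
    | base => intro _; exact h.frame_four u hu
    | succ j hj ih =>
      intro hj16
      obtain ⟨f, hf⟩ := ih (by omega)
      rcases hf.step h hj (by omega) with h1 | h1
      · exact h1
      · exact absurd h1 h8
  exact key 16 (by omega) le_rfl


namespace IsFrame

variable {M : Type*} [AddCommGroup M] {B : M →ₗ[ℤ] M →ₗ[ℤ] ℤ} {R : Finset M}

theorem complete {f : Fin 16 → M} (hf : IsFrame B f) (h : DesignLat B R) (z : M) :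
    (4 : ℤ) • z = ∑ a, B z (f a) • f a := by
  set d := (4 : ℤ) • z - ∑ a, B z (f a) • f a with hd
  have hda : ∀ a, B d (f a) = 0 := by
    intro a
    rw [hd, map_sub, LinearMap.sub_apply, hf.apply_sum, map_smul, LinearMap.smul_apply, smul_eq_mul, sub_self]
  obtain ⟨c, hc, hc0⟩ := h.rank (Fin.snoc f d)
  rw [Fin.sum_univ_castSucc] at hc0
  simp only [Fin.snoc_castSucc, Fin.snoc_last] at hc0
  have h1 : ∀ a : Fin 16, c a.castSucc = 0 := by
    intro a
    have h2 := congrArg (fun w => B w (f a)) hc0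
    simp only [map_add, LinearMap.add_apply] at h2
    rw [hf.apply_sum (fun a => c a.castSucc), map_smul, LinearMap.smul_apply, hda] at h2
    simp at h2
    exact h2
  by_cases hd0 : d = 0
  · exact sub_eq_zero.1 hd0
  exfalso
  simp only [h1, zero_smul, Finset.sum_const_zero, zero_add] at hc0
  have h3 := congrArg (fun w => B w d) hc0
  simp only [map_smul, LinearMap.smul_apply, smul_eq_mul, map_zero, LinearMap.zero_apply] at h3
  have h4 : c (Fin.last 16) = 0 := (mul_eq_zero.1 h3).resolve_right (h.pos d hd0).ne'
  apply hc
  ext i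
  refine Fin.lastCases ?_ ?_ i
  · exact h4
  · exact h1

theorem normalize {f : Fin 16 → M} (hf : IsFrame B f) (h : DesignLat B R) (z : M) (hz : ¬ (2 ∣ B z (f 0))) :
    ∃ g : Fin 16 → M, IsFrame B g ∧ ∃ s, (4 : ℤ) • s = ∑ a, g a := by
  have h1 : ∀ a, ∃ e k : ℤ, (e = 1 ∨ e = -1) ∧ B z (f a) = e + 4 * k := by
    intro a
    obtain ⟨k, hk⟩ := hf.parity z a 0
    have : B z (f a) % 4 = 1 ∨ B z (f a) % 4 = 3 := by omega
    rcases this with h | h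
    · exact ⟨1, B z (f a) / 4, Or.inl rfl, by omega⟩
    · exact ⟨-1, B z (f a) / 4 + 1, Or.inr rfl, by omega⟩
  choose e k he hek using h1
  refine ⟨_, hf.flip e he, z - ∑ a, k a • f a, ?_⟩
  rw [hf.complete h (z - _)]
  refine Finset.sum_congr rfl fun a _ => ?_
  congr 1
  rw [map_sub, LinearMap.sub_apply, hf.apply_sum, hek]
  ring

end IsFrame

namespace DesignLat

variable {M : Type*} [AddCommGroup M] {B : M →ₗ[ℤ] M →ₗ[ℤ] ℤ} {R : Finset M}

/-- orthogonal complement of a family -/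
def perp (B : M →ₗ[ℤ] M →ₗ[ℤ] ℤ) (g : Fin 8 → M) : Submodule ℤ M where
  carrier := {z | ∀ a, B z (g a) = 0}
  add_mem' := by
    intro x y hx hy a
    rw [map_add, LinearMap.add_apply, hx a, hy a, add_zero]
  zero_mem' := by intro a; simp
  smul_mem' := by
    intro c x hx a
    rw [map_smul, LinearMap.smul_apply, hx a, smul_zero]

theorem mem_perp {g : Fin 8 → M} {z : M} : z ∈ perp B g ↔ ∀ a, B z (g a) = 0 := Iff.rfl

theorem four_s {g : Fin 8 → M} (h : DesignLat B R) (hg : IsFrame B g) {s : M} (hs : s ∈ R) (hsg : ∀ a, B s (g a) = 1) :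
    (4 : ℤ) • s = ∑ a, g a := by
  rw [hg.bessel_eq h s]
  · simp [hsg]
  · rw [(h.hR s).1 hs]; simp [hsg]

theorem root_split {g : Fin 8 → M} (h : DesignLat B R) (hg : IsFrame B g) {s : M} (hs : s ∈ R) (hsg : ∀ a, B s (g a) = 1)
    {x u : M} (hx : x ∈ R) (hu : u ∈ perp B g) (hxu : B x u ≠ 0) : x ∈ perp B g := by
  by_cases h8 : ∑ a, B x (g a) ^ 2 = 8
  · exfalso
    apply hxu
    have h1 := hg.bessel_eq h x (by rw [h8, (h.hR x).1 hx]; norm_num)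
    have h2 := congrArg (fun w => B w u) h1
    simp only [map_smul, LinearMap.smul_apply, smul_eq_mul, map_sum, LinearMap.sum_apply] at h2
    rw [Finset.sum_eq_zero] at h2
    · omega
    · intro a _
      rw [h.symm (g a) u, hu a, mul_zero]
  have hb := hg.bessel h x
  rw [(h.hR x).1 hx] at hb
  rcases Int.even_or_odd' (B x (g 0)) with ⟨k0, hk0 | hk0⟩
  · have h1 : ∀ a, ∃ k, B x (g a) = 2 * k := by
      intro a
      obtain ⟨k, hk⟩ := hg.parity x a 0
      exact ⟨k0 + k, by omega⟩
    choose k hk using h1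
    have h4 := congrArg (fun w => B x w) (h.four_s hg hs hsg)
    simp only [map_smul, smul_eq_mul, map_sum, hk] at h4
    simp only [hk, mul_pow] at hb h8
    rw [← Finset.mul_sum] at hb h4 h8
    have h5 : ∃ m, ∑ a, k a ^ 2 = ∑ a, k a + 2 * m := by
      have : ∀ a, ∃ m, k a ^ 2 = k a + 2 * m := by
        intro a
        obtain ⟨m, hm⟩ := Int.even_mul_succ_self (k a - 1)
        exact ⟨m, by linear_combination hm⟩
      choose m hm using this
      refine ⟨∑ a, m a, ?_⟩
      rw [Finset.mul_sum, ← Finset.sum_add_distrib]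
      exact Finset.sum_congr rfl fun a _ => hm a
    obtain ⟨m, hm⟩ := h5
    have h6 : 0 ≤ ∑ a, k a ^ 2 := Finset.sum_nonneg fun a _ => sq_nonneg _
    have h7 : ∑ a, k a ^ 2 = 0 := by omega
    rw [Finset.sum_eq_zero_iff_of_nonneg (fun a _ => sq_nonneg _)] at h7
    intro a
    have := h7 a (Finset.mem_univ _)
    rw [hk, pow_eq_zero_iff (by norm_num)] at *
    omega
  · exfalso
    have h1 : ∀ a, 1 ≤ B x (g a) ^ 2 := by
      intro a
      obtain ⟨k, hk⟩ := hg.parity x a 0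
      have : B x (g a) ≠ 0 := by omega
      have := sq_pos_of_ne_zero this
      omega
    have h2 := Finset.sum_le_sum fun (a : Fin 8) (_ : a ∈ Finset.univ) => h1 a
    simp only [Finset.sum_const, Finset.card_univ, Fintype.card_fin, nsmul_eq_mul, mul_one] at h2
    push_cast at h2
    omega

theorem restrict {g : Fin 8 → M} (h : DesignLat B R) (hg : IsFrame B g) {s : M} (hs : s ∈ R) (hsg : ∀ a, B s (g a) = 1) :
    ∃ R' : Finset (perp B g), DesignLat (B.domRestrict₁₂ (perp B g) (perp B g)) R' := by
  classical
  refine ⟨R.subtype (· ∈ perp B g), ?_, ?_, ?_, ?_, ?_⟩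
  · intro x y; exact h.symm x y
  · intro x hx
    exact h.pos x (fun e => hx (Subtype.ext e))
  · intro x
    rw [Finset.mem_subtype]
    exact h.hR x
  · intro u
    have h1 := h.design (u : M)
    have h2 : ∑ x ∈ R.subtype (· ∈ perp B g), (B x u) ^ 2 = ∑ x ∈ R with x ∈ perp B g, (B x u) ^ 2 :=
      Finset.sum_subtype_eq_sum_filter (fun x : M => (B x u) ^ 2)
    simp only [LinearMap.domRestrict₁₂_apply]
    rw [h2, ← h1]
    apply Finset.sum_subset (Finset.filter_subset _ _)
    intro x hx hx'
    by_contra hne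
    apply hx'
    rw [Finset.mem_filter]
    refine ⟨hx, h.root_split hg hs hsg hx u.2 ?_⟩
    intro e
    rw [e] at hne
    exact hne (by norm_num)
  · intro v
    obtain ⟨c, hc, hc0⟩ := h.rank (fun i => (v i : M))
    refine ⟨c, hc, ?_⟩
    apply Subtype.ext
    simpa using hc0

theorem lift_frame {j : ℕ} {g : Fin 8 → M} {f : Fin j → perp B g}
    (hf : IsFrame (B.domRestrict₁₂ (perp B g) (perp B g)) f) : IsFrame B (fun a => (f a : M)) where
  norm := hf.norm
  orth := hf.orth
  congr := by
    intro a b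
    obtain ⟨m, hm⟩ := hf.congr a b
    exact ⟨m, by simpa using congrArg Subtype.val hm⟩

/-- The final alternative. -/
theorem trichotomy (h : DesignLat B R) (u : M) (hu : u ≠ 0) (hperp : ∀ g : Fin 8 → M, ∃ z ≠ 0, ∀ a, B z (g a) = 0) :
    (∃ f : Fin 16 → M, IsFrame B f) ∨
    (∃ g g' : Fin 8 → M, IsFrame B g ∧ IsFrame B g' ∧ (∀ a b, B (g' a) (g b) = 0) ∧
      (∃ s, (4 : ℤ) • s = ∑ a, g a) ∧ (∃ s, (4 : ℤ) • s = ∑ a, g' a)) := by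
  rcases h.dichotomy u hu with h1 | ⟨g, hg, s, hs, hsg⟩
  · exact Or.inl h1
  obtain ⟨R', h'⟩ := h.restrict hg hs hsg
  obtain ⟨z, hz, hzg⟩ := hperp g
  rcases h'.dichotomy ⟨z, hzg⟩ (fun e => hz (congrArg Subtype.val e)) with ⟨f, hf⟩ | ⟨g', hg', s', hs', hsg'⟩
  · exact Or.inl ⟨_, lift_frame hf⟩
  · refine Or.inr ⟨g, _, hg, lift_frame hg', ?_, ⟨s, h.four_s hg hs hsg⟩, s', ?_⟩
    · intro a b
      exact (g' a).2 b
    · have := congrArg Subtype.val (h'.four_s hg' hs' hsg')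
      simpa using this

end DesignLat


namespace WittAux

open Matrix hiding gram PosDef

/-- upper triangular part -/
def upper {n : ℕ} (c : Matrix (Fin n) (Fin n) ℤ) : Matrix (Fin n) (Fin n) ℤ :=
  Matrix.of fun i j => if i ≤ j then c i j else 0

theorem Qform_eq {n : ℕ} (c : Matrix (Fin n) (Fin n) ℤ) (x : Fin n → ℤ) : Qform c x = x ⬝ᵥ upper c *ᵥ x := by
  simp only [Qform, dotProduct, mulVec, upper, Matrix.of_apply, Finset.mul_sum]
  refine Finset.sum_congr rfl fun i _ => Finset.sum_congr rfl fun j _ => ?_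
  split_ifs <;> ring

theorem Tbil_eq {n : ℕ} (c : Matrix (Fin n) (Fin n) ℤ) (x y : Fin n → ℤ) :
    Tbil c x y = x ⬝ᵥ (upper c + (upper c)ᵀ) *ᵥ y := by
  have h1 : x ⬝ᵥ (upper c)ᵀ *ᵥ y = y ⬝ᵥ upper c *ᵥ x := by
    rw [mulVec_transpose, dotProduct_comm, ← dotProduct_mulVec]
  rw [Tbil, Qform_eq, Qform_eq, Qform_eq, add_mulVec, dotProduct_add, h1]
  simp only [mulVec_add, dotProduct_add, add_dotProduct]
  ring

theorem gram_eq {n : ℕ} (c : Matrix (Fin n) (Fin n) ℤ) : gram c = upper c + (upper c)ᵀ := by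
  ext i j
  rw [gram, Matrix.of_apply, Tbil_eq]
  simp

theorem Tbil_gram {n : ℕ} (c : Matrix (Fin n) (Fin n) ℤ) (x y : Fin n → ℤ) : Tbil c x y = x ⬝ᵥ gram c *ᵥ y := by
  rw [gram_eq, Tbil_eq]

theorem gram_symm {n : ℕ} (c : Matrix (Fin n) (Fin n) ℤ) : (gram c)ᵀ = gram c := by
  rw [gram_eq, transpose_add, transpose_transpose, add_comm]

theorem gram_norm {n : ℕ} (c : Matrix (Fin n) (Fin n) ℤ) (x : Fin n → ℤ) : x ⬝ᵥ gram c *ᵥ x = 2 * Qform c x := by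
  have h1 : x ⬝ᵥ (upper c)ᵀ *ᵥ x = x ⬝ᵥ upper c *ᵥ x := by
    rw [mulVec_transpose, dotProduct_comm, ← dotProduct_mulVec]
  rw [gram_eq, add_mulVec, dotProduct_add, h1, Qform_eq]
  ring

theorem Qform_zero {n : ℕ} (c : Matrix (Fin n) (Fin n) ℤ) : Qform c 0 = 0 := by
  simp [Qform]

theorem disc_iff (c : Matrix (Fin 16) (Fin 16) ℤ) : HasDisc c 1 ↔ (gram c).det = 1 := by
  have h : eps 16 = 0 := by
    rw [eps, if_pos (by decide)]
  rw [HasDisc, h]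
  simp

theorem evenUni {c : Matrix (Fin 16) (Fin 16) ℤ} (hp : PosDef c) (hd : HasDisc c 1) :
    EvenUni (gram c) (fun x => (Qform c x).toNat) where
  sym := gram_symm c
  det := (disc_iff c).1 hd
  hq := by
    intro x
    have : 0 ≤ Qform c x := by
      by_cases hx : x = 0
      · subst hx; rw [Qform_zero]
      · exact (hp x hx).le
    rw [gram_norm, Int.toNat_of_nonneg this]
  pos := by
    intro x hx
    have := hp x hx
    simpa using this

/-- the bilinear form of a matrix -/
def bil (A : Matrix (Fin 16) (Fin 16) ℤ) : (Fin 16 → ℤ) →ₗ[ℤ] (Fin 16 → ℤ) →ₗ[ℤ] ℤ :=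
  LinearMap.mk₂ ℤ (fun x y => x ⬝ᵥ A *ᵥ y)
    (by intros; simp [add_dotProduct]) (by intros; simp only [smul_dotProduct])
    (by intros; simp [mulVec_add, dotProduct_add]) (by intros; simp only [mulVec_smul, dotProduct_smul])

theorem bil_apply (A : Matrix (Fin 16) (Fin 16) ℤ) (x y : Fin 16 → ℤ) : bil A x y = x ⬝ᵥ A *ᵥ y := rfl

theorem rank_rel (v : Fin 17 → Fin 16 → ℤ) : ∃ c : Fin 17 → ℤ, c ≠ 0 ∧ ∑ i, c i • v i = 0 := by
  let N : Matrix (Fin 17) (Fin 17) ℤ := Matrix.of fun i j => if h : i.val < 16 then v j ⟨i.val, h⟩ else 0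
  have hN : N.det = 0 := by
    apply Matrix.det_eq_zero_of_row_eq_zero (Fin.last 16)
    intro j
    simp [N]
  obtain ⟨z, hz, hNz⟩ := Matrix.exists_mulVec_eq_zero_iff.2 hN
  refine ⟨z, hz, ?_⟩
  ext i
  have := congrFun hNz i.castSucc
  simp only [mulVec, dotProduct, N, Matrix.of_apply, Fin.val_castSucc, i.2, dif_pos, Pi.zero_apply] at this
  rw [Finset.sum_apply, Pi.zero_apply, ← this]
  refine Finset.sum_congr rfl fun j _ => ?_
  rw [Pi.smul_apply, smul_eq_mul, mul_comm]

theorem designLat {A : Matrix (Fin 16) (Fin 16) ℤ} {q : (Fin 16 → ℤ) → ℕ} (h : EvenUni A q) :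
    ∃ R : Finset (Fin 16 → ℤ), DesignLat (bil A) R := by
  obtain ⟨R, hR⟩ := h.exists_roots
  refine ⟨R, ?_, ?_, ?_, ?_, rank_rel⟩
  · intro x y; exact h.comm x y
  · intro x hx
    have := h.pos x hx
    rw [bil_apply, h.hq]
    omega
  · intro x
    rw [hR, bil_apply, h.hq]
    omega
  · intro u
    exact h.design R hR u

theorem unimod_two {A : Matrix (Fin 16) (Fin 16) ℤ} (hdet : A.det = 1) (v : Fin 16 → ℤ) (hv : ∀ i, 2 ∣ (A *ᵥ v) i) :
    ∃ m : Fin 16 → ℤ, v = (2 : ℤ) • m := by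
  choose y hy using hv
  have h1 : A *ᵥ v = (2 : ℤ) • y := by
    ext i; rw [hy]; rfl
  refine ⟨A⁻¹ *ᵥ y, ?_⟩
  rw [← mulVec_smul, ← h1, mulVec_mulVec, nonsing_inv_mul _ (by rw [hdet]; exact isUnit_one), one_mulVec]

theorem exists_odd {A : Matrix (Fin 16) (Fin 16) ℤ} {q : (Fin 16 → ℤ) → ℕ} (h : EvenUni A q) (w : Fin 16 → ℤ)
    (hw : bil A w w = 4) : ∃ z, ¬ 2 ∣ bil A z w := by
  by_contra hcon
  push Not at hcon
  obtain ⟨m, hm⟩ := unimod_two h.det w (fun i => by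
    have := hcon (Pi.single i 1)
    rwa [bil_apply, single_one_dotProduct] at this)
  rw [hm] at hw
  simp only [map_smul, LinearMap.smul_apply, smul_eq_mul, bil_apply, h.hq] at hw
  omega

/-- equivalence from a system of vectors with the prescribed Gram matrix -/
theorem formEquiv_of_vectors {c a : Matrix (Fin 16) (Fin 16) ℤ} (hc : HasDisc c 1) (ha : HasDisc a 1)
    (w : Fin 16 → Fin 16 → ℤ) (hw : ∀ i j, bil (gram c) (w i) (w j) = gram a i j) : FormEquiv (Qform c) (Qform a) := by
  rw [disc_iff] at hc ha
  let P : Matrix (Fin 16) (Fin 16) ℤ := (Matrix.of w)ᵀ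
  have h1 : Pᵀ * gram c * P = gram a := by
    ext i j
    rw [← hw, bil_apply, dotProduct_mulVec, Matrix.mul_apply]
    rfl
  have hdet : P.det * P.det = 1 := by
    have := congrArg Matrix.det h1
    rw [det_mul, det_mul, det_transpose, hc, ha] at this
    linarith
  have hu : IsUnit P := (Matrix.isUnit_iff_isUnit_det _).2 (IsUnit.of_mul_eq_one _ hdet)
  obtain ⟨g, hg⟩ := hu
  refine ⟨g⁻¹, fun x => ?_⟩
  rw [inv_inv, hg]
  have h2 := gram_norm c (P *ᵥ x)
  have h3 := gram_norm a x
  rw [← h1] at h3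
  have h4 : x ⬝ᵥ (Pᵀ * gram c * P) *ᵥ x = (P *ᵥ x) ⬝ᵥ gram c *ᵥ (P *ᵥ x) := by
    rw [← mulVec_mulVec, ← mulVec_mulVec, dotProduct_mulVec x, vecMul_transpose]
  omega

theorem gram_of_coords {A : Matrix (Fin 16) (Fin 16) ℤ} (f w : Fin 16 → Fin 16 → ℤ)
    (hf : ∀ a b, bil A (f a) (f b) = if a = b then 4 else 0) (C : Matrix (Fin 16) (Fin 16) ℤ)
    (hw : ∀ i, (4 : ℤ) • w i = ∑ a, C i a • f a) (i j : Fin 16) : 4 * bil A (w i) (w j) = (C * Cᵀ) i j := by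
  have h1 : bil A ((4 : ℤ) • w i) ((4 : ℤ) • w j) = 16 * bil A (w i) (w j) := by
    simp only [map_smul, LinearMap.smul_apply, smul_eq_mul]; ring
  have h2 : bil A ((4 : ℤ) • w i) ((4 : ℤ) • w j) = 4 * (C * Cᵀ) i j := by
    rw [hw, hw]
    simp only [map_smul, LinearMap.smul_apply, smul_eq_mul, map_sum, LinearMap.sum_apply, hf, Matrix.mul_apply,
      transpose_apply, Finset.mul_sum]
    refine Finset.sum_congr rfl fun a _ => ?_
    rw [Finset.sum_eq_single a]
    · simp; ring
    · intro b _ hb; simp [hb]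
    · simp
  omega

/-- reference form from coordinate matrix -/
def refForm (C : Matrix (Fin 16) (Fin 16) ℤ) : Matrix (Fin 16) (Fin 16) ℤ :=
  Matrix.of fun i j => if i = j then (∑ a, C i a * C j a) / 8 else (∑ a, C i a * C j a) / 4

/-- integrality of the reference form -/
def Good (C : Matrix (Fin 16) (Fin 16) ℤ) : Prop :=
  (∀ i j, 4 ∣ ∑ a, C i a * C j a) ∧ (∀ i, 8 ∣ ∑ a, C i a * C i a) ∧ (∀ i j, C i j = 0 ∨ j ≤ i) ∧ (∏ i, C i i) = 2 ^ 16

theorem ref_gram {C : Matrix (Fin 16) (Fin 16) ℤ} (hC : Good C) : (4 : ℤ) • gram (refForm C) = C * Cᵀ := by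
  obtain ⟨h4, h8, -, -⟩ := hC
  ext i j
  rw [gram_eq, Matrix.mul_apply]
  simp only [Matrix.smul_apply, Matrix.add_apply, transpose_apply, upper, refForm, Matrix.of_apply, smul_eq_mul]
  have e : ∑ a, C j a * C i a = ∑ a, C i a * C j a := Finset.sum_congr rfl fun _ _ => mul_comm _ _
  have := h4 i j
  have := h8 i
  rcases lt_trichotomy i j with h | h | h
  · rw [if_pos h.le, if_neg h.ne, if_neg (not_le.2 h)]
    omega
  · subst h
    simp only [le_refl, if_true]
    omega
  · rw [if_neg (not_le.2 h), if_pos h.le, if_neg h.ne, e]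
    omega

theorem good_det {C : Matrix (Fin 16) (Fin 16) ℤ} (hC : Good C) : C.det = 2 ^ 16 := by
  rw [← hC.2.2.2]
  exact Matrix.det_of_lowerTriangular C (fun i j hij => (hC.2.2.1 i j).resolve_right (not_le.2 hij))

theorem ref_disc {C : Matrix (Fin 16) (Fin 16) ℤ} (hC : Good C) : HasDisc (refForm C) 1 := by
  rw [disc_iff]
  have := congrArg Matrix.det (ref_gram hC)
  rw [det_smul, det_mul, det_transpose, good_det hC] at this
  simp at this
  omega

theorem ref_norm {C : Matrix (Fin 16) (Fin 16) ℤ} (hC : Good C) (x : Fin 16 → ℤ) :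
    8 * Qform (refForm C) x = ∑ a, (x ᵥ* C) a ^ 2 := by
  have h1 := gram_norm (refForm C) x
  have h2 : 4 * (x ⬝ᵥ gram (refForm C) *ᵥ x) = x ⬝ᵥ (C * Cᵀ) *ᵥ x := by
    rw [← ref_gram hC, smul_mulVec, dotProduct_smul, smul_eq_mul]
  rw [← mulVec_mulVec, dotProduct_mulVec x C, mulVec_transpose] at h2
  have h3 : ∑ a, (x ᵥ* C) a ^ 2 = (x ᵥ* C) ⬝ᵥ (x ᵥ* C) := by
    simp only [dotProduct, sq]
  rw [h3, ← h2]
  omega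

theorem ref_pos {C : Matrix (Fin 16) (Fin 16) ℤ} (hC : Good C) : PosDef (refForm C) := by
  intro x hx
  have h1 := ref_norm hC x
  have h2 : 0 ≤ ∑ a, (x ᵥ* C) a ^ 2 := Finset.sum_nonneg fun a _ => sq_nonneg _
  have h3 : ∑ a, (x ᵥ* C) a ^ 2 ≠ 0 := by
    intro h0
    rw [Finset.sum_eq_zero_iff_of_nonneg (fun a _ => sq_nonneg _)] at h0
    have h4 : x ᵥ* C = 0 := by
      ext a
      exact pow_eq_zero_iff (two_ne_zero) |>.1 (h0 a (Finset.mem_univ _))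
    have h5 : C.det = 0 := Matrix.exists_vecMul_eq_zero_iff.1 ⟨x, hx, h4⟩
    rw [good_det hC] at h5
    norm_num at h5
  omega

theorem formEquiv_ref {C : Matrix (Fin 16) (Fin 16) ℤ} (hC : Good C) {c : Matrix (Fin 16) (Fin 16) ℤ}
    (hc : HasDisc c 1) (f w : Fin 16 → Fin 16 → ℤ)
    (hf : ∀ a b, bil (gram c) (f a) (f b) = if a = b then 4 else 0)
    (hw : ∀ i, (4 : ℤ) • w i = ∑ a, C i a • f a) : FormEquiv (Qform c) (Qform (refForm C)) := by
  refine formEquiv_of_vectors hc (ref_disc hC) w fun i j => ?_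
  have h1 := gram_of_coords f w hf C hw i j
  rw [← ref_gram hC, Matrix.smul_apply, smul_eq_mul] at h1
  omega

/-- coordinates for the half spin lattice -/
def CD : Matrix (Fin 16) (Fin 16) ℤ := Matrix.of fun i a =>
  if i.val = 0 then (if a.val = 0 then 4 else 0)
  else if i.val = 15 then 1
  else if a.val = i.val then 2 else if a.val + 1 = i.val then -2 else 0

/-- coordinates for two copies of the exceptional lattice -/
def CE : Matrix (Fin 16) (Fin 16) ℤ := Matrix.of fun i a =>
  if i.val = 0 ∨ i.val = 8 then (if a.val = i.val then 4 else 0)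
  else if i.val = 7 then (if a.val < 8 then 1 else 0)
  else if i.val = 15 then (if 8 ≤ a.val then 1 else 0)
  else if a.val = i.val then 2 else if a.val + 1 = i.val then -2 else 0

theorem good_CD : Good CD := by
  refine ⟨by decide +kernel, by decide +kernel, ?_, by decide +kernel⟩
  intro i j
  rw [Fin.le_def]
  simp only [CD, Matrix.of_apply]
  split_ifs <;> first | (right; omega) | (left; rfl)

theorem good_CE : Good CE := by
  refine ⟨by decide +kernel, by decide +kernel, ?_, by decide +kernel⟩
  intro i j
  rw [Fin.le_def]
  simp only [CE, Matrix.of_apply]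
  split_ifs <;> first | (right; omega) | (left; rfl)

end WittAux


namespace WittAux

open Matrix hiding gram PosDef

theorem row_mid (f : Fin 16 → Fin 16 → ℤ) (i i' : Fin 16) (hi : i'.val + 1 = i.val)
    (hm : ∃ m, f i - f i' = (2 : ℤ) • m) :
    ∃ w, (4 : ℤ) • w = ∑ a : Fin 16, (if a.val = i.val then (2 : ℤ) else if a.val + 1 = i.val then -2 else 0) • f a := by
  obtain ⟨m, hm⟩ := hm
  refine ⟨m, ?_⟩
  have h1 : ∀ a : Fin 16, (if a.val = i.val then (2 : ℤ) else if a.val + 1 = i.val then -2 else 0) • f a =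
      (if a = i then (2 : ℤ) • f a else 0) - (if a = i' then (2 : ℤ) • f a else 0) := by
    intro a
    by_cases ha : a = i
    · subst ha
      have : a ≠ i' := by rintro rfl; omega
      simp [this]
    · by_cases ha' : a = i'
      · subst ha'
        rw [if_neg (by omega), if_pos hi, if_neg ha, if_pos rfl]
        simp
      · have e1 : ¬ a.val = i.val := fun e => ha (Fin.ext e)
        have e2 : ¬ a.val + 1 = i.val := fun e => ha' (Fin.ext (by omega))
        simp only [if_neg ha, if_neg ha', if_neg e1, if_neg e2, zero_smul, sub_self]
  rw [Finset.sum_congr rfl fun a _ => h1 a, Finset.sum_sub_distrib, Finset.sum_ite_eq', Finset.sum_ite_eq',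
    if_pos (Finset.mem_univ _), if_pos (Finset.mem_univ _), ← smul_sub, hm, smul_smul]
  norm_num

theorem row_zero (f : Fin 16 → Fin 16 → ℤ) (i : Fin 16) :
    ∃ w, (4 : ℤ) • w = ∑ a : Fin 16, (if a.val = i.val then (4 : ℤ) else 0) • f a := by
  refine ⟨f i, ?_⟩
  rw [Finset.sum_eq_single i]
  · simp
  · intro b _ hb
    rw [if_neg (fun e => hb (Fin.ext e)), zero_smul]
  · simp

theorem case_D {c : Matrix (Fin 16) (Fin 16) ℤ} (hc : HasDisc c 1) (f : Fin 16 → Fin 16 → ℤ)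
    (hf : IsFrame (bil (gram c)) f) (s : Fin 16 → ℤ) (hs : (4 : ℤ) • s = ∑ a, f a) :
    FormEquiv (Qform c) (Qform (refForm CD)) := by
  have h1 : ∀ i, ∃ w, (4 : ℤ) • w = ∑ a, CD i a • f a := by
    intro i
    simp only [CD, Matrix.of_apply]
    by_cases h0 : i.val = 0
    · simp only [if_pos h0]
      simpa [h0] using row_zero f i
    by_cases h15 : i.val = 15
    · simp only [if_neg h0, if_pos h15, one_smul]
      exact ⟨s, hs⟩
    simp only [if_neg h0, if_neg h15]
    exact row_mid f i ⟨i.val - 1, by omega⟩ (by simp only; omega) (hf.congr _ _)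
  choose w hw using h1
  refine formEquiv_ref good_CD hc f w ?_ hw
  intro a b
  split_ifs with hab
  · subst hab; exact hf.norm a
  · exact hf.orth a b hab

/-- concatenation of two families -/
def cat (g g' : Fin 8 → Fin 16 → ℤ) (a : Fin 16) : Fin 16 → ℤ :=
  if h : a.val < 8 then g ⟨a.val, h⟩ else g' ⟨a.val - 8, by omega⟩

theorem case_E {c : Matrix (Fin 16) (Fin 16) ℤ} (hc : HasDisc c 1) (g g' : Fin 8 → Fin 16 → ℤ)
    (hg : IsFrame (bil (gram c)) g) (hg' : IsFrame (bil (gram c)) g') (ho : ∀ a b, bil (gram c) (g' a) (g b) = 0)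
    (ho' : ∀ a b, bil (gram c) (g a) (g' b) = 0)
    (s s' : Fin 16 → ℤ) (hs : (4 : ℤ) • s = ∑ a, g a) (hs' : (4 : ℤ) • s' = ∑ a, g' a) :
    FormEquiv (Qform c) (Qform (refForm CE)) := by
  have hsum : ∀ u : Fin 16 → ℤ, ∑ a, u a • cat g g' a =
      ∑ a : Fin 8, u ⟨a.val, by omega⟩ • g a + ∑ a : Fin 8, u ⟨a.val + 8, by omega⟩ • g' a := by
    intro u
    rw [Fin.sum_univ_add (a := 8) (b := 8) (fun a : Fin (8 + 8) => u a • cat g g' a)]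
    congr 1
  have hcongr : ∀ i i' : Fin 16, i'.val + 1 = i.val → i.val ≠ 8 → ∃ m, cat g g' i - cat g g' i' = (2 : ℤ) • m := by
    intro i i' hi h8
    by_cases h : i.val < 8
    · simp only [cat, dif_pos h, dif_pos (show i'.val < 8 by omega)]
      exact hg.congr _ _
    · simp only [cat, dif_neg h, dif_neg (show ¬ i'.val < 8 by omega)]
      exact hg'.congr _ _
  have h1 : ∀ i, ∃ w, (4 : ℤ) • w = ∑ a, CE i a • cat g g' a := by
    intro i
    simp only [CE, Matrix.of_apply]
    by_cases h0 : i.val = 0 ∨ i.val = 8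
    · simp only [if_pos h0]
      exact row_zero _ i
    by_cases h7 : i.val = 7
    · simp only [if_neg h0, if_pos h7]
      refine ⟨s, ?_⟩
      rw [hsum, hs]
      simp
    by_cases h15 : i.val = 15
    · simp only [if_neg h0, if_neg h7, if_pos h15]
      refine ⟨s', ?_⟩
      rw [hsum, hs']
      simp [show ∀ x : Fin 8, ¬ 8 ≤ x.val from fun x => by omega]
    simp only [if_neg h0, if_neg h7, if_neg h15]
    exact row_mid _ i ⟨i.val - 1, by omega⟩ (by simp only; omega) (hcongr _ _ (by simp only; omega) (by omega))
  choose w hw using h1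
  refine formEquiv_ref good_CE hc (cat g g') w ?_ hw
  intro a b
  by_cases ha : a.val < 8 <;> by_cases hb : b.val < 8
  · simp only [cat, dif_pos ha, dif_pos hb]
    split_ifs with hab
    · subst hab; exact hg.norm _
    · exact hg.orth _ _ (fun e => hab (Fin.ext (by simpa using e)))
  · simp only [cat, dif_pos ha, dif_neg hb]
    rw [if_neg (by rintro rfl; exact hb ha), ho']
  · simp only [cat, dif_neg ha, dif_pos hb]
    rw [if_neg (by rintro rfl; exact ha hb), ho]
  · simp only [cat, dif_neg ha, dif_neg hb]
    split_ifs with hab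
    · subst hab; exact hg'.norm _
    · refine hg'.orth _ _ (fun e => hab (Fin.ext ?_))
      have := congrArg Fin.val e
      simp only at this
      omega

theorem classify {c : Matrix (Fin 16) (Fin 16) ℤ} (hp : PosDef c) (hc : HasDisc c 1) :
    FormEquiv (Qform c) (Qform (refForm CE)) ∨ FormEquiv (Qform c) (Qform (refForm CD)) := by
  have hE := evenUni hp hc
  obtain ⟨R, h⟩ := designLat hE
  have hperp : ∀ g : Fin 8 → Fin 16 → ℤ, ∃ z ≠ 0, ∀ a, bil (gram c) z (g a) = 0 := by
    intro g
    obtain ⟨z, hz, hzg⟩ := EvenUni.exists_orth (gram c) 8 (by norm_num) (fun i => if h : i < 8 then g ⟨i, h⟩ else 0)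
    refine ⟨z, hz, fun a => ?_⟩
    have := hzg a.val a.2
    rw [h.symm, bil_apply]
    simpa using this
  have h1 : (Pi.single 0 1 : Fin 16 → ℤ) ≠ 0 := by simp
  rcases h.trichotomy _ h1 hperp with ⟨f, hf⟩ | ⟨g, g', hg, hg', ho, ⟨s, hs⟩, ⟨s', hs'⟩⟩
  · right
    obtain ⟨z, hz⟩ := exists_odd hE (f 0) (hf.norm 0)
    obtain ⟨f', hf', s, hs⟩ := hf.normalize h z hz
    exact case_D hc f' hf' s hs
  · left
    exact case_E hc g g' hg hg' ho (fun a b => by rw [h.symm, ho]) s s' hs hs'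

theorem D_even (x : Fin 16 → ℤ) (hx : Qform (refForm CD) x = 1) : 2 ∣ Tbil (refForm CD) x (Pi.single 0 1) := by
  have h1 := ref_norm good_CD x
  have h2 : 4 * Tbil (refForm CD) x (Pi.single 0 1) = 4 * (x ᵥ* CD) 0 := by
    rw [Tbil_gram]
    have : 4 * (x ⬝ᵥ gram (refForm CD) *ᵥ Pi.single 0 1) = x ⬝ᵥ (CD * CDᵀ) *ᵥ Pi.single 0 1 := by
      rw [← ref_gram good_CD, smul_mulVec, dotProduct_smul, smul_eq_mul]
    rw [this, ← mulVec_mulVec, dotProduct_mulVec x CD, mulVec_single_one]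
    rw [dotProduct, Finset.sum_eq_single 0]
    · simp [CD]; ring
    · intro b _ hb
      simp [CD, hb]
    · simp
  have h3 : ∀ a, ∃ k, (x ᵥ* CD) a = x 15 + 2 * k := by
    intro a
    have : ∀ i, ∃ k, x i * CD i a = (if i = 15 then x i else 0) + 2 * k := by
      intro i
      by_cases hi : i = 15
      · subst hi
        exact ⟨0, by simp [CD]⟩
      · have hi' : ¬ i.val = 15 := fun e => hi (Fin.ext e)
        simp only [CD, Matrix.of_apply, if_neg hi, if_neg hi']
        split_ifs
        · exact ⟨2 * x i, by ring⟩
        · exact ⟨0, by ring⟩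
        · exact ⟨x i, by ring⟩
        · exact ⟨- x i, by ring⟩
        · exact ⟨0, by ring⟩
    choose k hk using this
    refine ⟨∑ i, k i, ?_⟩
    rw [vecMul, dotProduct, Finset.sum_congr rfl fun i _ => hk i, Finset.sum_add_distrib, Finset.sum_ite_eq',
      if_pos (Finset.mem_univ _), ← Finset.mul_sum]
  have h4 : Tbil (refForm CD) x (Pi.single 0 1) = (x ᵥ* CD) 0 := by omega
  rw [h4]
  by_contra hodd
  obtain ⟨k0, hk0⟩ := h3 0
  have h5 : ∀ a, 1 ≤ (x ᵥ* CD) a ^ 2 := by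
    intro a
    obtain ⟨k, hk⟩ := h3 a
    have : (x ᵥ* CD) a ≠ 0 := by omega
    have := sq_pos_of_ne_zero this
    omega
  have h6 := Finset.sum_le_sum fun (a : Fin 16) (_ : a ∈ Finset.univ) => h5 a
  simp only [Finset.sum_const, Finset.card_univ, Fintype.card_fin, nsmul_eq_mul, mul_one] at h6
  rw [← h1, hx] at h6
  norm_num at h6

theorem not_equiv : ¬ FormEquiv (Qform (refForm CE)) (Qform (refForm CD)) := by
  rintro ⟨g, hg⟩
  set P : Matrix (Fin 16) (Fin 16) ℤ := (↑(g⁻¹) : Matrix (Fin 16) (Fin 16) ℤ) with hP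
  have hPg : P * (↑g : Matrix (Fin 16) (Fin 16) ℤ) = 1 := by
    rw [hP, ← Units.val_mul, inv_mul_cancel, Units.val_one]
  set v := P *ᵥ Pi.single 0 1 with hv
  have hQ : Qform (refForm CE) v = 2 := by
    rw [hv, ← hg]
    decide +kernel
  have hT : ∀ y, Qform (refForm CE) y = 1 → 2 ∣ Tbil (refForm CE) y v := by
    intro y hy
    have hy' : P *ᵥ ((↑g : Matrix (Fin 16) (Fin 16) ℤ) *ᵥ y) = y := by
      rw [mulVec_mulVec, hPg, one_mulVec]
    have h1 := D_even ((↑g : Matrix (Fin 16) (Fin 16) ℤ) *ᵥ y) (by rw [hg, hy', hy])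
    rw [Tbil, hg, hg, hg, mulVec_add, hy'] at h1
    exact h1
  have hroot : ∀ i : Fin 16, i ≠ 0 → i ≠ 8 → Qform (refForm CE) (Pi.single i 1) = 1 := by
    decide +kernel
  have hr0 : Qform (refForm CE) (Pi.single 0 1 + Pi.single 1 1) = 1 := by decide +kernel
  have hr8 : Qform (refForm CE) (Pi.single 8 1 + Pi.single 9 1) = 1 := by decide +kernel
  have hrow : ∀ i, Tbil (refForm CE) (Pi.single i 1) v = (gram (refForm CE) *ᵥ v) i := by
    intro i
    rw [Tbil_gram, single_one_dotProduct]
  have hadd : ∀ i j, Tbil (refForm CE) (Pi.single i 1 + Pi.single j 1) v =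
      (gram (refForm CE) *ᵥ v) i + (gram (refForm CE) *ᵥ v) j := by
    intro i j
    rw [Tbil_gram, add_dotProduct, single_one_dotProduct, single_one_dotProduct]
  have hall : ∀ i, 2 ∣ (gram (refForm CE) *ᵥ v) i := by
    have hbase : ∀ i : Fin 16, i ≠ 0 → i ≠ 8 → 2 ∣ (gram (refForm CE) *ᵥ v) i := by
      intro i h0 h8
      rw [← hrow]
      exact hT _ (hroot i h0 h8)
    intro i
    by_cases h0 : i = 0
    · subst h0
      have h1 := hT _ hr0
      rw [hadd] at h1
      have h2 := hbase 1 (by decide) (by decide)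
      omega
    by_cases h8 : i = 8
    · subst h8
      have h1 := hT _ hr8
      rw [hadd] at h1
      have h2 := hbase 9 (by decide) (by decide)
      omega
    exact hbase i h0 h8
  obtain ⟨m, hm⟩ := unimod_two ((disc_iff _).1 (ref_disc good_CE)) v hall
  have h1 := gram_norm (refForm CE) v
  have h2 := gram_norm (refForm CE) m
  rw [hQ, hm, mulVec_smul, dotProduct_smul, smul_dotProduct, h2] at h1
  simp only [smul_eq_mul] at h1
  omega

end WittAux

/-- Witt's theorem: there are exactly two `GL₁₆(ℤ)`-equivalence classes of
positive definite integral quadratic forms in `16` variables with discriminant `1`. -/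
theorem witt_sixteen :
    ∃ a b : Matrix (Fin 16) (Fin 16) ℤ,
      PosDef a ∧ HasDisc a 1 ∧ PosDef b ∧ HasDisc b 1 ∧
      ¬ FormEquiv (Qform a) (Qform b) ∧
      ∀ c : Matrix (Fin 16) (Fin 16) ℤ, PosDef c → HasDisc c 1 →
        (FormEquiv (Qform c) (Qform a) ∨ FormEquiv (Qform c) (Qform b)) := by
  refine ⟨WittAux.refForm WittAux.CE, WittAux.refForm WittAux.CD, WittAux.ref_pos WittAux.good_CE,
    WittAux.ref_disc WittAux.good_CE, WittAux.ref_pos WittAux.good_CD, WittAux.ref_disc WittAux.good_CD,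
    WittAux.not_equiv, fun c hp hc => WittAux.classify hp hc⟩
end

section
/- There are exactly two GL_3(ℤ)-equivalence classes of positive definite integral ternary quadratic forms with discriminant 11, represented by Q(x,y,z) = x² + y² + yz + 3z² and Q'(x,y,z) = x² + xy + xz + y² + yz + 4z²; in particular Q and Q' are not equivalent. -/
open scoped BigOperators

/-- Coefficient matrix of `Q(x,y,z) = x² + y² + yz + 3z²`. -/
def Qmat : Matrix (Fin 3) (Fin 3) ℤ := !![1, 0, 0; 0, 1, 1; 0, 0, 3]

/-- Coefficient matrix of `Q'(x,y,z) = x² + xy + xz + y² + yz + 4z²`. -/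
def Q'mat : Matrix (Fin 3) (Fin 3) ℤ := !![1, 1, 1; 0, 1, 1; 0, 0, 4]


/-- The ternary form with coefficients `a, b, c` (squares), `r = yz`, `s = xz`, `t = xy`. -/
def q3 (a b c r s t : ℤ) : (Fin 3 → ℤ) → ℤ := fun v =>
  a * v 0 ^ 2 + b * v 1 ^ 2 + c * v 2 ^ 2 + r * v 1 * v 2 + s * v 0 * v 2 + t * v 0 * v 1

theorem qform_eq (m : Matrix (Fin 3) (Fin 3) ℤ) :
    Qform m = q3 (m 0 0) (m 1 1) (m 2 2) (m 1 2) (m 0 2) (m 0 1) := by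
  funext v
  simp [Qform, q3, Fin.sum_univ_three]
  ring

theorem gram_det (m : Matrix (Fin 3) (Fin 3) ℤ) :
    (gram m).det = 2 * (4 * m 0 0 * m 1 1 * m 2 2 + m 1 2 * m 0 2 * m 0 1
      - m 0 0 * m 1 2 ^ 2 - m 1 1 * m 0 2 ^ 2 - m 2 2 * m 0 1 ^ 2) := by
  simp [Matrix.det_fin_three, gram, Tbil, qform_eq, q3]
  ring

theorem hasDisc_iff (m : Matrix (Fin 3) (Fin 3) ℤ) : HasDisc m 11 ↔
    4 * m 0 0 * m 1 1 * m 2 2 + m 1 2 * m 0 2 * m 0 1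
      - m 0 0 * m 1 2 ^ 2 - m 1 1 * m 0 2 ^ 2 - m 2 2 * m 0 1 ^ 2 = 11 := by
  have h : eps 3 = 1 := by decide
  rw [HasDisc, gram_det, h]
  constructor <;> intro h <;> linarith

theorem fe_trans {f g h : (Fin 3 → ℤ) → ℤ} (h1 : FormEquiv f g) (h2 : FormEquiv g h) :
    FormEquiv f h := by
  obtain ⟨u, hu⟩ := h1
  obtain ⟨w, hw⟩ := h2
  refine ⟨w * u, fun x => ?_⟩
  rw [hw, hu, Matrix.mulVec_mulVec, mul_inv_rev, Units.val_mul]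

theorem fe_step (f g : (Fin 3 → ℤ) → ℤ) (E : Matrix (Fin 3) (Fin 3) ℤ) (hE : IsUnit E.det)
    (h : ∀ v, g v = f (E.mulVec v)) : FormEquiv f g := by
  refine ⟨(Matrix.nonsingInvUnit E hE)⁻¹, fun x => ?_⟩
  rw [inv_inv]
  exact h x

theorem fe_pos {f g : (Fin 3 → ℤ) → ℤ} (h : FormEquiv f g)
    (hf : ∀ v : Fin 3 → ℤ, v ≠ 0 → 0 < f v) : ∀ v : Fin 3 → ℤ, v ≠ 0 → 0 < g v := by
  obtain ⟨u, hu⟩ := h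
  intro v hv
  rw [hu]
  apply hf
  intro h0
  apply hv
  have := congrArg (Matrix.mulVec (u : Matrix (Fin 3) (Fin 3) ℤ)) h0
  rwa [Matrix.mulVec_mulVec, ← Units.val_mul, mul_inv_cancel, Units.val_one, Matrix.one_mulVec,
    Matrix.mulVec_zero] at this

theorem fe_lin (a b c r s t p1 p2 p3 p4 p5 p6 p7 p8 p9 an bn cn rn sn tn : ℤ)
    (hdet : p1 * (p5 * p9 - p6 * p8) - p2 * (p4 * p9 - p6 * p7) + p3 * (p4 * p8 - p5 * p7) = 1 ∨
      p1 * (p5 * p9 - p6 * p8) - p2 * (p4 * p9 - p6 * p7) + p3 * (p4 * p8 - p5 * p7) = -1)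
    (h : an = a * p1 ^ 2 + b * p4 ^ 2 + c * p7 ^ 2 + r * p4 * p7 + s * p1 * p7 + t * p1 * p4 ∧
      bn = a * p2 ^ 2 + b * p5 ^ 2 + c * p8 ^ 2 + r * p5 * p8 + s * p2 * p8 + t * p2 * p5 ∧
      cn = a * p3 ^ 2 + b * p6 ^ 2 + c * p9 ^ 2 + r * p6 * p9 + s * p3 * p9 + t * p3 * p6 ∧
      rn = 2 * a * p2 * p3 + 2 * b * p5 * p6 + 2 * c * p8 * p9 + r * (p5 * p9 + p6 * p8)
        + s * (p2 * p9 + p3 * p8) + t * (p2 * p6 + p3 * p5) ∧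
      sn = 2 * a * p1 * p3 + 2 * b * p4 * p6 + 2 * c * p7 * p9 + r * (p4 * p9 + p6 * p7)
        + s * (p1 * p9 + p3 * p7) + t * (p1 * p6 + p3 * p4) ∧
      tn = 2 * a * p1 * p2 + 2 * b * p4 * p5 + 2 * c * p7 * p8 + r * (p4 * p8 + p5 * p7)
        + s * (p1 * p8 + p2 * p7) + t * (p1 * p5 + p2 * p4)) :
    FormEquiv (q3 a b c r s t) (q3 an bn cn rn sn tn) := by
  obtain ⟨rfl, rfl, rfl, rfl, rfl, rfl⟩ := h
  refine fe_step _ _ !![p1, p2, p3; p4, p5, p6; p7, p8, p9] ?_ ?_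
  · rw [Int.isUnit_iff]
    have : (!![p1, p2, p3; p4, p5, p6; p7, p8, p9]).det =
        p1 * (p5 * p9 - p6 * p8) - p2 * (p4 * p9 - p6 * p7) + p3 * (p4 * p8 - p5 * p7) := by
      simp [Matrix.det_fin_three]
      ring
    rwa [this]
  · intro v
    simp [q3, Matrix.mulVec, dotProduct, Fin.sum_univ_three]
    ring

theorem swap_xy (a b c r s t : ℤ) : FormEquiv (q3 a b c r s t) (q3 b a c s r t) :=
  fe_step _ _ !![0, 1, 0; 1, 0, 0; 0, 0, 1] (by simp [Matrix.det_fin_three])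
    (by intro v; simp [q3, Matrix.mulVec, dotProduct, Fin.sum_univ_three]; ring)

theorem swap_yz (a b c r s t : ℤ) : FormEquiv (q3 a b c r s t) (q3 a c b r t s) :=
  fe_step _ _ !![1, 0, 0; 0, 0, 1; 0, 1, 0] (by simp [Matrix.det_fin_three])
    (by intro v; simp [q3, Matrix.mulVec, dotProduct, Fin.sum_univ_three]; ring)

theorem move_y (a b c r s t e : ℤ) : FormEquiv (q3 a b c r s t)
    (q3 a (b + a * e ^ 2 + t * e) c (r + s * e) s (t + 2 * a * e)) :=
  fe_step _ _ !![1, e, 0; 0, 1, 0; 0, 0, 1] (by simp [Matrix.det_fin_three])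
    (by intro v; simp [q3, Matrix.mulVec, dotProduct, Fin.sum_univ_three]; ring)

theorem move_z (a b c r s t e d : ℤ) : FormEquiv (q3 a b c r s t)
    (q3 a b (c + a * e ^ 2 + b * d ^ 2 + r * d + s * e + t * e * d)
      (r + 2 * b * d + t * e) (s + 2 * a * e + t * d) t) :=
  fe_step _ _ !![1, 0, e; 0, 1, d; 0, 0, 1] (by simp [Matrix.det_fin_three])
    (by intro v; simp [q3, Matrix.mulVec, dotProduct, Fin.sum_univ_three]; ring)

theorem bound_neg (a b c R S T : ℤ) (ha : 1 ≤ a) (hab : a ≤ b) (hbc : b ≤ c)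
    (hR : 0 ≤ R) (hS : 0 ≤ S) (hT : 0 ≤ T) (hRb : R ≤ b) (hSa : S ≤ a) (hTa : T ≤ a)
    (hsum : R + S + T ≤ a + b) :
    a * b * c ≤ 4 * a * b * c - R * S * T - a * R ^ 2 - b * S ^ 2 - c * T ^ 2 := by
  have hb : 0 ≤ b := by linarith
  have hc : 0 ≤ c := by linarith
  have ha0 : 0 ≤ a := by linarith
  have h1 : a * R ^ 2 ≤ a * (b * R) := by
    apply mul_le_mul_of_nonneg_left _ ha0; nlinarith
  have h2 : b * S ^ 2 ≤ b * (a * S) := by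
    apply mul_le_mul_of_nonneg_left _ hb; nlinarith
  have h3 : c * T ^ 2 ≤ c * (a * T) := by
    apply mul_le_mul_of_nonneg_left _ hc; nlinarith
  have h4 : a * b * (R + S + T) ≤ a * b * (a + b) :=
    mul_le_mul_of_nonneg_left hsum (by positivity)
  have h5 : R * S * T ≤ b * a * a := by gcongr
  have h6 : a * (c - b) * T ≤ a * (c - b) * a :=
    mul_le_mul_of_nonneg_left hTa (mul_nonneg ha0 (by linarith))
  have h7 : a * b * a ≤ a * b * c := mul_le_mul_of_nonneg_left (by linarith) (by positivity)
  have h8 : a * b * b ≤ a * b * c := mul_le_mul_of_nonneg_left hbc (by positivity)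
  have h9 : a * c * a ≤ a * c * b := mul_le_mul_of_nonneg_left hab (by positivity)
  nlinarith

theorem bound_all (a b c r s t : ℤ) (ha : 1 ≤ a) (hab : a ≤ b) (hbc : b ≤ c)
    (hr1 : -b ≤ r) (hr2 : r ≤ b) (hs1 : -a ≤ s) (hs2 : s ≤ a) (ht1 : -a ≤ t) (ht2 : t ≤ a)
    (h1 : 0 ≤ a + b + r + s + t) (h2 : 0 ≤ a + b - r + s - t)
    (h3 : 0 ≤ a + b + r - s - t) (h4 : 0 ≤ a + b - r - s + t) :
    a * b * c ≤ 4 * a * b * c + r * s * t - a * r ^ 2 - b * s ^ 2 - c * t ^ 2 := by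
  have hb : 0 ≤ b := by linarith
  have hc : 0 ≤ c := by linarith
  have ha0 : 0 ≤ a := by linarith
  have key : 0 ≤ r * s * t →
      a * b * c ≤ 4 * a * b * c + r * s * t - a * r ^ 2 - b * s ^ 2 - c * t ^ 2 := by
    intro h0
    have e1 : a * r ^ 2 ≤ a * (b * c) := mul_le_mul_of_nonneg_left (by nlinarith) ha0
    have e2 : b * s ^ 2 ≤ b * (a * c) := mul_le_mul_of_nonneg_left (by nlinarith) hb
    have e3 : c * t ^ 2 ≤ c * (a * b) := mul_le_mul_of_nonneg_left (by nlinarith) hc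
    nlinarith
  rcases le_total 0 r with hr | hr <;> rcases le_total 0 s with hs | hs <;>
    rcases le_total 0 t with ht | ht
  · exact key (mul_nonneg (mul_nonneg hr hs) ht)
  · have := bound_neg a b c r s (-t) ha hab hbc hr hs (by linarith) hr2 hs2 (by linarith)
      (by linarith)
    linarith
  · have := bound_neg a b c r (-s) t ha hab hbc hr (by linarith) ht hr2 (by linarith) ht2
      (by linarith)
    linarith
  · exact key (mul_nonneg_of_nonpos_of_nonpos (mul_nonpos_of_nonneg_of_nonpos hr hs) ht)
  · have := bound_neg a b c (-r) s t ha hab hbc (by linarith) hs ht (by linarith) hs2 ht2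
      (by linarith)
    linarith
  · exact key (mul_nonneg_of_nonpos_of_nonpos (mul_nonpos_of_nonpos_of_nonneg hr hs) ht)
  · exact key (mul_nonneg (mul_nonneg_of_nonpos_of_nonpos hr hs) ht)
  · have := bound_neg a b c (-r) (-s) (-t) ha hab hbc (by linarith) (by linarith) (by linarith)
      (by linarith) (by linarith) (by linarith) (by linarith)
    linarith

theorem terminal (a b c r s t : ℤ) (ha : 1 ≤ a) (hab : a ≤ b) (hbc : b ≤ c)
    (hr1 : -b ≤ r) (hr2 : r ≤ b) (hs1 : -a ≤ s) (hs2 : s ≤ a) (ht1 : -a ≤ t) (ht2 : t ≤ a)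
    (h1 : 0 ≤ a + b + r + s + t) (h2 : 0 ≤ a + b - r + s - t)
    (h3 : 0 ≤ a + b + r - s - t) (h4 : 0 ≤ a + b - r - s + t)
    (hD : 4 * a * b * c + r * s * t - a * r ^ 2 - b * s ^ 2 - c * t ^ 2 = 11) :
    FormEquiv (q3 a b c r s t) (q3 1 1 3 1 0 0) ∨
      FormEquiv (q3 a b c r s t) (q3 1 1 4 1 1 1) := by
  have hB := bound_all a b c r s t ha hab hbc hr1 hr2 hs1 hs2 ht1 ht2 h1 h2 h3 h4
  rw [hD] at hB
  have ha2 : a ≤ 2 := by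
    by_contra! h
    have : 3 * 3 ≤ a * b := mul_le_mul (by linarith) (by linarith) (by norm_num) (by linarith)
    nlinarith
  have hb3 : b ≤ 3 := by
    by_contra! h
    have : 1 * 4 ≤ a * b := mul_le_mul (by linarith) (by linarith) (by norm_num) (by linarith)
    nlinarith
  have : (a = 2 ∧ b = 2 ∧ c = 2) ∨ (a = 1 ∧ b ≤ 3) := by
    interval_cases a <;> interval_cases b <;> omega
  rcases this with ⟨rfl, rfl, rfl⟩ | ⟨rfl, hb⟩
  · exfalso
    clear hab hbc hB ha
    interval_cases s <;> interval_cases t <;> interval_cases r <;> omega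
  interval_cases s <;> interval_cases t <;> interval_cases b <;> interval_cases r <;>
  first
    | (exfalso; omega)
    | (rcases (show c = 3 ∨ c = 4 by omega) with rfl | rfl <;> first | (exfalso; omega) | skip)
  all_goals clear * -
  all_goals first
    | exact Or.inl (fe_lin _ _ _ _ _ _ 1 0 0 0 1 0 0 0 (-1) _ _ _ _ _ _ (by decide) (by decide))
    | exact Or.inl (fe_lin _ _ _ _ _ _ 0 1 0 1 0 0 0 0 (-1) _ _ _ _ _ _ (by decide) (by decide))
    | exact Or.inl (fe_lin _ _ _ _ _ _ 0 1 0 1 0 0 0 0 1 _ _ _ _ _ _ (by decide) (by decide))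
    | exact Or.inl (fe_lin _ _ _ _ _ _ 1 0 0 0 1 0 0 0 1 _ _ _ _ _ _ (by decide) (by decide))
    | exact Or.inr (fe_lin _ _ _ _ _ _ 0 1 0 1 0 0 0 0 (-1) _ _ _ _ _ _ (by decide) (by decide))
    | exact Or.inr (fe_lin _ _ _ _ _ _ 0 1 0 1 1 0 0 0 (-1) _ _ _ _ _ _ (by decide) (by decide))
    | exact Or.inr (fe_lin _ _ _ _ _ _ 0 1 0 1 0 1 0 0 1 _ _ _ _ _ _ (by decide) (by decide))
    | exact Or.inr (fe_lin _ _ _ _ _ _ 0 1 0 (-1) 0 0 0 0 1 _ _ _ _ _ _ (by decide) (by decide))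
    | exact Or.inr (fe_lin _ _ _ _ _ _ 0 1 1 (-1) 0 0 0 0 1 _ _ _ _ _ _ (by decide) (by decide))
    | exact Or.inr (fe_lin _ _ _ _ _ _ 0 1 1 1 0 0 0 0 1 _ _ _ _ _ _ (by decide) (by decide))
    | exact Or.inr (fe_lin _ _ _ _ _ _ 0 1 1 (-1) 0 0 0 0 (-1) _ _ _ _ _ _ (by decide) (by decide))
    | exact Or.inr (fe_lin _ _ _ _ _ _ 0 1 1 1 0 0 0 0 (-1) _ _ _ _ _ _ (by decide) (by decide))
    | exact Or.inr (fe_lin _ _ _ _ _ _ 0 1 0 (-1) 0 0 0 0 (-1) _ _ _ _ _ _ (by decide) (by decide))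
    | exact Or.inr (fe_lin _ _ _ _ _ _ 0 1 0 1 1 0 0 0 1 _ _ _ _ _ _ (by decide) (by decide))
    | exact Or.inr (fe_lin _ _ _ _ _ _ 0 1 0 1 0 1 0 0 (-1) _ _ _ _ _ _ (by decide) (by decide))
    | exact Or.inr (fe_lin _ _ _ _ _ _ 0 1 0 1 0 0 0 0 1 _ _ _ _ _ _ (by decide) (by decide))

theorem reduce (n : ℕ) : ∀ a b c r s t : ℤ, 3 * a + 2 * b + c ≤ n →
    (∀ v : Fin 3 → ℤ, v ≠ 0 → 0 < q3 a b c r s t v) →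
    4 * a * b * c + r * s * t - a * r ^ 2 - b * s ^ 2 - c * t ^ 2 = 11 →
    FormEquiv (q3 a b c r s t) (q3 1 1 3 1 0 0) ∨
      FormEquiv (q3 a b c r s t) (q3 1 1 4 1 1 1) := by
  induction n with
  | zero =>
    intro a b c r s t hn hp hD
    have p1 := hp ![1, 0, 0] (by simp)
    have p2 := hp ![0, 1, 0] (by simp)
    have p3 := hp ![0, 0, 1] (by simp)
    simp [q3] at p1 p2 p3 hn
    omega
  | succ n ih =>
    intro a b c r s t hn hp hD
    have p1 := hp ![1, 0, 0] (by simp)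
    simp [q3] at p1
    have go : ∀ an bn cn rn sn tn : ℤ, FormEquiv (q3 a b c r s t) (q3 an bn cn rn sn tn) →
        4 * an * bn * cn + rn * sn * tn - an * rn ^ 2 - bn * sn ^ 2 - cn * tn ^ 2 = 11 →
        3 * an + 2 * bn + cn < 3 * a + 2 * b + c →
        FormEquiv (q3 a b c r s t) (q3 1 1 3 1 0 0) ∨
          FormEquiv (q3 a b c r s t) (q3 1 1 4 1 1 1) := by
      intro an bn cn rn sn tn hE hDn hlt
      have hnn : 3 * an + 2 * bn + cn ≤ n := by push_cast at hn; omega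
      exact (ih an bn cn rn sn tn hnn (fe_pos hE hp) hDn).imp (fe_trans hE) (fe_trans hE)
    by_contra hcon
    have hab : a ≤ b := by
      by_contra! h
      exact hcon (go _ _ _ _ _ _ (swap_xy a b c r s t) (by linarith) (by linarith))
    have hbc : b ≤ c := by
      by_contra! h
      exact hcon (go _ _ _ _ _ _ (swap_yz a b c r s t) (by linarith) (by linarith))
    have hy : ∀ e : ℤ, 0 ≤ a * e ^ 2 + t * e := by
      intro e
      by_contra! h
      exact hcon (go _ _ _ _ _ _ (move_y a b c r s t e) (by rw [← hD]; ring) (by linarith))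
    have hz : ∀ e d : ℤ, 0 ≤ a * e ^ 2 + b * d ^ 2 + r * d + s * e + t * e * d := by
      intro e d
      by_contra! h
      exact hcon (go _ _ _ _ _ _ (move_z a b c r s t e d) (by rw [← hD]; ring) (by linarith))
    have y1 := hy 1
    have y2 := hy (-1)
    have z1 := hz 1 0
    have z2 := hz (-1) 0
    have z3 := hz 0 1
    have z4 := hz 0 (-1)
    have z5 := hz 1 1
    have z6 := hz 1 (-1)
    have z7 := hz (-1) 1
    have z8 := hz (-1) (-1)
    norm_num at y1 y2 z1 z2 z3 z4 z5 z6 z7 z8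
    exact hcon (terminal a b c r s t (by linarith) hab hbc (by linarith) (by linarith)
      (by linarith) (by linarith) (by linarith) (by linarith) (by linarith) (by linarith)
      (by linarith) (by linarith) hD)

theorem qform_Qmat : Qform Qmat = q3 1 1 3 1 0 0 := by
  rw [qform_eq]; simp [Qmat]

theorem qform_Qpmat : Qform Q'mat = q3 1 1 4 1 1 1 := by
  rw [qform_eq]; simp [Q'mat]

theorem pos_of_q3 (f : (Fin 3 → ℤ) → ℤ)
    (h : ∀ v, f v ≤ 0 → v 0 = 0 ∧ v 1 = 0 ∧ v 2 = 0) (v : Fin 3 → ℤ) (hv : v ≠ 0) :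
    0 < f v := by
  by_contra! h0
  obtain ⟨h1, h2, h3⟩ := h v h0
  apply hv
  funext i
  fin_cases i <;> simp [h1, h2, h3]

theorem unit_Q (x y z : ℤ) (h : x ^ 2 + y ^ 2 + 3 * z ^ 2 + y * z = 1) : z = 0 := by
  have : z ^ 2 < 1 := by nlinarith [sq_nonneg (2 * y + z), sq_nonneg x]
  have := sq_nonneg z
  exact pow_eq_zero_iff (two_ne_zero) |>.1 (by linarith)

theorem not_equiv : ¬ FormEquiv (q3 1 1 3 1 0 0) (q3 1 1 4 1 1 1) := by
  rintro ⟨g, hg⟩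
  set M := ((g⁻¹ : GL (Fin 3) ℤ) : Matrix (Fin 3) (Fin 3) ℤ) with hM
  have h1 := hg ![1, 0, 0]
  have h2 := hg ![0, 1, 0]
  have h3 := hg ![1, -1, 0]
  simp [q3, Matrix.mulVec, dotProduct, Fin.sum_univ_three] at h1 h2 h3
  have z1 := unit_Q (M 0 0) (M 1 0) (M 2 0) (by linarith)
  have z2 := unit_Q (M 0 1) (M 1 1) (M 2 1) (by linarith)
  rw [z1] at h1 h3
  rw [z2] at h2 h3
  have : 2 * (1 - M 0 0 * M 0 1 - M 1 0 * M 1 1) = 1 := by linarith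
  omega

/-- there are exactly two `GL₃(ℤ)`-equivalence classes of positive definite
integral ternary quadratic forms with discriminant `11`, represented by
`Q = x² + y² + yz + 3z²` and `Q' = x² + xy + xz + y² + yz + 4z²`; in particular `Q ≁ Q'`. -/
theorem two_ternary_classes_disc_eleven :
    PosDef Qmat ∧ HasDisc Qmat 11 ∧ PosDef Q'mat ∧ HasDisc Q'mat 11 ∧
    ¬ FormEquiv (Qform Qmat) (Qform Q'mat) ∧
    ∀ c : Matrix (Fin 3) (Fin 3) ℤ, PosDef c → HasDisc c 11 →
      (FormEquiv (Qform c) (Qform Qmat) ∨ FormEquiv (Qform c) (Qform Q'mat)) := by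
  refine ⟨?_, ?_, ?_, ?_, ?_, ?_⟩
  · unfold PosDef
    rw [qform_Qmat]
    apply pos_of_q3
    intro v h
    simp only [q3] at h
    have e0 : v 0 ^ 2 = 0 := by nlinarith [sq_nonneg (v 0), sq_nonneg (v 1 + v 2), sq_nonneg (v 1), sq_nonneg (v 2)]
    have e1 : v 1 ^ 2 = 0 := by nlinarith [sq_nonneg (v 0), sq_nonneg (v 1 + v 2), sq_nonneg (v 1), sq_nonneg (v 2)]
    have e2 : v 2 ^ 2 = 0 := by nlinarith [sq_nonneg (v 0), sq_nonneg (v 1 + v 2), sq_nonneg (v 1), sq_nonneg (v 2)]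
    simpa using And.intro e0 (And.intro e1 e2)
  · rw [hasDisc_iff]; simp [Qmat]
  · unfold PosDef
    rw [qform_Qpmat]
    apply pos_of_q3
    intro v h
    simp only [q3] at h
    have s0 := sq_nonneg (v 0 + v 1 + v 2)
    have e0 : v 0 ^ 2 = 0 := by nlinarith [sq_nonneg (v 0), sq_nonneg (v 1), sq_nonneg (v 2)]
    have e1 : v 1 ^ 2 = 0 := by nlinarith [sq_nonneg (v 0), sq_nonneg (v 1), sq_nonneg (v 2)]
    have e2 : v 2 ^ 2 = 0 := by nlinarith [sq_nonneg (v 0), sq_nonneg (v 1), sq_nonneg (v 2)]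
    simpa using And.intro e0 (And.intro e1 e2)
  · rw [hasDisc_iff]; simp [Q'mat]
  · rw [qform_Qmat, qform_Qpmat]
    exact not_equiv
  · intro c hc hD
    rw [hasDisc_iff] at hD
    unfold PosDef at hc
    rw [qform_eq c] at hc ⊢
    rw [qform_Qmat, qform_Qpmat]
    exact reduce (3 * c 0 0 + 2 * c 1 1 + c 2 2).toNat _ _ _ _ _ _ (Int.self_le_toNat _) hc hD
end

section
/- Let n be a positive even integer. There exists a positive definite integral quadratic form in n variables with discriminant 1 (equivalently, a positive definite even unimodular lattice of rank n) if and only if n ≡ 0 (mod 8). -/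
open scoped BigOperators

section aux

open scoped Matrix

open Complex Filter Topology in
theorem aux_split (M d c : ℕ) [NeZero M] (hd : 0 < d) (hM : 2 * c * d = M) (t : ℝ) (ht : 0 < t) :
    jacobiTheta (1 / d + I * t) = ∑ k : Fin M, cexp (2 * Real.pi * I * (c * (k : ℕ) ^ 2 : ℤ) / M) *
      (HurwitzZeta.evenKernel (((k : ℕ) / M : ℝ) : UnitAddCircle) (t * M ^ 2) : ℂ) := by
  have hM0 : (M : ℝ) ≠ 0 := by exact_mod_cast NeZero.ne M
  have hM0' : (M : ℂ) ≠ 0 := by exact_mod_cast NeZero.ne M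
  have hd0 : (d : ℂ) ≠ 0 := by exact_mod_cast hd.ne'
  have hc0 : (c : ℂ) ≠ 0 := by
    intro h
    have : c = 0 := by exact_mod_cast h
    subst this
    exact NeZero.ne M (by simpa using hM.symm)
  have hMc : (M : ℂ) = 2 * c * d := by rw [← hM]; push_cast; ring
  have him : 0 < (1 / d + I * t : ℂ).im := by
    have : (1 / d + I * t : ℂ).im = t := by
      have : (1 / d + I * t : ℂ) = ((1 / d : ℝ) : ℂ) + I * t := by push_cast; rfl
      rw [this]; simp
    rw [this]; exact ht
  have h1 := hasSum_jacobiTheta₂_term 0 him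
  rw [← jacobiTheta_eq_jacobiTheta₂] at h1
  rw [← (Int.divModEquiv M).symm.hasSum_iff, ← (Equiv.prodComm (Fin M) ℤ).hasSum_iff] at h1
  have h2 : ∀ k : Fin M, HasSum (fun n : ℤ => ((jacobiTheta₂_term · 0 (1 / d + I * t)) ∘ (Int.divModEquiv M).symm ∘
      (Equiv.prodComm (Fin M) ℤ)) (k, n)) (cexp (2 * Real.pi * I * (c * (k : ℕ) ^ 2 : ℤ) / M) *
      (HurwitzZeta.evenKernel (((k : ℕ) / M : ℝ) : UnitAddCircle) (t * M ^ 2) : ℂ)) := by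
    intro k
    have h3 := HurwitzZeta.hasSum_int_evenKernel ((k : ℕ) / M : ℝ) (t := t * M ^ 2) (by positivity)
    have h4 := (Complex.hasSum_ofReal.2 h3).mul_left (cexp (2 * Real.pi * I * (c * (k : ℕ) ^ 2 : ℤ) / M))
    refine (congrArg (fun F => HasSum F _) (funext fun n => ?_)).mpr h4
    simp only [Function.comp, Equiv.prodComm_apply, Prod.swap, Int.divModEquiv_symm_apply, jacobiTheta₂_term]
    push_cast
    rw [← Complex.exp_add, Complex.exp_eq_exp_iff_exists_int]
    refine ⟨c * d * 2 * c * n ^ 2 + 2 * c * n * k, ?_⟩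
    push_cast
    have hI : I ^ 2 = -1 := I_sq
    rw [hMc]
    field_simp
    linear_combination (2 * (c:ℂ) * d * n + k) ^ 2 * t * d * hI
  have h5 := HasSum.prod_fiberwise h1 h2
  exact h5.unique (hasSum_fintype _)

open Complex Filter Topology in
theorem aux_cos (a : UnitAddCircle) (r : ℝ) (hr : 0 < r) :
    Tendsto (fun t : ℝ => Real.sqrt t * HurwitzZeta.evenKernel a (t * r ^ 2)) (𝓝[>] 0) (𝓝 (1 / r)) := by
  obtain ⟨p, hp, h⟩ := HurwitzZeta.isBigO_atTop_cosKernel_sub a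
  have h0 : Tendsto (fun x : ℝ => Real.exp (-p * x)) atTop (𝓝 0) := by
    simp only [neg_mul]
    exact Real.tendsto_exp_neg_atTop_nhds_zero.comp (tendsto_id.const_mul_atTop hp)
  have h1 : Tendsto (HurwitzZeta.cosKernel a) atTop (𝓝 1) := by
    simpa using (h.trans_tendsto h0).add_const 1
  have h2 : Tendsto (fun t : ℝ => 1 / (t * r ^ 2)) (𝓝[>] 0) atTop := by
    have : Tendsto (fun t : ℝ => t⁻¹ * (r ^ 2)⁻¹) (𝓝[>] 0) atTop :=
      tendsto_inv_nhdsGT_zero.atTop_mul_const (by positivity)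
    refine this.congr fun t => ?_
    rw [one_div, mul_inv]
  have h3 := (h1.comp h2).const_mul (1 / r)
  rw [mul_one] at h3
  refine h3.congr' ?_
  filter_upwards [self_mem_nhdsWithin] with t ht
  have ht : 0 < t := ht
  rw [HurwitzZeta.evenKernel_functional_equation, ← Real.sqrt_eq_rpow, Real.sqrt_mul ht.le,
    Real.sqrt_sq hr.le]
  have : Real.sqrt t ≠ 0 := by positivity
  simp only [Function.comp]
  field_simp

open Complex Filter Topology in
theorem aux_period (m : ℕ) (τ : ℂ) : jacobiTheta (τ + 2 * m) = jacobiTheta τ := by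
  induction m with
  | zero => simp
  | succ m ih =>
    rw [← ih, ← jacobiTheta_two_add (τ + 2 * m)]
    congr 1
    push_cast; ring

open Complex Filter Topology in
theorem aux_fe (τ : ℂ) : jacobiTheta τ = 1 / (-I * τ) ^ (1 / 2 : ℂ) * jacobiTheta (-1 / τ) := by
  have := jacobiTheta₂_functional_equation 0 τ
  simpa [← jacobiTheta_eq_jacobiTheta₂] using this

open Complex Filter Topology in
theorem aux_lim (m : ℕ) (hm : 0 < m) :
    Tendsto (fun t : ℝ => (Real.sqrt t : ℂ) * jacobiTheta (1 / (2 * m : ℕ) + I * t)) (𝓝[>] 0)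
      (𝓝 (1 / (-I * (1 / (2 * m : ℕ))) ^ (1 / 2 : ℂ) * (1 / (((2 * m : ℕ) : ℂ) / (1 / (2 * m : ℕ))) ^ (1 / 2 : ℂ)))) := by
  set d : ℕ := 2 * m with hd
  have hdpos : 0 < d := by omega
  have hd0 : (d : ℂ) ≠ 0 := by exact_mod_cast hdpos.ne'
  have hdr : (0 : ℝ) < d := by exact_mod_cast hdpos
  have hτ : Tendsto (fun t : ℝ => (1 / d + I * t : ℂ)) (𝓝[>] 0) (𝓝 (1 / d)) := by
    have : Continuous (fun t : ℝ => (1 / d + I * t : ℂ)) := by fun_prop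
    have := this.tendsto 0
    simp only [ofReal_zero, mul_zero, add_zero] at this
    exact this.mono_left nhdsWithin_le_nhds
  have hs1 : -I * (1 / d : ℂ) ∈ slitPlane := by
    right
    have : -I * (1 / d : ℂ) = ((-(1 / d) : ℝ) : ℂ) * I := by push_cast; ring
    rw [this]
    simp [hdpos.ne']
  have hs2 : (d : ℂ) / (1 / d) ∈ slitPlane := by
    have : (d : ℂ) / (1 / d) = ((d * d : ℝ) : ℂ) := by push_cast; field_simp
    rw [this]
    exact ofReal_mem_slitPlane.2 (by positivity)
  have n1 : (-I * (1 / d : ℂ)) ^ (1 / 2 : ℂ) ≠ 0 := by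
    rw [Ne, cpow_eq_zero_iff]; exact fun h => slitPlane_ne_zero hs1 h.1
  have n2 : ((d : ℂ) / (1 / d)) ^ (1 / 2 : ℂ) ≠ 0 := by
    rw [Ne, cpow_eq_zero_iff]; exact fun h => slitPlane_ne_zero hs2 h.1
  have l1 : Tendsto (fun t : ℝ => 1 / (-I * (1 / d + I * t : ℂ)) ^ (1 / 2 : ℂ)) (𝓝[>] 0)
      (𝓝 (1 / (-I * (1 / d : ℂ)) ^ (1 / 2 : ℂ))) :=
    tendsto_const_nhds.div ((hτ.const_mul (-I)).cpow tendsto_const_nhds hs1) n1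
  have l2 : Tendsto (fun t : ℝ => 1 / ((d : ℂ) / (1 / d + I * t : ℂ)) ^ (1 / 2 : ℂ)) (𝓝[>] 0)
      (𝓝 (1 / ((d : ℂ) / (1 / d : ℂ)) ^ (1 / 2 : ℂ))) :=
    tendsto_const_nhds.div ((tendsto_const_nhds.div hτ (by simpa using hd0)).cpow tendsto_const_nhds hs2) n2
  have l3 : Tendsto (fun t : ℝ => jacobiTheta (I / (t * d ^ 2) - 1 / d)) (𝓝[>] 0) (𝓝 1) := by
    have him : ∀ t : ℝ, (I / (t * d ^ 2) - 1 / d : ℂ).im = 1 / (t * d ^ 2) := by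
      intro t
      have : (I / (t * d ^ 2) - 1 / d : ℂ) = ((1 / (t * d ^ 2) : ℝ) : ℂ) * I - ((1 / d : ℝ) : ℂ) := by
        push_cast; ring
      rw [this]
      rw [sub_im, im_ofReal_mul, I_im, mul_one, ofReal_im, sub_zero]
    have h2 : Tendsto (fun t : ℝ => 1 / (t * (d : ℝ) ^ 2)) (𝓝[>] 0) atTop := by
      have : Tendsto (fun t : ℝ => t⁻¹ * ((d : ℝ) ^ 2)⁻¹) (𝓝[>] 0) atTop :=
        tendsto_inv_nhdsGT_zero.atTop_mul_const (by positivity)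
      refine this.congr fun t => ?_
      rw [one_div, mul_inv]
    have h3 : Tendsto (fun t : ℝ => (I / (t * d ^ 2) - 1 / d : ℂ)) (𝓝[>] 0) (comap im atTop) := by
      rw [tendsto_comap_iff]
      refine h2.congr fun t => (him t).symm
    have h4 : Tendsto (fun τ : ℂ => Real.exp (-Real.pi * τ.im)) (comap im atTop) (𝓝 0) := by
      simp only [neg_mul]
      exact Real.tendsto_exp_neg_atTop_nhds_zero.comp
        ((tendsto_id.const_mul_atTop Real.pi_pos).comp tendsto_comap)
    have h5 := (isBigO_at_im_infty_jacobiTheta_sub_one.trans_tendsto h4).comp h3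
    simpa [Function.comp_def] using h5.add_const 1
  have l4 := (l1.mul l2).mul l3
  rw [mul_one] at l4
  refine l4.congr' ?_
  filter_upwards [self_mem_nhdsWithin] with t ht
  have ht : 0 < t := ht
  have htc : (t : ℂ) ≠ 0 := by exact_mod_cast ht.ne'
  have hτ0 : (1 / d + I * t : ℂ) ≠ 0 := by
    intro h
    have := congrArg im h
    have h' : (1 / d + I * t : ℂ) = ((1 / d : ℝ) : ℂ) + I * t := by push_cast; rfl
    rw [h'] at this
    simp at this
    exact ht.ne' this
  rw [aux_fe (1 / d + I * t)]
  have e1 : jacobiTheta (-1 / (1 / d + I * t)) = jacobiTheta (I * t * d / (1 / d + I * t)) := by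
    rw [← aux_period m]
    congr 1
    have : (2 * m : ℂ) = d := by rw [hd]; push_cast; ring
    rw [this]
    rw [div_add' _ _ _ hτ0]
    congr 1
    field_simp
    ring
  rw [e1, aux_fe (I * t * d / (1 / d + I * t))]
  have e2 : -1 / (I * t * d / (1 / d + I * t)) = (I / (t * d ^ 2) - 1 / d : ℂ) := by
    have hI : I ^ 2 = -1 := I_sq
    field_simp
    linear_combination (-1 : ℂ) * hI
  have e3 : -I * (I * t * d / (1 / d + I * t)) = (t : ℝ) * ((d : ℂ) / (1 / d + I * t)) := by
    calc _ = -(I * I) * (t * ((d : ℂ) / (1 / d + I * t))) := by ring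
      _ = _ := by rw [I_mul_I]; ring
  have hz : (d : ℂ) / (1 / d + I * t) ≠ 0 := div_ne_zero hd0 hτ0
  have e4 : ((t : ℝ) * ((d : ℂ) / (1 / d + I * t))) ^ (1 / 2 : ℂ) =
      (Real.sqrt t : ℂ) * ((d : ℂ) / (1 / d + I * t)) ^ (1 / 2 : ℂ) := by
    rw [cpow_def_of_ne_zero (mul_ne_zero htc hz), cpow_def_of_ne_zero hz, Complex.log_ofReal_mul ht hz,
      add_mul, Complex.exp_add]
    congr 1
    rw [Real.sqrt_eq_rpow, Real.rpow_def_of_pos ht]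
    push_cast; rfl
  rw [e2, e3, e4]
  have hsq : (Real.sqrt t : ℂ) ≠ 0 := by
    have : Real.sqrt t ≠ 0 := by positivity
    exact_mod_cast this
  have hz2 : ((d : ℂ) / (1 / d + I * t)) ^ (1 / 2 : ℂ) ≠ 0 := by
    rw [Ne, cpow_eq_zero_iff]; exact fun h => hz h.1
  rw [one_div ((Real.sqrt t : ℂ) * _), mul_inv, one_div (((d : ℂ) / (1 / d + I * t)) ^ (1 / 2 : ℂ))]
  calc _ = ((Real.sqrt t : ℂ) * (Real.sqrt t : ℂ)⁻¹) * (1 / (-I * (1 / ↑d + I * ↑t)) ^ (1 / 2 : ℂ) * (((d : ℂ) / (1 / ↑d + I * ↑t)) ^ (1 / 2 : ℂ))⁻¹ *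
      jacobiTheta (I / (↑t * ↑d ^ 2) - 1 / ↑d)) := by rw [mul_inv_cancel₀ hsq, one_mul]
    _ = _ := by ring

open Complex Filter Topology in
theorem aux_gauss (M d c : ℕ) [NeZero M] (hd : 0 < d) (hde : Even d) (hM : 2 * c * d = M) :
    ∃ r : ℝ, 0 < r ∧ ∑ k : ZMod M, ZMod.stdAddChar ((c : ZMod M) * k ^ 2) =
      r * cexp (Real.pi / 4 * I) := by
  obtain ⟨m, hm⟩ := hde
  have hm : d = 2 * m := by omega
  have hMp : (0 : ℝ) < M := by exact_mod_cast Nat.pos_of_ne_zero (NeZero.ne M)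
  have hdp : (0 : ℝ) < d := by exact_mod_cast hd
  have hd0 : (d : ℂ) ≠ 0 := by exact_mod_cast hd.ne'
  have e0 : ∑ k : ZMod M, ZMod.stdAddChar ((c : ZMod M) * k ^ 2) =
      ∑ k : Fin M, cexp (2 * Real.pi * I * (c * (k : ℕ) ^ 2 : ℤ) / M) := by
    symm
    refine Fintype.sum_bijective (fun k : Fin M => ((k : ℕ) : ZMod M)) ?_ _ _ ?_
    · rw [Fintype.bijective_iff_injective_and_card]
      refine ⟨fun a b h => ?_, by simp [ZMod.card]⟩
      have h' : ((a : ℕ) : ZMod M) = ((b : ℕ) : ZMod M) := h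
      rw [ZMod.natCast_eq_natCast_iff', Nat.mod_eq_of_lt a.2, Nat.mod_eq_of_lt b.2] at h'
      exact Fin.ext h'
    · intro k
      rw [← ZMod.stdAddChar_coe]
      congr 1
      push_cast; rfl
  have L1 := aux_lim m (by omega)
  rw [← hm] at L1
  have L2 : Tendsto (fun t : ℝ => (Real.sqrt t : ℂ) * jacobiTheta (1 / d + I * t)) (𝓝[>] 0)
      (𝓝 (∑ k : Fin M, cexp (2 * Real.pi * I * (c * (k : ℕ) ^ 2 : ℤ) / M) * ((1 / M : ℝ) : ℂ))) := by
    have : Tendsto (fun t : ℝ => ∑ k : Fin M, cexp (2 * Real.pi * I * (c * (k : ℕ) ^ 2 : ℤ) / M) *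
        ((Real.sqrt t * HurwitzZeta.evenKernel (((k : ℕ) / M : ℝ) : UnitAddCircle) (t * M ^ 2) : ℝ) : ℂ)) (𝓝[>] 0)
      (𝓝 (∑ k : Fin M, cexp (2 * Real.pi * I * (c * (k : ℕ) ^ 2 : ℤ) / M) * ((1 / M : ℝ) : ℂ))) := by
      refine tendsto_finsetSum _ fun k _ => ?_
      exact ((continuous_ofReal.tendsto _).comp (aux_cos _ _ hMp)).const_mul _
    refine this.congr' ?_
    filter_upwards [self_mem_nhdsWithin] with t ht
    rw [aux_split M d c hd hM t ht, Finset.mul_sum]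
    refine Finset.sum_congr rfl fun k _ => ?_
    push_cast; ring
  have E := tendsto_nhds_unique L2 L1
  rw [← Finset.sum_mul, ← e0] at E
  refine ⟨M / Real.sqrt d, by positivity, ?_⟩
  have c1 : ((d : ℂ) / (1 / d)) ^ (1 / 2 : ℂ) = d := by
    have : (d : ℂ) / (1 / d) = ((d ^ 2 : ℝ) : ℂ) := by push_cast; field_simp
    rw [this]
    have h2 : (1 / 2 : ℂ) = ((1 / 2 : ℝ) : ℂ) := by push_cast; rfl
    rw [h2, ← ofReal_cpow (by positivity), ← Real.sqrt_eq_rpow, Real.sqrt_sq hdp.le]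
    simp
  have c2 : (-I * (1 / d : ℂ)) ^ (1 / 2 : ℂ) = (1 / Real.sqrt d : ℝ) * cexp (-(Real.pi / 4 * I)) := by
    have h : (-I * (1 / d : ℂ)) = ((1 / d : ℝ) : ℂ) * -I := by push_cast; ring
    have hI : (-I) ≠ 0 := by simp
    have hp : (0 : ℝ) < 1 / d := by positivity
    rw [h, cpow_def_of_ne_zero (mul_ne_zero (by exact_mod_cast hp.ne') hI), Complex.log_ofReal_mul hp hI,
      add_mul, Complex.exp_add, Complex.log_neg_I]
    congr 1
    · rw [← Real.sqrt_one, ← Real.sqrt_div zero_le_one, Real.sqrt_one, Real.sqrt_eq_rpow, Real.rpow_def_of_pos hp]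
      push_cast; rfl
    · congr 1; ring
  rw [c1, c2, Complex.exp_neg] at E
  have hs : (Real.sqrt d : ℂ) ≠ 0 := by
    have : Real.sqrt d ≠ 0 := by positivity
    exact_mod_cast this
  have hM0 : (M : ℂ) ≠ 0 := by exact_mod_cast hMp.ne'
  have hss : (Real.sqrt d : ℂ) * Real.sqrt d = d := by
    rw [← ofReal_mul, Real.mul_self_sqrt hdp.le]; simp
  push_cast at E ⊢
  have he := Complex.exp_ne_zero (Real.pi / 4 * I)
  set S := ∑ k : ZMod M, ZMod.stdAddChar ((c : ZMod M) * k ^ 2)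
  have E2 : S = M * (S * (1 / M)) := by field_simp
  rw [E2, E, ← hss]
  field_simp

theorem aux_hform {n : ℕ} {R : Type*} [CommRing R] (A U P C : Matrix (Fin n) (Fin n) R) (N : R)
    (hA : A = U + Uᵀ) (hC : Cᵀ = C) (hW : (A * P * C) * Pᵀ = N • (1 : Matrix (Fin n) (Fin n) R)) (hN : 2 * N = 0)
    (k y : Fin n → R) :
    (Pᵀ *ᵥ (A *ᵥ y)) ⬝ᵥ (C *ᵥ (Pᵀ *ᵥ (A *ᵥ y))) = 0 ∧
    (k + Pᵀ *ᵥ (A *ᵥ y)) ⬝ᵥ (C *ᵥ (k + Pᵀ *ᵥ (A *ᵥ y))) =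
      k ⬝ᵥ (C *ᵥ k) + (2 • ((A * P * C) *ᵥ k)) ⬝ᵥ y := by
  have hAt : Aᵀ = A := by rw [hA, Matrix.transpose_add, Matrix.transpose_transpose, add_comm]
  have hU : ∀ y, y ⬝ᵥ (A *ᵥ y) = 2 * (y ⬝ᵥ (U *ᵥ y)) := by
    intro y
    rw [hA, Matrix.add_mulVec, dotProduct_add]
    have : y ⬝ᵥ (Uᵀ *ᵥ y) = y ⬝ᵥ (U *ᵥ y) := by
      rw [Matrix.mulVec_transpose, dotProduct_comm, ← Matrix.dotProduct_mulVec]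
    rw [this]; ring
  have key : ∀ k, (Pᵀ *ᵥ (A *ᵥ y)) ⬝ᵥ (C *ᵥ k) = ((A * P * C) *ᵥ k) ⬝ᵥ y := by
    intro k
    rw [Matrix.mulVec_mulVec, dotProduct_comm, dotProduct_comm _ y, Matrix.dotProduct_mulVec,
      Matrix.vecMul_mulVec]
    have : (Pᵀ * A)ᵀ * C = A * P * C := by
      rw [Matrix.transpose_mul, Matrix.transpose_transpose, hAt]
    rw [dotProduct_comm]
    congr 1
    rw [← this, ← Matrix.mulVec_transpose]
    congr 1
    simp [Matrix.transpose_mul, hC, hAt]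
  have key2 : ∀ h k : Fin n → R, h ⬝ᵥ (C *ᵥ k) = k ⬝ᵥ (C *ᵥ h) := by
    intro h k
    rw [dotProduct_comm, Matrix.dotProduct_mulVec k, ← Matrix.mulVec_transpose, hC]
  have h0 : (Pᵀ *ᵥ (A *ᵥ y)) ⬝ᵥ (C *ᵥ (Pᵀ *ᵥ (A *ᵥ y))) = 0 := by
    rw [key, Matrix.mulVec_mulVec, hW, Matrix.smul_mulVec, Matrix.one_mulVec, smul_dotProduct,
      dotProduct_comm, hU, smul_eq_mul]
    linear_combination (y ⬝ᵥ (U *ᵥ y)) * hN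
  refine ⟨h0, ?_⟩
  rw [Matrix.mulVec_add, add_dotProduct, dotProduct_add, dotProduct_add, h0, key2 k (Pᵀ *ᵥ (A *ᵥ y)), key, smul_dotProduct, two_smul]
  ring

theorem aux_charsum {n M : ℕ} [NeZero M] (v : Fin n → ZMod M) :
    ∑ y : Fin n → ZMod M, ZMod.stdAddChar (v ⬝ᵥ y) =
      if v = 0 then (Fintype.card (Fin n → ZMod M) : ℂ) else 0 := by
  classical
  split_ifs with h
  · simp [h]
  · let f : (Fin n → ZMod M) →+ ZMod M :=
      { toFun := fun y => v ⬝ᵥ y, map_zero' := by simp, map_add' := fun a b => dotProduct_add _ _ _ }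
    let χ := (ZMod.stdAddChar (N := M)).compAddMonoidHom f
    have : ∑ y, χ y = 0 := by
      rw [AddChar.sum_eq_zero_iff_ne_zero]
      intro h0
      apply h
      funext i
      have h1 : χ (Pi.single i 1) = 1 := by rw [h0]; rfl
      have h2 : ZMod.stdAddChar (v ⬝ᵥ Pi.single i 1) = 1 := h1
      rw [dotProduct_single, mul_one, ← (ZMod.stdAddChar (N := M)).map_zero_eq_one] at h2
      exact ZMod.injective_stdAddChar h2
    exact this

theorem aux_pos {n M : ℕ} [NeZero M] (A U P C Ai : Matrix (Fin n) (Fin n) ℤ) (N : ℤ) (hN0 : N ≠ 0)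
    (hMN : (M : ℤ) = 2 * N) (hA : A = U + Uᵀ) (hAi : A * Ai = 1) (hC : Cᵀ = C)
    (hW' : Pᵀ * (A * P * C) = N • (1 : Matrix (Fin n) (Fin n) ℤ)) :
    ∃ K : ℕ, 0 < K ∧ ∑ k : Fin n → ZMod M,
      ZMod.stdAddChar (k ⬝ᵥ ((C.map (Int.cast : ℤ → ZMod M)) *ᵥ k)) = (K : ℂ) := by
  classical
  have hW : (A * P * C) * Pᵀ = N • (1 : Matrix (Fin n) (Fin n) ℤ) := by
    have hdet : Pᵀ.det ≠ 0 := by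
      intro h
      have := congrArg Matrix.det hW'
      rw [Matrix.det_mul, h, zero_mul, Matrix.det_smul, Matrix.det_one, mul_one] at this
      exact pow_ne_zero _ hN0 this.symm
    have h1 : Pᵀ * ((A * P * C) * Pᵀ - N • (1 : Matrix (Fin n) (Fin n) ℤ)) = 0 := by
      rw [mul_sub, ← mul_assoc, hW', smul_mul_assoc, mul_smul_comm, one_mul, mul_one, sub_self]
    have h2 := congrArg (fun X => Pᵀ.adjugate * X) h1
    simp only [← mul_assoc, Matrix.adjugate_mul, mul_zero, Matrix.smul_mul, one_mul] at h2
    have h3 := (smul_eq_zero.1 h2).resolve_left hdet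
    exact sub_eq_zero.1 (by simpa [mul_assoc] using h3)
  let φ : Matrix (Fin n) (Fin n) ℤ →+* Matrix (Fin n) (Fin n) (ZMod M) := (Int.castRingHom (ZMod M)).mapMatrix
  have hφ : ∀ X, X.map (Int.cast : ℤ → ZMod M) = φ X := fun X => rfl
  have hφt : ∀ X, φ Xᵀ = (φ X)ᵀ := fun X => rfl
  have hφv : ∀ (X : Matrix (Fin n) (Fin n) ℤ) (v : Fin n → ℤ), φ X *ᵥ (fun i => (v i : ZMod M)) = fun i => ((X *ᵥ v) i : ZMod M) := by
    intro X v
    funext i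
    simp [φ, Matrix.mulVec, dotProduct]
  have bA : φ A = φ U + (φ U)ᵀ := by rw [← hφt, ← map_add, ← hA]
  have bC : (φ C)ᵀ = φ C := by rw [← hφt, hC]
  have bW : (φ A * φ P * φ C) * (φ P)ᵀ = (N : ZMod M) • (1 : Matrix (Fin n) (Fin n) (ZMod M)) := by
    rw [← hφt, ← map_mul, ← map_mul, ← map_mul, hW]
    ext i j
    change (((N • (1 : Matrix (Fin n) (Fin n) ℤ)) i j : ℤ) : ZMod M) = _
    rw [Matrix.smul_apply, Matrix.smul_apply]
    by_cases hij : i = j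
    · subst hij; simp
    · simp [hij]
  have bN : 2 * (N : ZMod M) = 0 := by
    have : ((M : ℤ) : ZMod M) = ((2 * N : ℤ) : ZMod M) := by rw [hMN]
    push_cast at this
    rw [← this]; simp
  have key := aux_hform (φ A) (φ U) (φ P) (φ C) (N : ZMod M) bA bC bW bN
  rw [hφ]
  set W := φ A * φ P * φ C with hWdef
  have triv : ∀ k : Fin n → ZMod M, 2 • (W *ᵥ k) = 0 → k ⬝ᵥ (φ C *ᵥ k) = 0 := by
    intro k hk
    obtain ⟨kz, rfl⟩ : ∃ kz : Fin n → ℤ, k = fun i => (kz i : ZMod M) := by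
      choose kz hkz using fun i => ZMod.intCast_surjective (k i)
      exact ⟨kz, funext fun i => (hkz i).symm⟩
    have h1 : ∀ i, ∃ z : ℤ, ((A * P * C) *ᵥ kz) i = N * z := by
      intro i
      have h := congrFun hk i
      rw [hWdef, ← map_mul, ← map_mul, hφv] at h
      have h' : ((2 * ((A * P * C) *ᵥ kz) i : ℤ) : ZMod M) = 0 := by
        push_cast
        simpa [two_mul, two_smul] using h
      rw [ZMod.intCast_zmod_eq_zero_iff_dvd] at h'
      obtain ⟨z, hz⟩ := h'
      refine ⟨z, ?_⟩
      rw [hMN] at hz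
      have : (2 : ℤ) * ((A * P * C) *ᵥ kz) i = 2 * (N * z) := by rw [hz]; ring
      exact mul_left_cancel₀ two_ne_zero this
    choose z hz using h1
    have h2 : (A * P * C) *ᵥ kz = N • z := by funext i; simpa using hz i
    have h3 : Pᵀ *ᵥ ((A * P * C) *ᵥ kz) = N • kz := by
      rw [Matrix.mulVec_mulVec, hW', Matrix.smul_mulVec, Matrix.one_mulVec]
    rw [h2, Matrix.mulVec_smul] at h3
    have h4 : kz = Pᵀ *ᵥ z := by
      funext i
      have := congrFun h3 i
      simp only [Pi.smul_apply, smul_eq_mul] at this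
      exact (mul_left_cancel₀ hN0 this).symm
    have h5 : kz = Pᵀ *ᵥ (A *ᵥ (Ai *ᵥ z)) := by
      rw [Matrix.mulVec_mulVec z, hAi, Matrix.one_mulVec, ← h4]
    have h6 : (fun i => (kz i : ZMod M)) = (φ P)ᵀ *ᵥ (φ A *ᵥ (fun i => ((Ai *ᵥ z) i : ZMod M))) := by
      rw [hφv, ← hφt, hφv, ← h5]
    rw [h6]
    exact (key 0 _).1
  set S := ∑ k : Fin n → ZMod M, ZMod.stdAddChar (k ⬝ᵥ (φ C *ᵥ k)) with hS
  have hcard : (Fintype.card (Fin n → ZMod M) : ℂ) ≠ 0 := Nat.cast_ne_zero.2 Fintype.card_ne_zero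
  have e1 : (Fintype.card (Fin n → ZMod M) : ℂ) * S =
      ∑ y : Fin n → ZMod M, ∑ k : Fin n → ZMod M, ZMod.stdAddChar (k ⬝ᵥ (φ C *ᵥ k)) *
        ZMod.stdAddChar ((2 • (W *ᵥ k)) ⬝ᵥ y) := by
    have : ∀ y : Fin n → ZMod M, ∑ k : Fin n → ZMod M, ZMod.stdAddChar (k ⬝ᵥ (φ C *ᵥ k)) *
        ZMod.stdAddChar ((2 • (W *ᵥ k)) ⬝ᵥ y) = S := by
      intro y
      refine Fintype.sum_equiv (Equiv.addRight ((φ P)ᵀ *ᵥ (φ A *ᵥ y))) _ _ fun k => ?_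
      rw [← AddChar.map_add_eq_mul, ← (key k y).2]
      rfl
    rw [Finset.sum_congr rfl fun y _ => this y]
    simp
  rw [Finset.sum_comm] at e1
  simp_rw [← Finset.mul_sum, aux_charsum] at e1
  have e2 : S = ((Finset.univ.filter fun k : Fin n → ZMod M => 2 • (W *ᵥ k) = 0).card : ℂ) := by
    apply mul_left_cancel₀ hcard
    rw [e1, Finset.card_filter]
    push_cast
    rw [Finset.mul_sum]
    refine Finset.sum_congr rfl fun k _ => ?_
    by_cases hk : 2 • (W *ᵥ k) = 0
    · rw [if_pos hk, if_pos hk, triv k hk]; simp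
    · rw [if_neg hk, if_neg hk]; simp
  refine ⟨_, ?_, e2⟩
  rw [Finset.card_pos]
  exact ⟨0, by simp⟩

theorem aux_final (n : ℕ) (r : Fin n → ℝ) (hr : ∀ i, 0 < r i) (K : ℕ) (hK : 0 < K)
    (h : ∏ i, ((r i : ℂ) * Complex.exp (Real.pi / 4 * Complex.I)) = K) : 8 ∣ n := by
  rw [Finset.prod_mul_distrib, Finset.prod_const, Finset.card_univ, Fintype.card_fin, ← Complex.ofReal_prod,
    ← Complex.exp_nat_mul] at h
  have hR : 0 < ∏ i, r i := Finset.prod_pos fun i _ => hr i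
  set R := ∏ i, r i
  have hx : (n : ℂ) * (Real.pi / 4 * Complex.I) = ((n * (Real.pi / 4) : ℝ) : ℂ) * Complex.I := by
    push_cast; ring
  have hn := congrArg norm h
  rw [hx, norm_mul, Complex.norm_exp_ofReal_mul_I, mul_one, Complex.norm_real, Complex.norm_natCast,
    Real.norm_of_nonneg hR.le] at hn
  have hK0 : (K : ℂ) ≠ 0 := Nat.cast_ne_zero.2 hK.ne'
  rw [hn] at h
  have h1 : Complex.exp ((n : ℂ) * (Real.pi / 4 * Complex.I)) = 1 := by
    apply mul_left_cancel₀ hK0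
    rw [mul_one]; simpa using h
  rw [Complex.exp_eq_one_iff] at h1
  obtain ⟨m, hm⟩ := h1
  have hp : (Real.pi : ℂ) ≠ 0 := by exact_mod_cast Real.pi_ne_zero
  have h2 : (n : ℂ) = 8 * m := by
    have : (Real.pi * Complex.I : ℂ) * n = (Real.pi * Complex.I) * (8 * m) := by linear_combination 4 * hm
    exact mul_left_cancel₀ (mul_ne_zero hp Complex.I_ne_zero) this
  have h3 : (n : ℤ) = 8 * m := by exact_mod_cast h2
  omega

theorem aux_addchar_sum {ι R : Type*} [AddCommMonoid R] (ψ : AddChar R ℂ) (s : Finset ι) (f : ι → R) :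
    ψ (∑ i ∈ s, f i) = ∏ i ∈ s, ψ (f i) := by
  classical
  induction s using Finset.induction_on with
  | empty => simp
  | insert a s ha ih => rw [Finset.sum_insert ha, Finset.prod_insert ha, AddChar.map_add_eq_mul, ih]

theorem aux_main {n : ℕ} (A U P Ai : Matrix (Fin n) (Fin n) ℤ) (d : Fin n → ℕ) (hd : ∀ i, 0 < d i)
    (hde : ∀ i, Even (d i)) (hA : A = U + Uᵀ) (hAi : A * Ai = 1)
    (hP : Pᵀ * A * P = Matrix.diagonal fun i => (d i : ℤ)) : 8 ∣ n := by
  classical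
  let N : ℕ := ∏ i, d i
  let c : Fin n → ℕ := fun i => ∏ j ∈ Finset.univ.erase i, d j
  have hN : 0 < N := Finset.prod_pos fun i _ => hd i
  have hcd : ∀ i, d i * c i = N := fun i => Finset.mul_prod_erase _ _ (Finset.mem_univ i)
  let M : ℕ := 2 * N
  have : NeZero M := ⟨by omega⟩
  obtain ⟨K, hK, hS⟩ := aux_pos (M := M) A U P (Matrix.diagonal fun i => (c i : ℤ)) Ai N
    (by exact_mod_cast hN.ne') (by simp [M]) hA hAi (Matrix.diagonal_transpose _) (by
      rw [← mul_assoc, ← mul_assoc, hP, Matrix.diagonal_mul_diagonal, Matrix.smul_one_eq_diagonal]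
      congr 1
      funext i
      exact_mod_cast hcd i)
  have hg := fun i => aux_gauss M (d i) (c i) (hd i) (hde i) (by
    show 2 * c i * d i = 2 * N
    rw [← hcd i]; ring)
  choose r hr hrg using hg
  refine aux_final n r hr K hK ?_
  rw [← hS]
  simp_rw [← hrg]
  rw [Finset.prod_univ_sum, Fintype.piFinset_univ]
  refine Finset.sum_congr rfl fun k _ => ?_
  rw [← aux_addchar_sum]
  congr 1
  simp only [dotProduct]
  refine Finset.sum_congr rfl fun i _ => ?_
  rw [Matrix.diagonal_map (by simp), Matrix.mulVec_diagonal]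
  push_cast
  ring

theorem aux_diag {n : ℕ} (A : Matrix (Fin n) (Fin n) ℤ) (hA : Aᵀ = A) :
    ∃ P : Matrix (Fin n) (Fin n) ℤ, (∀ i j, i ≠ j → (Pᵀ * A * P) i j = 0) ∧ ∀ i, Pᵀ i ≠ 0 := by
  classical
  have : Invertible (2 : ℚ) := invertibleOfNonzero two_ne_zero
  let B : LinearMap.BilinForm ℚ (Fin n → ℚ) := Matrix.toBilin' (A.map (Int.cast : ℤ → ℚ))
  have hBa : ∀ x y, B x y = x ⬝ᵥ (A.map (Int.cast : ℤ → ℚ)) *ᵥ y := fun x y => Matrix.toBilin'_apply' _ _ _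
  have hB : LinearMap.IsSymm B := by
    refine ⟨fun x y => ?_⟩
    simp only [RingHom.id_apply]
    rw [hBa, hBa, dotProduct_comm, Matrix.dotProduct_mulVec, ← Matrix.mulVec_transpose, ← Matrix.transpose_map, hA]
  obtain ⟨v0, hv0⟩ := LinearMap.BilinForm.exists_orthogonal_basis hB
  have hfr : Module.finrank ℚ (Fin n → ℚ) = n := by simp
  let v := v0.reindex (finCongr hfr)
  have hv : ∀ i j, i ≠ j → B (v i) (v j) = 0 := by
    intro i j hij
    simp only [v, Module.Basis.reindex_apply]
    exact hv0 (fun h => hij ((finCongr hfr).symm.injective h))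
  have hint : ∀ i, ∃ b : ℤ, b ≠ 0 ∧ ∃ p : Fin n → ℤ, ∀ j, (p j : ℚ) = b * v i j := by
    intro i
    obtain ⟨b, hb⟩ := IsLocalization.exist_integer_multiples_of_finite (nonZeroDivisors ℤ) (v i)
    choose p hp using hb
    refine ⟨b, nonZeroDivisors.coe_ne_zero b, p, fun j => ?_⟩
    have := hp j
    simpa using this
  choose b hb p hp using hint
  refine ⟨(Matrix.of p)ᵀ, ?_, ?_⟩
  · intro i j hij
    rw [Matrix.transpose_transpose]
    have : (((Matrix.of p * A * (Matrix.of p)ᵀ) i j : ℤ) : ℚ) = b i * b j * B (v i) (v j) := by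
      rw [hBa, Matrix.mul_assoc]
      simp only [Matrix.mul_apply, dotProduct, Matrix.mulVec, Matrix.of_apply,
        Matrix.transpose_apply, Matrix.map_apply]
      push_cast
      simp only [hp, Finset.mul_sum]
      refine Finset.sum_congr rfl fun x _ => Finset.sum_congr rfl fun y _ => ?_
      ring
    rw [hv i j hij, mul_zero] at this
    exact_mod_cast this
  · intro i h
    apply v.ne_zero i
    funext j
    have h1 : p i j = 0 := congrFun h j
    have h2 := hp i j
    rw [h1] at h2
    have h3 : (b i : ℚ) ≠ 0 := by exact_mod_cast hb i
    simpa [h3] using h2.symm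

/-- upper-triangular coefficient matrix -/
def upperPart {n : ℕ} (a : Matrix (Fin n) (Fin n) ℤ) : Matrix (Fin n) (Fin n) ℤ :=
  Matrix.of fun i j => if i ≤ j then a i j else 0

theorem Qform_eq {n : ℕ} (a : Matrix (Fin n) (Fin n) ℤ) (x : Fin n → ℤ) :
    Qform a x = x ⬝ᵥ (upperPart a *ᵥ x) := by
  simp only [Qform, upperPart, dotProduct, Matrix.mulVec, Matrix.of_apply, Finset.mul_sum]
  refine Finset.sum_congr rfl fun i _ => Finset.sum_congr rfl fun j _ => ?_
  split_ifs <;> ring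

theorem gram_eq {n : ℕ} (a : Matrix (Fin n) (Fin n) ℤ) : gram a = upperPart a + (upperPart a)ᵀ := by
  ext i j
  simp only [gram, Tbil, Qform_eq, Matrix.of_apply, Matrix.add_apply, Matrix.transpose_apply,
    Matrix.mulVec_add, add_dotProduct, dotProduct_add]
  simp
  ring

theorem aux_forward {n : ℕ} (heven : Even n) (a : Matrix (Fin n) (Fin n) ℤ) (hpos : PosDef a) (hdisc : HasDisc a 1) :
    8 ∣ n := by
  have hdet : (gram a).det = 1 := by
    have := hdisc
    simpa [HasDisc, eps, heven] using this
  have hA := gram_eq a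
  have hAt : (gram a)ᵀ = gram a := by rw [hA, Matrix.transpose_add, Matrix.transpose_transpose, add_comm]
  obtain ⟨P, hP, hP0⟩ := aux_diag (gram a) hAt
  have hq : ∀ i, (Pᵀ * gram a * P) i i = 2 * Qform a (Pᵀ i) := by
    intro i
    have h1 : (Pᵀ * gram a * P) i i = Pᵀ i ⬝ᵥ (gram a *ᵥ (Pᵀ i)) := by
      rw [Matrix.mul_assoc]
      simp only [Matrix.mul_apply, dotProduct, Matrix.mulVec, Matrix.transpose_apply]
    rw [h1, hA, Matrix.add_mulVec, dotProduct_add, Qform_eq]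
    have : Pᵀ i ⬝ᵥ ((upperPart a)ᵀ *ᵥ Pᵀ i) = Pᵀ i ⬝ᵥ (upperPart a *ᵥ Pᵀ i) := by
      rw [Matrix.mulVec_transpose, dotProduct_comm, ← Matrix.dotProduct_mulVec]
    rw [this]; ring
  have hq0 : ∀ i, 0 < Qform a (Pᵀ i) := fun i => hpos _ (hP0 i)
  refine aux_main (gram a) (upperPart a) P (gram a)⁻¹ (fun i => 2 * (Qform a (Pᵀ i)).toNat)
    (fun i => by have := hq0 i; omega) (fun i => even_two_mul _) hA
    (Matrix.mul_nonsing_inv _ (by rw [hdet]; exact isUnit_one)) ?_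
  ext i j
  by_cases hij : i = j
  · subst hij
    rw [Matrix.diagonal_apply_eq, hq]
    have := hq0 i
    push_cast
    omega
  · rw [Matrix.diagonal_apply_ne _ hij, hP i j hij]

/-- coefficients of the `E₈` form -/
def e8c : Matrix (Fin 8) (Fin 8) ℤ :=
  !![1, -1, 0, 0, 0, 0, 0, 0; 0, 1, -1, 0, 0, 0, 0, 0; 0, 0, 1, -1, 0, 0, 0, 0; 0, 0, 0, 1, 0, 0, 0, -1; 0, 0, 0, 0, 1, -1, 0, 0; 0, 0, 0, 0, 0, 1, 0, -1; 0, 0, 0, 0, 0, 0, 1, -1; 0, 0, 0, 0, 0, 0, 0, 1]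

def e8b : Matrix (Fin 8) (Fin 8) ℤ :=
  !![1, 1, 1, 1, 0, 0, 0, 6; 0, 2, 2, 2, 0, 0, 0, 12; 0, 0, 3, 3, 0, 0, 0, 18; 0, 0, 0, 4, 0, 0, 0, 24; 0, 0, 0, 0, 1, 1, 0, 10; 0, 0, 0, 0, 0, 2, 0, 20; 0, 0, 0, 0, 0, 0, 1, 15; 0, 0, 0, 0, 0, 0, 0, 30]

def e8l : Matrix (Fin 8) (Fin 8) ℤ :=
  !![2, 0, 0, 0, 0, 0, 0, 0; -1, 3, 0, 0, 0, 0, 0, 0; 0, -2, 4, 0, 0, 0, 0, 0; 0, 0, -3, 5, 0, 0, 0, 0; 0, 0, 0, 0, 2, 0, 0, 0; 0, 0, 0, 0, -1, 3, 0, 0; 0, 0, 0, 0, 0, 0, 2, 0; 0, 0, 0, -4, 0, -2, -1, 1]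

theorem e8_mul : (upperPart e8c + (upperPart e8c)ᵀ) * e8b = e8l := by
  ext i j
  fin_cases i <;> fin_cases j <;> rfl

theorem e8_det : (gram e8c).det = 1 := by
  rw [gram_eq]
  have h := congrArg Matrix.det e8_mul
  have hb : e8b.det = 1440 := by
    have hz : ∀ i j : Fin 8, j < i → e8b i j = 0 := by
      intro i j h
      fin_cases i <;> fin_cases j <;> first | rfl | exact absurd h (by decide)
    rw [Matrix.det_of_isUpperTriangular (fun i j h => hz i j h)]
    rfl
  have hl : e8l.det = 1440 := by
    have hz : ∀ i j : Fin 8, i < j → e8l i j = 0 := by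
      intro i j h
      fin_cases i <;> fin_cases j <;> first | rfl | exact absurd h (by decide)
    rw [Matrix.det_of_isLowerTriangular e8l (fun i j h => hz i j h)]
    rfl
  rw [Matrix.det_mul, hb, hl] at h
  omega

theorem e8_form (x : Fin 8 → ℤ) : 120 * (x ⬝ᵥ (upperPart e8c *ᵥ x)) =
    30 * (2 * x 0 - x 1) ^ 2 + 10 * (3 * x 1 - 2 * x 2) ^ 2 + 5 * (4 * x 2 - 3 * x 3) ^ 2 +
    3 * (5 * x 3 - 4 * x 7) ^ 2 + 30 * (2 * x 4 - x 5) ^ 2 + 10 * (3 * x 5 - 2 * x 7) ^ 2 +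
    30 * (2 * x 6 - x 7) ^ 2 + 2 * x 7 ^ 2 := by
  have hu : upperPart e8c = e8c := by
    ext i j
    fin_cases i <;> fin_cases j <;> rfl
  rw [hu]
  simp [e8c, dotProduct, Matrix.mulVec, Fin.sum_univ_eight]
  ring

theorem e8_nonneg (x : Fin 8 → ℤ) : 0 ≤ x ⬝ᵥ (upperPart e8c *ᵥ x) := by
  have h := e8_form x
  have : 0 ≤ 120 * (x ⬝ᵥ (upperPart e8c *ᵥ x)) := by rw [h]; positivity
  omega

theorem e8_zero (x : Fin 8 → ℤ) (hx : x ⬝ᵥ (upperPart e8c *ᵥ x) = 0) : x = 0 := by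
  have h := e8_form x
  rw [hx] at h
  have h1 := sq_nonneg (2 * x 0 - x 1)
  have h2 := sq_nonneg (3 * x 1 - 2 * x 2)
  have h3 := sq_nonneg (4 * x 2 - 3 * x 3)
  have h4 := sq_nonneg (5 * x 3 - 4 * x 7)
  have h5 := sq_nonneg (2 * x 4 - x 5)
  have h6 := sq_nonneg (3 * x 5 - 2 * x 7)
  have h7 := sq_nonneg (2 * x 6 - x 7)
  have h8 := sq_nonneg (x 7)
  have z8 : x 7 = 0 := pow_eq_zero_iff two_ne_zero |>.1 (by linarith : x 7 ^ 2 = 0)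
  have z7 := pow_eq_zero_iff two_ne_zero |>.1 (by linarith : (2 * x 6 - x 7) ^ 2 = 0)
  have z6 := pow_eq_zero_iff two_ne_zero |>.1 (by linarith : (3 * x 5 - 2 * x 7) ^ 2 = 0)
  have z5 := pow_eq_zero_iff two_ne_zero |>.1 (by linarith : (2 * x 4 - x 5) ^ 2 = 0)
  have z4 := pow_eq_zero_iff two_ne_zero |>.1 (by linarith : (5 * x 3 - 4 * x 7) ^ 2 = 0)
  have z3 := pow_eq_zero_iff two_ne_zero |>.1 (by linarith : (4 * x 2 - 3 * x 3) ^ 2 = 0)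
  have z2 := pow_eq_zero_iff two_ne_zero |>.1 (by linarith : (3 * x 1 - 2 * x 2) ^ 2 = 0)
  have z1 := pow_eq_zero_iff two_ne_zero |>.1 (by linarith : (2 * x 0 - x 1) ^ 2 = 0)
  funext i
  fin_cases i <;> simp <;> omega

/-- coefficients of the orthogonal sum of `m` copies of the `E₈` form -/
def e8sum (m : ℕ) : Matrix (Fin (m * 8)) (Fin (m * 8)) ℤ :=
  Matrix.of fun i j => if i.divNat = j.divNat then e8c i.modNat j.modNat else 0

def e8idx (m : ℕ) : Fin 8 × Fin m ≃ Fin (m * 8) := (Equiv.prodComm _ _).trans finProdFinEquiv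

theorem e8sum_upper (m : ℕ) : (upperPart (e8sum m)).submatrix (e8idx m) (e8idx m) =
    Matrix.blockDiagonal fun _ => upperPart e8c := by
  ext ⟨r, b⟩ ⟨s, b'⟩
  have h1 : ∀ (r : Fin 8) (b : Fin m), (e8idx m (r, b)).divNat = b ∧ (e8idx m (r, b)).modNat = r := by
    intro r b
    have := finProdFinEquiv.symm_apply_apply (b, r)
    exact Prod.ext_iff.1 this
  have h2 : ∀ (r : Fin 8) (b : Fin m), (e8idx m (r, b) : ℕ) = r + 8 * b := fun r b => rfl
  simp only [Matrix.submatrix_apply, Matrix.blockDiagonal_apply, upperPart, e8sum, Matrix.of_apply, h1]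
  by_cases hb : b = b'
  · subst hb
    have hle : e8idx m (r, b) ≤ e8idx m (s, b) ↔ r ≤ s := by
      rw [Fin.le_def, h2, h2, Fin.le_def]; omega
    simp only [hle, if_true]
  · simp [hb]

theorem e8sum_disc (m : ℕ) : (gram (e8sum m)).det = 1 := by
  rw [← Matrix.det_submatrix_equiv_self (e8idx m)]
  have : (gram (e8sum m)).submatrix (e8idx m) (e8idx m) = Matrix.blockDiagonal fun _ => gram e8c := by
    rw [gram_eq, gram_eq]
    have h := e8sum_upper m
    ext p q
    have h1 := congrFun (congrFun h p) q
    have h2 := congrFun (congrFun h q) p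
    simp only [Matrix.submatrix_apply, Matrix.add_apply, Matrix.transpose_apply] at h1 h2 ⊢
    rw [h1, h2]
    by_cases hb : p.2 = q.2
    · simp [Matrix.blockDiagonal_apply, hb]
    · simp [Matrix.blockDiagonal_apply, hb, Ne.symm hb]
  rw [this, Matrix.det_blockDiagonal]
  simp [e8_det]

theorem e8sum_form (m : ℕ) (x : Fin (m * 8) → ℤ) : Qform (e8sum m) x =
    ∑ b : Fin m, (fun r => x (e8idx m (r, b))) ⬝ᵥ (upperPart e8c *ᵥ fun r => x (e8idx m (r, b))) := by
  rw [Qform_eq]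
  simp only [dotProduct, Matrix.mulVec]
  rw [← (e8idx m).sum_comp, Fintype.sum_prod_type_right]
  refine Finset.sum_congr rfl fun b _ => Finset.sum_congr rfl fun r _ => ?_
  congr 1
  rw [← (e8idx m).sum_comp, Fintype.sum_prod_type_right]
  have h : ∀ p q, upperPart (e8sum m) (e8idx m p) (e8idx m q) = Matrix.blockDiagonal (fun _ => upperPart e8c) p q :=
    fun p q => congrFun (congrFun (e8sum_upper m) p) q
  simp only [h, Matrix.blockDiagonal_apply]
  rw [Finset.sum_eq_single b]
  · simp
  · intro b' _ hb
    simp [Ne.symm hb]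
  · simp

theorem e8sum_pos (m : ℕ) : PosDef (e8sum m) := by
  intro x hx
  rw [e8sum_form]
  refine lt_of_le_of_ne (Finset.sum_nonneg fun b _ => e8_nonneg _) fun h => hx ?_
  have h0 := (Finset.sum_eq_zero_iff_of_nonneg fun b _ => e8_nonneg _).1 h.symm
  funext i
  obtain ⟨⟨r, b⟩, rfl⟩ := (e8idx m).surjective i
  exact congrFun (e8_zero _ (h0 b (Finset.mem_univ b))) r

end aux

/-- for a positive even integer `n`, there exists a positive definite
integral quadratic form in `n` variables with discriminant `1` (equivalently, a positive
definite even unimodular lattice of rank `n`) if and only if `8 ∣ n`. -/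
theorem even_unimodular_exists_iff (n : ℕ) (hn : 0 < n) (heven : Even n) :
    (∃ a : Matrix (Fin n) (Fin n) ℤ, PosDef a ∧ HasDisc a 1) ↔ 8 ∣ n := by
  constructor
  · rintro ⟨a, hpos, hdisc⟩
    exact aux_forward heven a hpos hdisc
  · rintro ⟨m, rfl⟩
    rw [mul_comm]
    refine ⟨e8sum m, e8sum_pos m, ?_⟩
    have he : Even (m * 8) := by rw [mul_comm]; exact heven
    unfold HasDisc
    rw [e8sum_disc]
    simp [eps, he]
end
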